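/- Let K be a finite dimensional compact metric space of basic type (i.e. dim K² = 2·dim K) and let σ: K^ℤ → K^ℤ be the full shift on the alphabet K. Then the mean dimension of (K^ℤ, σ) equals dim K. -/

import Mathlib

open Filter Set
open scoped ENNReal

namespace MeanDimPaper

variable {X : Type*} [TopologicalSpace X]

/-- `α` is an open cover of `X`. -/
def IsOpenCover (α : Set (Set X)) : Prop :=
  (∀ U ∈ α, IsOpen U) ∧ ⋃₀ α = Set.univ

/-- The order of a cover `α`: the maximum `n ≥ 0` such that there exist `n + 1`
pairwise distinct members of `α` with nonempty common intersection. -/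
noncomputable def ord (α : Set (Set X)) : ℕ∞ :=
  ⨆ n ∈ {n : ℕ | ∃ f : Fin (n + 1) → Set X,
      Function.Injective f ∧ (∀ i, f i ∈ α) ∧ (⋂ i, f i).Nonempty}, (n : ℕ∞)

/-- `β` refines `α`: every member of `β` is contained in some member of `α`. -/
def Refines (β α : Set (Set X)) : Prop := ∀ V ∈ β, ∃ U ∈ α, V ⊆ U

/-- `D(α)`: the minimum of `ord β` over open covers `β` refining `α`. -/
noncomputable def covD (α : Set (Set X)) : ℕ∞ :=
  ⨅ β ∈ {β : Set (Set X) | IsOpenCover β ∧ Refines β α}, ord β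

/-- Topological (covering) dimension: the supremum of `D(α)` over open covers `α`. -/
noncomputable def topDim (X : Type*) [TopologicalSpace X] : ℕ∞ :=
  ⨆ α ∈ {α : Set (Set X) | IsOpenCover α}, covD α

/-- Diameter of a set with respect to a distance function `d`. -/
noncomputable def diamD (d : X → X → ℝ) (U : Set X) : ℝ :=
  sSup {r | ∃ x ∈ U, ∃ y ∈ U, r = d x y}

/-- Mesh of a cover: the supremum of the diameters of its members. -/
noncomputable def mesh (d : X → X → ℝ) (α : Set (Set X)) : ℝ :=
  sSup (diamD d '' α)

/-- `widim_ε(X, d)`: the minimum of `D(α)` over open covers `α` with `mesh(α, d) < ε`. -/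
noncomputable def widim (ε : ℝ) (d : X → X → ℝ) : ℕ∞ :=
  ⨅ α ∈ {α : Set (Set X) | IsOpenCover α ∧ mesh d α < ε}, covD α

/-- `d` is a metric on `X` compatible with the topology of `X`. -/
structure IsCompatMetric {X : Type*} [TopologicalSpace X] (d : X → X → ℝ) : Prop where
  refl : ∀ x, d x x = 0
  eq_of : ∀ x y, d x y = 0 → x = y
  symm : ∀ x y, d x y = d y x
  triangle : ∀ x y z, d x z ≤ d x y + d y z
  isOpen_iff : ∀ U : Set X, IsOpen U ↔ ∀ x ∈ U, ∃ ε > 0, ∀ y, d x y < ε → y ∈ U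

/-- The dynamical distance `d_n(x, y) = max_{0 ≤ i < n} d(Tⁱ x, Tⁱ y)`. -/
noncomputable def dynDist (d : X → X → ℝ) (T : X → X) (n : ℕ) (x y : X) : ℝ :=
  sSup {r | ∃ i < n, r = d (T^[i] x) (T^[i] y)}

/-- Mean dimension `mdim(X, T)` computed with the metric `d`:
`lim_{ε → 0} lim_{n → ∞} widim_ε(X, d_n) / n`.  The inner limit exists (by
subadditivity of `n ↦ widim_ε(X, d_n)`) so it coincides with the liminf, and the inner
quantity is monotone as `ε` decreases, so the limit as `ε → 0` is the supremum over
`ε > 0`. -/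
noncomputable def mdim (T : X → X) (d : X → X → ℝ) : ℝ≥0∞ :=
  ⨆ (ε : ℝ) (_ : 0 < ε),
    Filter.liminf (fun n : ℕ => (widim ε (dynDist d T n) : ℝ≥0∞) / (n : ℝ≥0∞)) Filter.atTop

/-- The full shift `σ` on the alphabet `K`: `σ((xₙ)ₙ) = (xₙ₊₁)ₙ`. -/
def shift (K : Type*) : (ℤ → K) → ℤ → K := fun x n => x (n + 1)

section Part1
section Cochains
variable {X : Type*} {R : Type*} [CommRing R]

/-- slice of a cochain -/
def sl {X R : Type*} (c : List X → R) (x : X) : List X → R := fun l => c (x :: l)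

@[simp] lemma sl_apply {X R : Type*} (c : List X → R) (x : X) (l : List X) : sl c x l = c (x :: l) := rfl

/-- Alexander-Spanier coboundary -/
def cobd {X R : Type*} [CommRing R] : (List X → R) → List X → R
  | _, [] => 0
  | c, x :: l => c l - cobd (fun l' => c (x :: l')) l

@[simp] lemma cobd_nil (c : List X → R) : cobd c [] = 0 := rfl
lemma cobd_cons (c : List X → R) (x : X) (l : List X) :
    cobd c (x :: l) = c l - cobd (sl c x) l := rfl

lemma sl_cobd (c : List X → R) (x : X) : sl (cobd c) x = c - cobd (sl c x) := rfl

lemma cobd_congr {c c' : List X → R} {l : List X}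
    (h : ∀ l', l'.Sublist l → l'.length + 1 = l.length → c l' = c' l') : cobd c l = cobd c' l := by
  induction l generalizing c c' with
  | nil => rfl
  | cons x l ih =>
    rw [cobd_cons, cobd_cons, h l (List.sublist_cons_self x l) rfl]
    congr 1
    apply ih
    intro l' hl hlen
    exact h _ (hl.cons_cons x) (by simp [hlen])

lemma cobd_sub (c c' : List X → R) (l : List X) : cobd (c - c') l = cobd c l - cobd c' l := by
  induction l generalizing c c' with
  | nil => simp
  | cons x l ih =>
    have : sl (c - c') x = sl c x - sl c' x := rfl
    rw [cobd_cons, cobd_cons, cobd_cons, this, ih]; simp only [Pi.sub_apply]; ring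

@[simp] lemma cobd_zero (l : List X) : cobd (0 : List X → R) l = 0 := by
  have := cobd_sub (0 : List X → R) 0 l
  simpa using this

lemma cobd_zero' {c : List X → R} {l : List X}
    (h : ∀ l', l'.Sublist l → l'.length + 1 = l.length → c l' = 0) : cobd c l = 0 := by
  rw [cobd_congr (c' := 0) h, cobd_zero]

lemma cobd_neg (c : List X → R) (l : List X) : cobd (-c) l = - cobd c l := by
  have := cobd_sub 0 c l
  simpa using this

lemma cobd_add (c c' : List X → R) (l : List X) : cobd (c + c') l = cobd c l + cobd c' l := by
  have := cobd_sub c (-c') l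
  rw [cobd_neg] at this
  simpa using this

lemma cobd_smul (a : R) (c : List X → R) (l : List X) : cobd (a • c) l = a * cobd c l := by
  induction l generalizing c with
  | nil => simp
  | cons x l ih =>
    have : sl (a • c) x = a • sl c x := rfl
    rw [cobd_cons, cobd_cons, this, ih]; simp only [Pi.smul_apply, smul_eq_mul]; ring

lemma cobd_smul' (a : R) (c : List X → R) (l : List X) : cobd (fun l => a * c l) l = a * cobd c l :=
  cobd_smul a c l

lemma cobd_cobd (c : List X → R) (l : List X) : cobd (cobd c) l = 0 := by
  induction l generalizing c with
  | nil => simp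
  | cons x l ih => rw [cobd_cons, sl_cobd, cobd_sub, ih]; ring

lemma cobd_ringHom {S : Type*} [CommRing S] (f : R →+* S) (c : List X → R) (l : List X) :
    cobd (fun l => f (c l)) l = f (cobd c l) := by
  induction l generalizing c with
  | nil => simp
  | cons x l ih =>
    rw [cobd_cons, cobd_cons, map_sub, ← ih]; rfl

lemma cobd_map {Y : Type*} (g : X → Y) (c : List Y → R) (l : List X) :
    cobd (fun l => c (l.map g)) l = cobd c (l.map g) := by
  induction l generalizing c with
  | nil => simp
  | cons x l ih =>
    rw [List.map_cons, cobd_cons, cobd_cons, ← ih]; rfl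

lemma cobd_linear {ι : Type*} (Z : (ι → R) →ₗ[R] R) (c : ι → List X → R) (l : List X) :
    Z (fun i => cobd (c i) l) = cobd (fun l' => Z (fun i => c i l')) l := by
  induction l generalizing c with
  | nil => exact map_zero Z
  | cons x l ih =>
    rw [cobd_cons]
    have := ih (fun i => sl (c i) x)
    have h2 : sl (fun l' => Z (fun i => c i l')) x = fun l' => Z (fun i => sl (c i) x l') := rfl
    rw [h2, ← this, ← map_sub]; rfl

lemma cobd_comm {Y : Type*} (F : List X → List Y → R) (σ : List X) (τ : List Y) :
    cobd (fun σ' => cobd (fun τ' => F σ' τ') τ) σ = cobd (fun τ' => cobd (fun σ' => F σ' τ') σ) τ := by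
  induction σ generalizing F with
  | nil => exact (cobd_zero τ).symm
  | cons x σ ih =>
    have := ih (fun σ' τ' => F (x :: σ') τ')
    have h1 := cobd_sub (fun τ' => F σ τ') (fun τ' => cobd (fun σ' => F (x :: σ') τ') σ) τ
    rw [cobd_cons]
    rw [← this] at h1
    exact h1.symm

/-- vanishing on lists of length `n` with adjacent duplicates -/
def NormLen (n : ℕ) (c : List X → R) : Prop := ∀ a x b, (a ++ x :: x :: b).length = n → c (a ++ x :: x :: b) = 0

def Normalized (c : List X → R) : Prop := ∀ n, NormLen n c

lemma Normalized.sl {c : List X → R} (h : Normalized c) (x : X) : Normalized (sl c x) :=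
  fun _ a y b _ => h _ (x :: a) y b rfl

lemma Normalized.sl_sl {c : List X → R} (h : Normalized c) (x : X) :
    MeanDimPaper.sl (MeanDimPaper.sl c x) x = 0 := by
  ext l; exact h _ [] x l rfl

lemma NormLen.cobd {n : ℕ} {c : List X → R} (h : NormLen n c) : NormLen (n+1) (cobd c) := by
  intro a x b hl
  induction a generalizing c n with
  | nil =>
    simp only [List.nil_append]
    rw [cobd_cons, cobd_cons, cobd_zero' (c := MeanDimPaper.sl (MeanDimPaper.sl c x) x)]
    · simp
    · intro l' _ h2
      refine h [] x l' ?_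
      simp at hl ⊢; omega
  | cons y a ih =>
    rw [List.cons_append, cobd_cons]
    rcases n with _ | n
    · simp at hl
    rw [h a x b (by simpa using hl), ih (n := n) (c := MeanDimPaper.sl c y) _ (by simpa using hl)]
    · simp
    · intro a' x' b' h'
      exact h (y :: a') x' b' (by simpa using h')

lemma Normalized.cobd {c : List X → R} (h : Normalized c) : Normalized (cobd c) := by
  intro n
  rcases n with _ | n
  · intro a x b hl; simp at hl
  · exact (h n).cobd

end Cochains

section SopDef
variable {X : Type*} {R : Type*} [CommRing R] [LinearOrder X] (φ : X → X)

/-- minimum of `φ` over a nonempty list -/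
def vmin (x : X) (l : List X) : X := l.foldr (fun y a => min (φ y) a) (φ x)

lemma vmin_mem (x : X) (l : List X) : ∃ y ∈ x :: l, vmin φ x l = φ y := by
  induction l with
  | nil => exact ⟨x, by simp, rfl⟩
  | cons z l ih =>
    obtain ⟨y, hy, h⟩ := ih
    have : vmin φ x (z :: l) = min (φ z) (vmin φ x l) := rfl
    rw [this]
    rcases min_choice (φ z) (vmin φ x l) with h' | h'
    · exact ⟨z, by simp, h'⟩
    · refine ⟨y, ?_, by rw [h', h]⟩
      simp at hy ⊢; tauto

lemma vmin_le (x : X) (l : List X) : ∀ y ∈ x :: l, vmin φ x l ≤ φ y := by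
  induction l with
  | nil => intro y hy; simp at hy; subst hy; exact le_rfl
  | cons z l ih =>
    intro y hy
    have : vmin φ x (z :: l) = min (φ z) (vmin φ x l) := rfl
    rw [this]
    simp only [List.mem_cons] at hy ih
    rcases hy with h | h | h
    · exact (min_le_right _ _).trans (ih y (Or.inl h))
    · subst h; exact min_le_left _ _
    · exact (min_le_right _ _).trans (ih y (Or.inr h))

def Saux : ℕ → (List X → R) → List X → R
  | 0, c, l => c l
  | _ + 1, _, [] => 0
  | k + 1, c, x :: l => cobd (Saux k (sl c (vmin φ x l))) (x :: l)

def Sop (c : List X → R) (l : List X) : R := Saux φ l.length c l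

@[simp] lemma Sop_nil (c : List X → R) : Sop φ c [] = c [] := rfl

lemma Sop_cons (c : List X → R) (x : X) (l : List X) :
    Sop φ c (x :: l) = cobd (Sop φ (sl c (vmin φ x l))) (x :: l) := by
  rw [Sop, List.length_cons, Saux]
  apply cobd_congr
  intro l' _ h
  rw [Sop]
  simp at h
  rw [h]

lemma list_len_induct {P : List X → Prop} (h0 : P [])
    (h : ∀ x l, (∀ l', l'.length = l.length → P l') → P (x :: l)) : ∀ l, P l := by
  intro l
  induction hn : l.length generalizing l with
  | zero => rw [List.length_eq_zero_iff.1 hn]; exact h0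
  | succ n ih =>
    rcases l with _ | ⟨x, l⟩
    · exact h0
    · exact h x l (fun l' hl' => ih l' (by simp at hn; omega))

lemma Sop_sub (c c' : List X → R) (l : List X) : Sop φ (c - c') l = Sop φ c l - Sop φ c' l := by
  revert c c'
  refine list_len_induct (P := fun l => ∀ c c' : List X → R, Sop φ (c - c') l = Sop φ c l - Sop φ c' l) ?_ ?_ l
  · intro c c'; simp
  · intro x l ih c c'
    rw [Sop_cons, Sop_cons, Sop_cons, ← cobd_sub]
    apply cobd_congr
    intro l' _ h
    exact ih l' (by simpa using h) _ _

lemma Sop_cobd (c : List X → R) (l : List X) : Sop φ (cobd c) l = cobd (Sop φ c) l := by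
  revert c
  refine list_len_induct (P := fun l => ∀ c : List X → R, Sop φ (cobd c) l = cobd (Sop φ c) l) ?_ ?_ l
  · intro c; simp
  · intro x l ih c
    rw [Sop_cons, sl_cobd]
    have : Sop φ (c - cobd (sl c (vmin φ x l))) = Sop φ c - Sop φ (cobd (sl c (vmin φ x l))) := by
      ext l'; exact Sop_sub φ _ _ l'
    rw [this, cobd_sub]
    have h2 : cobd (Sop φ (cobd (sl c (vmin φ x l)))) (x :: l) = cobd (cobd (Sop φ (sl c (vmin φ x l)))) (x :: l) := by
      apply cobd_congr
      intro l' _ h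
      exact ih l' (by simpa using h) _
    rw [h2, cobd_cobd, sub_zero]

lemma Sop_congr (c c' : List X → R) (l : List X)
    (h : ∀ l' : List X, l'.length = l.length → l'.Pairwise (· ≤ ·) → (∀ y ∈ l', ∃ x ∈ l, y = φ x) →
      c l' = c' l') : Sop φ c l = Sop φ c' l := by
  revert c c'
  refine list_len_induct (P := fun l => ∀ c c' : List X → R, (∀ l' : List X, l'.length = l.length → l'.Pairwise (· ≤ ·) → (∀ y ∈ l', ∃ x ∈ l, y = φ x) →
      c l' = c' l') → Sop φ c l = Sop φ c' l) ?_ ?_ l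
  · intro c c' h; exact h [] rfl (by simp) (by simp)
  · intro x l ih c c' h
    rw [Sop_cons, Sop_cons]
    apply cobd_congr
    intro l' hl' hlen
    apply ih l' (by simpa using hlen)
    intro l2 h1 h2 h3
    apply h
    · simp at hlen ⊢; omega
    · rw [List.pairwise_cons]
      refine ⟨?_, h2⟩
      intro y hy
      obtain ⟨z, hz, rfl⟩ := h3 y hy
      exact vmin_le φ x l z (hl'.subset hz)
    · intro y hy
      rcases List.mem_cons.1 hy with rfl | hy
      · exact vmin_mem φ x l
      · obtain ⟨z, hz, rfl⟩ := h3 y hy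
        exact ⟨z, hl'.subset hz, rfl⟩

lemma Sop_normalized (c : List X → R) : Normalized (Sop φ c) := by
  intro n
  induction n generalizing c with
  | zero => intro a x b h; simp at h
  | succ n ih =>
    intro a x b h
    obtain ⟨y, l, hyl⟩ : ∃ y l, a ++ x :: x :: b = y :: l := by
      cases a with
      | nil => exact ⟨_, _, rfl⟩
      | cons y a => exact ⟨_, _, rfl⟩
    rw [hyl, Sop_cons, ← hyl]
    exact (ih _).cobd a x b h

lemma vmin_id_sorted {x : X} {l : List X} (h : (x :: l).Pairwise (· ≤ ·)) : vmin id x l = x := by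
  apply le_antisymm
  · exact vmin_le id x l x (by simp)
  · obtain ⟨y, hy, h2⟩ := vmin_mem id x l
    rw [h2]
    rcases List.mem_cons.1 hy with rfl | hy
    · exact le_rfl
    · exact (List.pairwise_cons.1 h).1 y hy

lemma Sop_id_sorted {c : List X → R} (hc : Normalized c) {l : List X} (h : l.Pairwise (· ≤ ·)) :
    Sop id c l = c l := by
  revert c
  revert h
  refine list_len_induct (P := fun l => l.Pairwise (· ≤ ·) → ∀ {c : List X → R}, Normalized c → Sop id c l = c l) ?_ ?_ l
  · intros; rfl
  · intro x l ih h c hc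
    rw [Sop_cons, vmin_id_sorted h, cobd_cons, ih l rfl (List.pairwise_cons.1 h).2 (hc.sl x),
      cobd_zero', sub_zero]; rfl
    intro l' h1 h2
    rw [sl_apply, ih (x :: l') (by simpa using h2) (h.sublist (h1.cons_cons x)) (hc.sl x)]
    exact congrFun (hc.sl_sl x) l'

end SopDef

section Hop
variable {X : Type*} {R : Type*} [CommRing R] (T : (List X → R) → List X → R)

def Haux : ℕ → (List X → R) → List X → R
  | 0, _, _ => 0
  | _ + 1, _, [] => 0
  | k + 1, c, x :: l => c (x :: x :: l) - T (sl c x) (x :: l) - cobd (Haux k (sl c x)) (x :: l)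

def Hop (c : List X → R) (l : List X) : R := Haux T l.length c l

@[simp] lemma Hop_nil (c : List X → R) : Hop T c [] = 0 := rfl

lemma Hop_cons (c : List X → R) (x : X) (l : List X) :
    Hop T c (x :: l) = c (x :: x :: l) - T (sl c x) (x :: l) - cobd (Hop T (sl c x)) (x :: l) := by
  rw [Hop, List.length_cons, Haux]
  congr 1
  apply cobd_congr
  intro l' _ h
  rw [Hop]
  simp at h
  rw [h]

lemma list_len_induct' {P : List X → Prop} (h0 : P [])
    (h : ∀ x l, (∀ l', l'.length = l.length → P l') → P (x :: l)) : ∀ l, P l := by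
  intro l
  induction hn : l.length generalizing l with
  | zero => rw [List.length_eq_zero_iff.1 hn]; exact h0
  | succ n ih =>
    rcases l with _ | ⟨x, l⟩
    · exact h0
    · exact h x l (fun l' hl' => ih l' (by simp at hn; omega))

lemma Hop_sub (hsub : ∀ c c' l, T (c - c') l = T c l - T c' l) (c c' : List X → R) (l : List X) : Hop T (c - c') l = Hop T c l - Hop T c' l := by
  revert c c'
  refine list_len_induct' (P := fun l => ∀ c c' : List X → R, Hop T (c - c') l = Hop T c l - Hop T c' l) ?_ ?_ l
  · intro c c'; simp
  · intro x l ih c c'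
    have h1 : sl (c - c') x = sl c x - sl c' x := rfl
    rw [Hop_cons, Hop_cons, Hop_cons, h1, hsub]
    have : cobd (Hop T (sl c x - sl c' x)) (x :: l) = cobd (Hop T (sl c x)) (x :: l) - cobd (Hop T (sl c' x)) (x :: l) := by
      rw [← cobd_sub]
      apply cobd_congr
      intro l' _ h
      exact ih l' (by simpa using h) _ _
    rw [this, Pi.sub_apply]; ring

lemma Hop_identity (hsub : ∀ c c' l, T (c - c') l = T c l - T c' l)
    (hcob : ∀ c l, T (cobd c) l = cobd (T c) l) (hnil : ∀ c, T c [] = c []) (c : List X → R) (l : List X) :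
    c l = T c l + Hop T (cobd c) l + cobd (Hop T c) l := by
  revert c
  refine list_len_induct' (P := fun l => ∀ c : List X → R, c l = T c l + Hop T (cobd c) l + cobd (Hop T c) l) ?_ ?_ l
  · intro c; simp [hnil]
  · intro x l ih c
    rw [Hop_cons, sl_cobd, hsub, hcob]
    have e1 : cobd c (x :: x :: l) = c (x :: l) - cobd (sl c x) (x :: l) := rfl
    have e2 : Hop T (c - cobd (sl c x)) = Hop T c - Hop T (cobd (sl c x)) := by
      ext l'; exact Hop_sub T hsub _ _ l'
    have e3 : cobd (sl c x) (x :: l) = cobd (T (sl c x) + Hop T (cobd (sl c x)) + cobd (Hop T (sl c x))) (x :: l) := by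
      apply cobd_congr
      intro l' _ h
      exact ih l' (by simpa using h) _
    rw [cobd_add, cobd_add, cobd_cobd] at e3
    rw [e1, e2, cobd_sub, e3]; ring

lemma Hop_congr (c c' : List X → R) (S : Set X) (l : List X) (hl : ∀ x ∈ l, x ∈ S)
    (hT : ∀ (c c' : List X → R) (τ : List X), (∀ x ∈ τ, x ∈ l) →
      (∀ τ' : List X, τ'.length = τ.length → (∀ y ∈ τ', y ∈ S) → c τ' = c' τ') → T c τ = T c' τ)
    (h : ∀ l' : List X, l'.length = l.length + 1 → (∀ y ∈ l', y ∈ S) → c l' = c' l') :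
    Hop T c l = Hop T c' l := by
  have key : ∀ σ : List X, ∀ c c' : List X → R, (∀ x ∈ σ, x ∈ l) →
      (∀ l' : List X, l'.length = σ.length + 1 → (∀ y ∈ l', y ∈ S) → c l' = c' l') → Hop T c σ = Hop T c' σ := by
    intro σ
    refine list_len_induct' (P := fun σ => ∀ c c' : List X → R, (∀ x ∈ σ, x ∈ l) →
      (∀ l' : List X, l'.length = σ.length + 1 → (∀ y ∈ l', y ∈ S) → c l' = c' l') → Hop T c σ = Hop T c' σ) ?_ ?_ σ
    · intros; rfl
    · intro x σ ih c c' hσ h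
      have hx : x ∈ S := hl x (hσ x (by simp))
      have hsl : ∀ l' : List X, l'.length = σ.length + 1 → (∀ y ∈ l', y ∈ S) → sl c x l' = sl c' x l' := by
        intro l' h1 h2
        apply h
        · simp [h1]
        · intro y hy
          rcases List.mem_cons.1 hy with rfl | hy
          · exact hx
          · exact h2 y hy
      rw [Hop_cons, Hop_cons, ← sl_apply c x, ← sl_apply c' x, hsl (x :: σ) rfl (fun y hy => hl y (hσ y hy)),
        hT (sl c x) (sl c' x) (x :: σ) hσ (fun τ' h1 h2 => hsl τ' h1 h2)]
      congr 1
      apply cobd_congr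
      intro l' h1 h2
      simp only [List.length_cons, add_left_inj] at h2
      apply ih l' h2 _ _ (fun y hy => hσ y (h1.subset hy))
      intro l2 h3 h4
      exact hsl l2 (by omega) h4
  exact key l c c' (fun x hx => hx) h

end Hop
end Part1

section Part2
section Cross
variable {X Y W : Type*} {R : Type*} [CommRing R] (f : W → X) (g : W → Y)

/-- cross product of cochains -/
def cross {X Y W R : Type*} [CommRing R] (f : W → X) (g : W → Y) : ℕ → (List X → R) → (List Y → R) → List W → R
  | _, _, _, [] => 0
  | 0, c, κ, p :: ps => c [f p] * κ ((p :: ps).map g)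
  | n + 1, c, κ, p :: ps => cross f g n (sl c (f p)) κ ps

@[simp] lemma cross_nil (n : ℕ) (c : List X → R) (κ : List Y → R) : cross f g n c κ [] = 0 := by
  cases n <;> rfl

lemma cross_zero (c : List X → R) (κ : List Y → R) (p : W) (ps : List W) :
    cross f g 0 c κ (p :: ps) = c [f p] * κ ((p :: ps).map g) := rfl

lemma cross_succ (n : ℕ) (c : List X → R) (κ : List Y → R) (p : W) (ps : List W) :
    cross f g (n+1) c κ (p :: ps) = cross f g n (sl c (f p)) κ ps := rfl

lemma cross_sub_left (n : ℕ) (c c' : List X → R) (κ : List Y → R) (l : List W) :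
    cross f g n (c - c') κ l = cross f g n c κ l - cross f g n c' κ l := by
  induction l generalizing n c c' with
  | nil => simp
  | cons p l ih =>
    cases n with
    | zero => simp only [cross_zero, Pi.sub_apply]; ring
    | succ n => exact ih n _ _

lemma cross_congr (n : ℕ) (c c' : List X → R) (κ κ' : List Y → R) (l : List W) (hl : n < l.length)
    (h1 : ∀ a : List X, a.length = n + 1 → a.Sublist (l.map f) → c a = c' a)
    (h2 : ∀ b : List Y, b.length + n = l.length → b.Sublist (l.map g) → κ b = κ' b) :
    cross f g n c κ l = cross f g n c' κ' l := by
  induction l generalizing n c c' with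
  | nil => simp
  | cons p l ih =>
    cases n with
    | zero =>
      rw [cross_zero, cross_zero, h1 _ rfl (by simp), h2 _ (by simp) (List.Sublist.refl _)]
    | succ n =>
      rw [cross_succ, cross_succ]
      apply ih
      · simpa using hl
      · intro a h3 h4
        exact h1 _ (by simp [h3]) (h4.cons_cons _)
      · intro b h3 h4
        exact h2 _ (by simp; omega) (h4.cons _)

lemma cross_mul_left (n : ℕ) (a : R) (c : List X → R) (κ : List Y → R) (l : List W) :
    cross f g n (fun l => a * c l) κ l = a * cross f g n c κ l := by
  induction l generalizing n c with
  | nil => simp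
  | cons p l ih =>
    cases n with
    | zero => simp only [cross_zero]; ring
    | succ n => exact ih n _

lemma cross_mul_right (n : ℕ) (a : R) (c : List X → R) (κ : List Y → R) (l : List W) :
    cross f g n c (fun l => a * κ l) l = a * cross f g n c κ l := by
  induction l generalizing n c with
  | nil => simp
  | cons p l ih =>
    cases n with
    | zero => simp only [cross_zero]; ring
    | succ n => exact ih n _

lemma cross_add_left (n : ℕ) (c c' : List X → R) (κ : List Y → R) (l : List W) :
    cross f g n (c + c') κ l = cross f g n c κ l + cross f g n c' κ l := by
  have := cross_sub_left f g n (c + c') c' κ l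
  rw [add_sub_cancel_right] at this
  rw [this]; ring

lemma cobd_cross (n : ℕ) (c : List X → R) (κ : List Y → R) (l : List W) (hl : n + 2 ≤ l.length) :
    cobd (cross f g n c κ) l = cross f g (n+1) (cobd c) κ l + (-1)^n * cross f g n c (cobd κ) l := by
  induction n generalizing c l with
  | zero =>
    obtain ⟨p, q, r, rfl⟩ : ∃ p q r, l = p :: q :: r := by
      rcases l with _ | ⟨p, _ | ⟨q, r⟩⟩
      · simp at hl
      · simp at hl
      · exact ⟨p, q, r, rfl⟩
    rw [cobd_cons, cross_succ, cross_zero, cross_zero, cross_zero]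
    have e : cobd (sl (cross f g 0 c κ) p) (q :: r) = c [f p] * cobd (sl κ (g p)) ((q :: r).map g) := by
      rw [← cobd_map, ← cobd_smul']; rfl
    rw [e, List.map_cons (l := q :: r), cobd_cons]
    simp [sl, cobd_cons]
    ring
  | succ n ih =>
    rcases l with _ | ⟨p, r⟩
    · simp at hl
    rw [cobd_cons, cross_succ, cross_succ, sl_cobd, cross_sub_left]
    have := ih (sl c (f p)) r (by simpa using hl)
    have e : sl (cross f g (n+1) c κ) p = cross f g n (sl c (f p)) κ := rfl
    rw [e, this, pow_succ]; ring

lemma cross_normalized (n : ℕ) {c : List X → R} {κ : List Y → R} (hc : Normalized c) (hκ : Normalized κ) :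
    Normalized (cross f g n c κ) := by
  suffices H : ∀ a x b, cross f g n c κ (a ++ x :: x :: b) = 0 from fun m a x b _ => H a x b
  intro a x b
  induction a generalizing n c with
  | nil =>
    rcases n with _ | _ | n
    · rw [List.nil_append, cross_zero]
      have : κ ((x :: x :: b).map g) = 0 := hκ _ [] (g x) (b.map g) rfl
      rw [this, mul_zero]
    · rw [List.nil_append, cross_succ, cross_zero]
      have : sl c (f x) [f x] = 0 := hc _ [] (f x) [] rfl
      rw [this, zero_mul]
    · rw [List.nil_append, cross_succ, cross_succ, hc.sl_sl]
      have := cross_sub_left f g n (0 : List X → R) 0 κ b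
      simpa using this
  | cons y a ih =>
    rcases n with _ | n
    · rw [List.cons_append, cross_zero]
      have : κ ((y :: (a ++ x :: x :: b)).map g) = 0 := by
        simpa using hκ _ (g y :: a.map g) (g x) (b.map g) rfl
      rw [this, mul_zero]
    · exact ih n (hc.sl _)

end Cross

section EZ
variable {X Y W : Type*} {R : Type*} [CommRing R] (mk : X → Y → W)

def Eaux : ℕ → (List W → R) → List X → List Y → R
  | 0, _, _, _ => 0
  | _ + 1, _, [], _ => 0
  | _ + 1, _, _ :: _, [] => 0
  | k + 1, c, x :: σ, y :: τ =>
    if σ.length + τ.length = 0 then c [mk x y] else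
      cobd (fun σ' => Eaux k (sl c (mk x y)) σ' (y :: τ)) (x :: σ)
        + (-1)^σ.length * cobd (fun τ' => Eaux k (sl c (mk x y)) (x :: σ) τ') (y :: τ)

def EZ (c : List W → R) (σ : List X) (τ : List Y) : R := Eaux mk (σ.length + τ.length) c σ τ

@[simp] lemma EZ_nil_left (c : List W → R) (τ : List Y) : EZ mk c [] τ = 0 := by
  rcases τ with _ | ⟨y, τ⟩ <;> simp [EZ, Eaux]

@[simp] lemma EZ_nil_right (c : List W → R) (σ : List X) : EZ mk c σ [] = 0 := by
  rcases σ with _ | ⟨y, σ⟩ <;> simp [EZ, Eaux]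

lemma EZ_one (c : List W → R) (x : X) (y : Y) : EZ mk c [x] [y] = c [mk x y] := by
  simp [EZ, Eaux]

lemma EZ_cons (c : List W → R) (x : X) (y : Y) (σ : List X) (τ : List Y) (h : σ.length + τ.length ≠ 0) :
    EZ mk c (x :: σ) (y :: τ) = cobd (fun σ' => EZ mk (sl c (mk x y)) σ' (y :: τ)) (x :: σ)
        + (-1)^σ.length * cobd (fun τ' => EZ mk (sl c (mk x y)) (x :: σ) τ') (y :: τ) := by
  have e : (x :: σ).length + (y :: τ).length = (σ.length + τ.length + 1) + 1 := by simp; omega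
  rw [EZ, e, Eaux, if_neg h]
  congr 1
  · apply cobd_congr
    intro l' _ h
    simp at h
    simp only [EZ, h, List.length_cons]; rfl
  · congr 1
    apply cobd_congr
    intro l' _ h
    simp at h
    simp only [EZ, h, List.length_cons]
    congr 1; omega

lemma EZ_sub (c c' : List W → R) (σ : List X) (τ : List Y) :
    EZ mk (c - c') σ τ = EZ mk c σ τ - EZ mk c' σ τ := by
  induction hn : σ.length + τ.length using Nat.strong_induction_on generalizing c c' σ τ with
  | _ n ih =>
  rcases σ with _ | ⟨x, σ⟩
  · simp
  rcases τ with _ | ⟨y, τ⟩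
  · simp
  by_cases h : σ.length + τ.length = 0
  · have h1 : σ = [] := List.length_eq_zero_iff.1 (by omega)
    have h2 : τ = [] := List.length_eq_zero_iff.1 (by omega)
    subst h1; subst h2
    simp [EZ_one]
  · rw [EZ_cons _ _ _ _ _ _ h, EZ_cons _ _ _ _ _ _ h, EZ_cons _ _ _ _ _ _ h]
    have e : sl (c - c') (mk x y) = sl c (mk x y) - sl c' (mk x y) := rfl
    rw [e]
    simp only [List.length_cons] at hn
    have h1 : cobd (fun σ' => EZ mk (sl c (mk x y) - sl c' (mk x y)) σ' (y :: τ)) (x :: σ) =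
       cobd (fun σ' => EZ mk (sl c (mk x y)) σ' (y :: τ)) (x :: σ) - cobd (fun σ' => EZ mk (sl c' (mk x y)) σ' (y :: τ)) (x :: σ) := by
      rw [← cobd_sub]
      apply cobd_congr
      intro l' _ h
      simp at h
      exact ih _ (by simp; omega) _ _ _ _ rfl
    have h2 : cobd (fun τ' => EZ mk (sl c (mk x y) - sl c' (mk x y)) (x :: σ) τ') (y :: τ) =
       cobd (fun τ' => EZ mk (sl c (mk x y)) (x :: σ) τ') (y :: τ) - cobd (fun τ' => EZ mk (sl c' (mk x y)) (x :: σ) τ') (y :: τ) := by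
      rw [← cobd_sub]
      apply cobd_congr
      intro l' _ h
      simp at h
      exact ih _ (by simp; omega) _ _ _ _ rfl
    rw [h1, h2]; ring

@[simp] lemma EZ_zero (σ : List X) (τ : List Y) : EZ mk (0 : List W → R) σ τ = 0 := by
  have := EZ_sub mk (0 : List W → R) 0 σ τ
  simpa using this

lemma EZ_sl_zero (c : List W → R) (x : X) (y : Y) (σ : List X) (τ : List Y) (h : sl c (mk x y) = 0) :
    EZ mk c (x :: σ) (y :: τ) = 0 := by
  by_cases h0 : σ.length + τ.length = 0
  · have h1 : σ = [] := List.length_eq_zero_iff.1 (by omega)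
    have h2 : τ = [] := List.length_eq_zero_iff.1 (by omega)
    subst h1; subst h2
    rw [EZ_one]
    exact congrFun h []
  · rw [EZ_cons _ _ _ _ _ _ h0, h]
    rw [cobd_zero' (by simp), cobd_zero' (by simp)]; simp

lemma EZ_smul (a : R) (c : List W → R) (σ : List X) (τ : List Y) :
    EZ mk (a • c) σ τ = a * EZ mk c σ τ := by
  induction hn : σ.length + τ.length using Nat.strong_induction_on generalizing c σ τ with
  | _ n ih =>
  rcases σ with _ | ⟨x, σ⟩
  · simp
  rcases τ with _ | ⟨y, τ⟩
  · simp
  by_cases h : σ.length + τ.length = 0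
  · have h1 : σ = [] := List.length_eq_zero_iff.1 (by omega)
    have h2 : τ = [] := List.length_eq_zero_iff.1 (by omega)
    subst h1; subst h2
    simp [EZ_one]
  · rw [EZ_cons _ _ _ _ _ _ h, EZ_cons _ _ _ _ _ _ h]
    have e : sl (a • c) (mk x y) = a • sl c (mk x y) := rfl
    rw [e]
    simp only [List.length_cons] at hn
    have h1 : cobd (fun σ' => EZ mk (a • sl c (mk x y)) σ' (y :: τ)) (x :: σ) =
       a * cobd (fun σ' => EZ mk (sl c (mk x y)) σ' (y :: τ)) (x :: σ) := by
      rw [← cobd_smul']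
      apply cobd_congr
      intro l' _ h
      simp at h
      exact ih _ (by simp; omega) _ _ _ rfl
    have h2 : cobd (fun τ' => EZ mk (a • sl c (mk x y)) (x :: σ) τ') (y :: τ) =
       a * cobd (fun τ' => EZ mk (sl c (mk x y)) (x :: σ) τ') (y :: τ) := by
      rw [← cobd_smul']
      apply cobd_congr
      intro l' _ h
      simp at h
      exact ih _ (by simp; omega) _ _ _ rfl
    rw [h1, h2]; ring

/-- `EZ` depends only on values on lists `l` whose projections are in the given sets -/
lemma EZ_congr (c c' : List W → R) (σ : List X) (τ : List Y)
    (h : ∀ l : List W, l.length + 1 = σ.length + τ.length → (∀ w ∈ l, ∃ x ∈ σ, ∃ y ∈ τ, w = mk x y) →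
      c l = c' l) : EZ mk c σ τ = EZ mk c' σ τ := by
  induction hn : σ.length + τ.length using Nat.strong_induction_on generalizing c c' σ τ with
  | _ n ih =>
  rcases σ with _ | ⟨x, σ⟩
  · simp
  rcases τ with _ | ⟨y, τ⟩
  · simp
  by_cases h0 : σ.length + τ.length = 0
  · have h1 : σ = [] := List.length_eq_zero_iff.1 (by omega)
    have h2 : τ = [] := List.length_eq_zero_iff.1 (by omega)
    subst h1; subst h2
    rw [EZ_one, EZ_one]
    exact h _ rfl (by simp)
  · rw [EZ_cons _ _ _ _ _ _ h0, EZ_cons _ _ _ _ _ _ h0]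
    simp only [List.length_cons] at hn h
    congr 1
    · apply cobd_congr
      intro l' h1 h2
      simp only [List.length_cons] at h2
      apply ih (l'.length + (y :: τ).length) (by simp; omega) _ _ _ _ _ rfl
      intro l h3 h4
      simp only [List.length_cons] at h3
      apply h
      · simp; omega
      · intro w hw
        rcases List.mem_cons.1 hw with rfl | hw
        · exact ⟨x, by simp, y, by simp, rfl⟩
        · obtain ⟨x', hx', y', hy', e⟩ := h4 w hw
          exact ⟨x', h1.subset hx', y', hy', e⟩
    · congr 1
      apply cobd_congr
      intro l' h1 h2
      simp only [List.length_cons] at h2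
      apply ih ((x :: σ).length + l'.length) (by simp; omega) _ _ _ _ _ rfl
      intro l h3 h4
      simp only [List.length_cons] at h3
      apply h
      · simp; omega
      · intro w hw
        rcases List.mem_cons.1 hw with rfl | hw
        · exact ⟨x, by simp, y, by simp, rfl⟩
        · obtain ⟨x', hx', y', hy', e⟩ := h4 w hw
          exact ⟨x', hx', y', h1.subset hy', e⟩

lemma cobd_len_one (a : R) (P : Prop) [Decidable P] (l : List X) :
    cobd (fun l' => if l'.length = 1 ∧ P then a else 0) l = 0 := by
  rcases l with _ | ⟨x, _ | ⟨y, _ | ⟨z, l⟩⟩⟩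
  · rfl
  · simp [cobd_cons]
  · simp [cobd_cons]
  · apply cobd_zero'
    intro l' _ h
    simp only [List.length_cons] at h
    rw [if_neg]
    rintro ⟨h1, -⟩
    omega

lemma EZ_cobd (c : List W → R) (σ : List X) (τ : List Y) :
    EZ mk (cobd c) σ τ = cobd (fun σ' => EZ mk c σ' τ) σ + (-1)^(σ.length + 1) * cobd (fun τ' => EZ mk c σ τ') τ
      + (if σ.length = 1 ∧ τ.length = 1 then c [] else 0) := by
  induction hn : σ.length + τ.length using Nat.strong_induction_on generalizing c σ τ with
  | _ n ih =>
  rcases σ with _ | ⟨x, σ⟩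
  · rw [EZ_nil_left, cobd_nil, cobd_zero' (by simp)]; simp
  rcases τ with _ | ⟨y, τ⟩
  · rw [EZ_nil_right, cobd_nil, cobd_zero' (by simp)]; simp
  by_cases h0 : σ.length + τ.length = 0
  · have h1 : σ = [] := List.length_eq_zero_iff.1 (by omega)
    have h2 : τ = [] := List.length_eq_zero_iff.1 (by omega)
    subst h1; subst h2
    simp [EZ_one, cobd_cons]
  · rw [EZ_cons _ _ _ _ _ _ h0, sl_cobd]
    rw [if_neg (by simp only [List.length_cons]; omega), add_zero]
    simp only [List.length_cons] at hn ⊢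
    set cv := sl c (mk x y) with hcv
    have h1 : cobd (fun σ' => EZ mk (c - cobd cv) σ' (y :: τ)) (x :: σ) =
        cobd (fun σ' => EZ mk c σ' (y :: τ)) (x :: σ) - (-1)^(σ.length + 1) *
          cobd (fun σ' => cobd (fun τ' => EZ mk cv σ' τ') (y :: τ)) (x :: σ) := by
      rw [← cobd_smul', ← cobd_sub]
      have e : cobd (fun σ' => EZ mk (c - cobd cv) σ' (y :: τ)) (x :: σ) =
        cobd (((fun σ' => EZ mk c σ' (y :: τ)) - (fun σ' => (-1)^(σ.length + 1) * cobd (fun τ' => EZ mk cv σ' τ') (y :: τ)))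
          - cobd (fun σ' => EZ mk cv σ' (y :: τ)) - (fun σ' => if σ'.length = 1 ∧ (y :: τ).length = 1 then cv [] else 0)) (x :: σ) := by
        apply cobd_congr
        intro l' _ h
        simp only [List.length_cons] at h
        rw [EZ_sub, ih (l'.length + (y :: τ).length) (by simp; omega) cv l' (y :: τ) rfl]
        simp only [Pi.sub_apply]
        rw [show l'.length = σ.length by omega]
        ring
      rw [e, cobd_sub _ (fun σ' : List X => if σ'.length = 1 ∧ (y :: τ).length = 1 then cv [] else 0), cobd_sub, cobd_len_one, cobd_cobd]
      simp
    have h2 : cobd (fun τ' => EZ mk (c - cobd cv) (x :: σ) τ') (y :: τ) =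
        cobd (fun τ' => EZ mk c (x :: σ) τ') (y :: τ) -
          cobd (fun τ' => cobd (fun σ' => EZ mk cv σ' τ') (x :: σ)) (y :: τ) := by
      rw [← cobd_sub]
      have e : cobd (fun τ' => EZ mk (c - cobd cv) (x :: σ) τ') (y :: τ) =
        cobd (((fun τ' => EZ mk c (x :: σ) τ') - (fun τ' => cobd (fun σ' => EZ mk cv σ' τ') (x :: σ)))
          - (fun τ'' => (-1)^((x :: σ).length + 1) * cobd (fun τ' => EZ mk cv (x :: σ) τ') τ'') - (fun τ' => if τ'.length = 1 ∧ (x :: σ).length = 1 then cv [] else 0)) (y :: τ) := by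
        apply cobd_congr
        intro l' _ h
        simp only [List.length_cons] at h
        rw [EZ_sub, ih ((x :: σ).length + l'.length) (by simp; omega) cv (x :: σ) l' rfl]
        simp only [Pi.sub_apply]
        simp only [and_comm]
        ring
      rw [e, cobd_sub _ (fun τ' : List Y => if τ'.length = 1 ∧ (x :: σ).length = 1 then cv [] else 0), cobd_sub, cobd_len_one, cobd_smul', cobd_cobd]
      simp
    rw [h1, h2, cobd_comm, pow_succ, pow_succ]; ring

lemma EZ_norm_cons {γ : List W → R} (hγ : Normalized γ) (x : X) (y : Y) (σ : List X) (τ : List Y)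
    (h : σ.length + τ.length ≠ 0) :
    EZ mk γ (x :: σ) (y :: τ) = EZ mk (sl γ (mk x y)) σ (y :: τ)
        + (-1)^σ.length * EZ mk (sl γ (mk x y)) (x :: σ) τ := by
  rw [EZ_cons _ _ _ _ _ _ h, cobd_cons, cobd_cons, cobd_zero' (l := σ), cobd_zero' (l := τ), sub_zero, sub_zero]
  · intro l' _ _
    exact EZ_sl_zero mk _ _ _ _ _ (hγ.sl_sl _)
  · intro l' _ _
    exact EZ_sl_zero mk _ _ _ _ _ (hγ.sl_sl _)

lemma EZ_single {γ : List W → R} (hγ : Normalized γ) (x : X) (y : Y) (τ : List Y) :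
    EZ mk γ [x] (y :: τ) = γ ((y :: τ).map (mk x)) := by
  induction τ generalizing γ y with
  | nil => exact EZ_one mk γ x y
  | cons z τ ih =>
    rw [EZ_norm_cons mk hγ _ _ _ _ (by simp), EZ_nil_left, ih (hγ.sl _)]
    simp [sl]

variable (f : W → X) (g : W → Y) 

lemma EZ_cross (hf : ∀ x y, f (mk x y) = x) (hg : ∀ x y, g (mk x y) = y) (n : ℕ) {c : List X → R} {κ : List Y → R}
    (hc : Normalized c) (hκ : Normalized κ) (σ : List X) (τ : List Y) (hσ : σ.length = n + 1) (hτ : τ ≠ []) :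
    EZ mk (cross f g n c κ) σ τ = c σ * κ τ := by
  obtain ⟨y, τ, rfl⟩ := List.exists_cons_of_ne_nil hτ
  induction n generalizing c σ with
  | zero =>
    obtain ⟨x, rfl⟩ := List.length_eq_one_iff.1 hσ
    rw [EZ_single mk (cross_normalized f g 0 hc hκ), List.map_cons, cross_zero]
    simp [hf, hg]
    congr 3
    conv_rhs => rw [← List.map_id τ]
    congr 1; ext y; simp [hg]
  | succ n ih =>
    rcases σ with _ | ⟨x, σ⟩
    · simp at hσ
    rw [EZ_norm_cons mk (cross_normalized f g (n+1) hc hκ) _ _ _ _ (by simp at hσ; omega)]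
    have e : sl (cross f g (n+1) c κ) (mk x y) = cross f g n (sl c x) κ := by
      ext l; rw [sl_apply, cross_succ, hf]
    rw [e, ih (hc.sl x) σ (by simpa using hσ)]
    have e2 : EZ mk (cross f g n (sl c x) κ) (x :: σ) τ = 0 := by
      rcases τ with _ | ⟨z, τ⟩
      · simp
      · apply EZ_sl_zero
        ext l
        rcases n with _ | n
        · rw [sl_apply, cross_zero, hf, sl_apply, show c [x, x] = 0 from hc _ [] x [] rfl]; simp
        · rw [sl_apply, cross_succ, hf, hc.sl_sl]
          have := cross_sub_left f g n (0 : List X → R) 0 κ l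
          simpa using this
    rw [e2]; simp

end EZ
end Part2

section Part3
/-- small lists -/
def Sm {X : Type*} [MetricSpace X] (δ : ℝ) (l : List X) : Prop := ∀ x ∈ l, ∀ y ∈ l, dist x y < δ

lemma Sm.of_subset {X : Type*} [MetricSpace X] {δ : ℝ} {l l' : List X} (h : Sm δ l) (hs : ∀ x ∈ l', x ∈ l) : Sm δ l' :=
  fun x hx y hy => h x (hs x hx) y (hs y hy)

lemma Sm.mono {X : Type*} [MetricSpace X] {δ δ' : ℝ} {l : List X} (h : Sm δ l) (hs : δ ≤ δ') : Sm δ' l :=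
  fun x hx y hy => (h x hx y hy).trans_le hs

structure Rob (F : Type*) [Field F] (X : Type*) [MetricSpace X] (k : ℕ) (δ η : ℝ) (c : List X → F)
    (𝒜 : Set (Set X)) : Prop where
  norm : Normalized c
  coc : ∀ l : List X, l.length = k + 2 → Sm δ l → cobd c l = 0
  van : ∀ l : List X, l.length = k + 1 → Sm δ l → ∀ A ∈ 𝒜, (∀ x ∈ l, ∃ a ∈ A, dist x a < η) → c l = 0
  ess : ∀ δ' > 0, ∃ Z : (List X → F) →ₗ[F] F,
    (∀ c' : List X → F, (∀ l : List X, l.length = k + 1 → Sm δ' l → c' l = 0) → Z c' = 0) ∧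
    (∀ b : List X → F, b [] = 0 → (∀ A ∈ 𝒜, ∀ l : List X, l.length = k → Sm δ' l → (∀ x ∈ l, x ∈ A) → b l = 0) →
      Z (cobd b) = 0) ∧ Z c ≠ 0

section
variable {F : Type*} [Field F]

lemma cross_zero_left {X Y W : Type*} (f : W → X) (g : W → Y) (n : ℕ) (κ : List Y → F) (l : List W) :
    cross f g n (0 : List X → F) κ l = 0 := by
  have := cross_sub_left f g n (0 : List X → F) 0 κ l
  simpa using this

lemma cross_zero_right {X Y W : Type*} (f : W → X) (g : W → Y) (n : ℕ) (c : List X → F) (l : List W) :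
    cross f g n c (0 : List Y → F) l = 0 := by
  have := cross_mul_right f g n 0 c (0 : List Y → F) l
  simp only [zero_mul] at this
  exact this

theorem Rob.prod {X Y W : Type*} [MetricSpace X] [MetricSpace Y] [MetricSpace W]
    (mk : X → Y → W) (f : W → X) (g : W → Y) (hf : ∀ x y, f (mk x y) = x) (hg : ∀ x y, g (mk x y) = y)
    (hd : ∀ w w' r, dist w w' < r ↔ dist (f w) (f w') < r ∧ dist (g w) (g w') < r)
    {n k : ℕ} {δ η : ℝ} {c : List X → F} {κ : List Y → F} {𝒜 : Set (Set X)} {ℬ : Set (Set Y)}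
    (h1 : Rob F X n δ η c 𝒜) (h2 : Rob F Y k δ η κ ℬ) :
    Rob F W (n + k) δ η (cross f g n c κ) ({S | ∃ A ∈ 𝒜, S = f ⁻¹' A} ∪ {S | ∃ B ∈ ℬ, S = g ⁻¹' B}) := by
  have smf : ∀ {δ : ℝ} {l : List W} {a : List X}, Sm δ l → a.Sublist (l.map f) → Sm δ a := by
    intro δ l a hl ha x hx y hy
    obtain ⟨w, hw, rfl⟩ := List.mem_map.1 (ha.subset hx)
    obtain ⟨w', hw', rfl⟩ := List.mem_map.1 (ha.subset hy)
    exact ((hd _ _ _).1 (hl w hw w' hw')).1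
  have smg : ∀ {δ : ℝ} {l : List W} {a : List Y}, Sm δ l → a.Sublist (l.map g) → Sm δ a := by
    intro δ l a hl ha x hx y hy
    obtain ⟨w, hw, rfl⟩ := List.mem_map.1 (ha.subset hx)
    obtain ⟨w', hw', rfl⟩ := List.mem_map.1 (ha.subset hy)
    exact ((hd _ _ _).1 (hl w hw w' hw')).2
  have smp : ∀ {δ : ℝ} {l : List W} {a : List X} {b : List Y}, Sm δ a → Sm δ b →
      (∀ w ∈ l, ∃ x ∈ a, ∃ y ∈ b, w = mk x y) → Sm δ l := by
    intro δ l a b ha hb hl w hw w' hw'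
    obtain ⟨x, hx, y, hy, rfl⟩ := hl w hw
    obtain ⟨x', hx', y', hy', rfl⟩ := hl w' hw'
    rw [hd, hf, hf, hg, hg]
    exact ⟨ha _ hx _ hx', hb _ hy _ hy'⟩
  refine ⟨cross_normalized f g n h1.norm h2.norm, ?_, ?_, ?_⟩
  · intro l hl hs
    rw [cobd_cross f g n c κ l (by omega)]
    rw [cross_congr f g (n+1) (cobd c) 0 κ κ l (by omega) _ (fun _ _ _ => rfl), cross_zero_left,
      cross_congr f g n c c (cobd κ) 0 l (by omega) (fun _ _ _ => rfl), cross_zero_right]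
    · simp
    · intro b hb hbl
      exact h2.coc b (by omega) (smg hs hbl)
    · intro a ha hal
      exact h1.coc a ha (smf hs hal)
  · rintro l hl hs S (⟨A, hA, rfl⟩ | ⟨B, hB, rfl⟩) hS
    · rw [cross_congr f g n c 0 κ κ l (by omega) _ (fun _ _ _ => rfl), cross_zero_left]
      intro a ha hal
      refine h1.van a ha (smf hs hal) A hA ?_
      intro x hx
      obtain ⟨w, hw, rfl⟩ := List.mem_map.1 (hal.subset hx)
      obtain ⟨w', hw', hdist⟩ := hS w hw
      exact ⟨f w', hw', ((hd _ _ _).1 hdist).1⟩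
    · rw [cross_congr f g n c c κ 0 l (by omega) (fun _ _ _ => rfl), cross_zero_right]
      intro a ha hal
      refine h2.van a (by omega) (smg hs hal) B hB ?_
      intro x hx
      obtain ⟨w, hw, rfl⟩ := List.mem_map.1 (hal.subset hx)
      obtain ⟨w', hw', hdist⟩ := hS w hw
      exact ⟨g w', hw', ((hd _ _ _).1 hdist).2⟩
  · intro δ' hδ'
    obtain ⟨Z, z1, z2, z3⟩ := h1.ess δ' hδ'
    obtain ⟨Z', y1, y2, y3⟩ := h2.ess δ' hδ'
    have zc : ∀ c c' : List X → F, (∀ l : List X, l.length = n + 1 → Sm δ' l → c l = c' l) → Z c = Z c' := by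
      intro c c' h
      have := z1 (c - c') (fun l a b => by simp [h l a b])
      rw [map_sub] at this; exact sub_eq_zero.1 this
    have yc : ∀ c c' : List Y → F, (∀ l : List Y, l.length = k + 1 → Sm δ' l → c l = c' l) → Z' c = Z' c' := by
      intro c c' h
      have := y1 (c - c') (fun l a b => by simp [h l a b])
      rw [map_sub] at this; exact sub_eq_zero.1 this
    have hadd : ∀ γ γ' : List W → F, ∀ σ τ, EZ mk (γ + γ') σ τ = EZ mk γ σ τ + EZ mk γ' σ τ := by
      intro γ γ' σ τ
      have := EZ_sub mk (γ + γ') γ' σ τ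
      rw [add_sub_cancel_right] at this
      rw [this]; ring
    let ZZ : (List W → F) →ₗ[F] F :=
      { toFun := fun γ => Z (fun σ => Z' (fun τ => EZ mk γ σ τ))
        map_add' := by
          intro γ γ'
          rw [← map_add]; congr 1; ext σ
          simp only [Pi.add_apply]
          rw [← map_add]; congr 1; ext τ
          exact hadd _ _ _ _
        map_smul' := by
          intro a γ
          rw [RingHom.id_apply, ← map_smul]; congr 1; ext σ
          simp only [Pi.smul_apply]
          rw [← map_smul]; congr 1; ext τ
          exact EZ_smul mk a γ σ τ }
    have ZZd : ∀ γ, ZZ γ = Z (fun σ => Z' (fun τ => EZ mk γ σ τ)) := fun _ => rfl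
    refine ⟨ZZ, ?_, ?_, ?_⟩
    · intro γ hγ
      rw [ZZd]
      apply z1
      intro σ hσ sσ
      apply y1
      intro τ hτ sτ
      rw [EZ_congr mk γ 0 σ τ, EZ_zero]
      intro l hl hl2
      exact hγ l (by omega) (smp sσ sτ hl2)
    · intro b hb0 hb
      rw [ZZd]
      have e1 : Z (fun σ => Z' (fun τ => EZ mk (cobd b) σ τ)) =
          Z (cobd (fun σ' => Z' (fun τ => EZ mk b σ' τ))) := by
        apply zc
        intro σ hσ sσ
        have e2 : (fun τ => EZ mk (cobd b) σ τ) = (fun τ => cobd (fun σ' => EZ mk b σ' τ) σ)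
            + (-1 : F)^(σ.length + 1) • cobd (fun τ' => EZ mk b σ τ') := by
          ext τ
          rw [EZ_cobd, hb0]; simp
        rw [e2, map_add, map_smul, y2, smul_zero, add_zero]
        · exact cobd_linear Z' (fun τ σ' => EZ mk b σ' τ) σ
        · simp
        · intro B hB τ hτ sτ hτB
          rw [EZ_congr mk b 0 σ τ, EZ_zero]
          intro l hl hl2
          refine hb (g ⁻¹' B) (Or.inr ⟨B, hB, rfl⟩) l (by omega) (smp sσ sτ hl2) ?_
          intro w hw
          obtain ⟨x, hx, y, hy, rfl⟩ := hl2 w hw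
          show g (mk x y) ∈ B
          rw [hg]; exact hτB y hy
      rw [e1]
      apply z2
      · simp only [EZ_nil_left]; exact map_zero Z'
      · intro A hA σ hσ sσ hσA
        apply y1
        intro τ hτ sτ
        rw [EZ_congr mk b 0 σ τ, EZ_zero]
        intro l hl hl2
        refine hb (f ⁻¹' A) (Or.inl ⟨A, hA, rfl⟩) l (by omega) (smp sσ sτ hl2) ?_
        intro w hw
        obtain ⟨x, hx, y, hy, rfl⟩ := hl2 w hw
        show f (mk x y) ∈ A
        rw [hf]; exact hσA x hx
    · have : ZZ (cross f g n c κ) = Z' κ * Z c := by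
        rw [ZZd, ← smul_eq_mul, ← map_smul]
        apply zc
        intro σ hσ sσ
        rw [Pi.smul_apply, smul_eq_mul, mul_comm, ← smul_eq_mul, ← map_smul]
        apply yc
        intro τ hτ sτ
        rw [EZ_cross mk f g hf hg n h1.norm h2.norm σ τ hσ (by rintro rfl; simp at hτ)]
        rfl
      rw [this]
      exact mul_ne_zero y3 z3

/-- powers -/
theorem Rob.pow {K : Type*} [MetricSpace K] {n : ℕ} {δ η : ℝ} {c : List K → F} {𝒜 : Set (Set K)}
    (h : Rob F K n δ η c 𝒜) (hδ : 0 < δ) (N : ℕ) : ∃ (c' : List (Fin N → K) → F) (𝒜' : Set (Set (Fin N → K))),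
      Rob F (Fin N → K) (n * N) δ η c' 𝒜' := by
  induction N with
  | zero =>
    refine ⟨fun l => if l.length = 1 then 1 else 0, ∅, ?_, ?_, ?_, ?_⟩
    · intro m a x b _
      refine if_neg ?_; simp; omega
    · intro l hl _
      simp only [mul_zero, zero_add] at hl
      obtain ⟨x, y, rfl⟩ := List.length_eq_two.1 hl
      simp [cobd_cons, sl]
    · intro l _ _ A hA; simp at hA
    · intro δ' hδ'
      refine ⟨LinearMap.proj [Fin.elim0], ?_, ?_, ?_⟩
      · intro c' h
        exact h _ (by simp) (by intro x hx y hy; rw [Subsingleton.elim x y, dist_self]; exact hδ')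
      · intro b hb _
        simp [cobd_cons, hb]
      · simp
  | succ N ih =>
    obtain ⟨c', 𝒜', h'⟩ := ih
    have := Rob.prod (W := Fin (N+1) → K) (fun x y => Fin.cons x y) (fun w => w 0) (fun w => Fin.tail w)
      (by intros; rfl) (by intros; rfl) ?_ h h'
    · rw [show n * (N + 1) = n + n * N by ring]
      exact ⟨_, _, this⟩
    · intro w w' r
      by_cases hr : 0 < r
      · rw [dist_pi_lt_iff hr, dist_pi_lt_iff hr, Fin.forall_fin_succ]; rfl
      · constructor
        · intro h; exact absurd (dist_nonneg.trans_lt h) hr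
        · intro h; exact absurd (dist_nonneg.trans_lt h.1) hr

end
end Part3

section Part4
def Vanish (F : Type*) [CommRing F] (K : Type*) [MetricSpace K] (n : ℕ) : Prop :=
  ∀ (A : Set K) (c : List K → F) (δ η : ℝ), 0 < δ → 0 < η →
    (∀ l : List K, l.length = n + 2 → Sm δ l → cobd c l = 0) →
    (∀ l : List K, l.length = n + 1 → Sm δ l → (∀ x ∈ l, ∃ a ∈ A, dist x a < η) → c l = 0) →
    ∃ δ' > 0, ∃ b : List K → F, (∀ l : List K, l.length = n + 1 → Sm δ' l → c l = cobd b l) ∧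
      (∀ l : List K, l.length = n → Sm δ' l → (∀ x ∈ l, x ∈ A) → b l = 0)

lemma Sop_support {X R : Type*} [CommRing R] [LinearOrder X] (φ : X → X) (c : List X → R) (l : List X)
    (h : ∀ l' : List X, l'.length = l.length → l'.Pairwise (· ≤ ·) → (∀ y ∈ l', ∃ x ∈ l, y = φ x) →
      c l' = 0) : Sop φ c l = 0 := by
  rw [Sop_congr φ c 0 l h]
  have := Sop_sub φ (0 : List X → R) 0 l
  simpa using this

lemma Hop_Sop_support {X R : Type*} [CommRing R] [LinearOrder X] (φ : X → X) (c : List X → R) (l : List X)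
    (h : ∀ l' : List X, l'.length = l.length + 1 → (∀ y ∈ l', y ∈ l ∨ ∃ x ∈ l, y = φ x) → c l' = 0) :
    Hop (Sop φ) c l = 0 := by
  rw [Hop_congr (Sop φ) c 0 {y | y ∈ l ∨ ∃ x ∈ l, y = φ x} l (fun x hx => Or.inl hx) _ h]
  · have := Hop_sub (Sop φ) (Sop_sub φ) (0 : List X → R) 0 l
    simpa using this
  · intro c c' τ hτ hcc
    apply Sop_congr
    intro l' h1 _ h3
    apply hcc l' h1
    intro y hy
    obtain ⟨x, hx, e⟩ := h3 y hy
    exact Or.inr ⟨x, hτ x hx, e⟩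

lemma Sop_homotopy {X R : Type*} [CommRing R] [LinearOrder X] (φ : X → X) (c : List X → R) (l : List X) :
    c l = Sop φ c l + Hop (Sop φ) (cobd c) l + cobd (Hop (Sop φ) c) l :=
  Hop_identity (Sop φ) (Sop_sub φ) (Sop_cobd φ) (Sop_nil φ) c l

theorem Rob.of_not_vanish {F : Type*} [Field F] {K : Type*} [MetricSpace K] {n : ℕ} (h : ¬ Vanish F K n) :
    ∃ (δ η : ℝ) (c : List K → F) (𝒜 : Set (Set K)), 0 < δ ∧ 0 < η ∧ Rob F K n δ η c 𝒜 := by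
  classical
  unfold Vanish at h
  push Not at h
  obtain ⟨A, c, δ, η, hδ, hη, hcoc, hvan, hess⟩ := h
  letI : LinearOrder K := linearOrderOfSTO (WellOrderingRel (α := K))
  refine ⟨δ, η, Sop id c, {A}, hδ, hη, Sop_normalized id c, ?_, ?_, ?_⟩
  · intro l hl hs
    rw [← Sop_cobd]
    apply Sop_support
    intro l' h1 _ h3
    apply hcoc l' (h1.trans hl) (hs.of_subset _)
    intro x hx
    obtain ⟨y, hy, rfl⟩ := h3 x hx
    exact hy
  · rintro l hl hs _ rfl hA
    apply Sop_support
    intro l' h1 _ h3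
    have hsub : ∀ x ∈ l', x ∈ l := by
      intro x hx
      obtain ⟨y, hy, rfl⟩ := h3 x hx
      exact hy
    exact hvan l' (h1.trans hl) (hs.of_subset hsub) (fun x hx => hA x (hsub x hx))
  · intro δ' hδ'
    set δ1 := min δ' δ with hδ1
    have hδpos1 : 0 < δ1 := lt_min hδ' hδ
    let S : Submodule F (List K → F) :=
      { carrier := {c' | ∃ b : List K → F, (∀ l : List K, l.length = n + 1 → Sm δ1 l → c' l = cobd b l) ∧
          (∀ l : List K, l.length = n → Sm δ1 l → (∀ x ∈ l, x ∈ A) → b l = 0)}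
        add_mem' := by
          rintro c1 c2 ⟨b1, h1, h1'⟩ ⟨b2, h2, h2'⟩
          refine ⟨b1 + b2, ?_, ?_⟩
          · intro l hl hs
            rw [cobd_add, Pi.add_apply, h1 l hl hs, h2 l hl hs]
          · intro l hl hs hA
            rw [Pi.add_apply, h1' l hl hs hA, h2' l hl hs hA, add_zero]
        zero_mem' := ⟨0, by simp, by simp⟩
        smul_mem' := by
          rintro a c1 ⟨b1, h1, h1'⟩
          refine ⟨a • b1, ?_, ?_⟩
          · intro l hl hs
            rw [cobd_smul, Pi.smul_apply, h1 l hl hs, smul_eq_mul]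
          · intro l hl hs hA
            rw [Pi.smul_apply, h1' l hl hs hA, smul_zero] }
    have hcS : c ∉ S := by
      rintro ⟨b, h1, h2⟩
      obtain ⟨l, a1, a2, a3, a4⟩ := hess δ1 hδpos1 b h1
      exact a4 (h2 l a1 a2 a3)
    obtain ⟨Z, hZ1, hZ2⟩ := Submodule.exists_le_ker_of_notMem hcS
    have hZS : ∀ c' ∈ S, Z c' = 0 := fun c' h => hZ2 h
    have z1 : ∀ c' : List K → F, (∀ l : List K, l.length = n + 1 → Sm δ1 l → c' l = 0) → Z c' = 0 := by
      intro c' h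
      exact hZS c' ⟨0, by simpa using h, by simp⟩
    have z2 : ∀ b : List K → F, (∀ l : List K, l.length = n → Sm δ1 l → (∀ x ∈ l, x ∈ A) → b l = 0) →
        Z (cobd b) = 0 := by
      intro b h
      exact hZS _ ⟨b, fun _ _ _ => rfl, h⟩
    refine ⟨Z, ?_, ?_, ?_⟩
    · intro c' h
      exact z1 c' fun l hl hs => h l hl (hs.mono (min_le_left _ _))
    · intro b _ h
      exact z2 b fun l hl hs hA => h A rfl l hl (hs.mono (min_le_left _ _)) hA
    · have e : c = Sop id c + Hop (Sop id) (cobd c) + cobd (Hop (Sop id) c) := by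
        ext l; exact Sop_homotopy id c l
      rw [e, map_add, map_add, z1 (Hop (Sop id) (cobd c)), z2] at hZ1
      · simpa using hZ1
      · intro l hl hs hA
        apply Hop_Sop_support
        intro l' h1 h3
        have hsub : ∀ x ∈ l', x ∈ l := by
          intro x hx
          rcases h3 x hx with h | ⟨y, hy, rfl⟩
          · exact h
          · exact hy
        exact hvan l' (by omega) ((hs.of_subset hsub).mono (min_le_right _ _)) fun x hx =>
          ⟨x, hA x (hsub x hx), by simpa using hη⟩
      · intro l hl hs
        apply Hop_Sop_support
        intro l' h1 h3
        have hsub : ∀ x ∈ l', x ∈ l := by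
          intro x hx
          rcases h3 x hx with h | ⟨y, hy, rfl⟩
          · exact h
          · exact hy
        exact hcoc l' (by omega) ((hs.of_subset hsub).mono (min_le_right _ _))

lemma nodup_of_sorted {X : Type*} [LinearOrder X] (l : List X) (h : l.Pairwise (· ≤ ·))
    (hd : ∀ a x b, l ≠ a ++ x :: x :: b) : l.Nodup := by
  induction l with
  | nil => simp
  | cons x l ih =>
    rw [List.pairwise_cons] at h
    rw [List.nodup_cons]
    refine ⟨?_, ih h.2 (fun a y b e => hd (x :: a) y b (by rw [e]; rfl))⟩
    intro hx
    rcases l with _ | ⟨y, l⟩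
    · simp at hx
    · have h1 : x ≤ y := h.1 y (by simp)
      have h2 : y ≤ x := by
        rcases List.mem_cons.1 hx with rfl | hx
        · exact le_rfl
        · exact (List.pairwise_cons.1 h.2).1 x hx
      have := le_antisymm h1 h2
      subst this
      exact hd [] x l rfl

theorem Rob.width {F : Type*} [Field F] {X : Type*} [MetricSpace X] [CompactSpace X] {k : ℕ} {δ η ε : ℝ}
    {c : List X → F} {𝒜 : Set (Set X)} (h : Rob F X k δ η c 𝒜) (hε : 2 * ε ≤ δ) (hεη : ε ≤ η)
    {ι : Type*} (U : ι → Set X) (hU : ∀ i, IsOpen (U i)) (hcov : ∀ x, ∃ i, x ∈ U i)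
    (hdiam : ∀ i, ∀ x ∈ U i, ∀ y ∈ U i, dist x y < ε)
    (hord : ∀ x, ∀ s : Finset ι, (∀ i ∈ s, x ∈ U i) → s.card ≤ k) : False := by
  classical
  obtain ⟨ℓ, hℓ, hleb⟩ := lebesgue_number_lemma_of_metric (s := (Set.univ : Set X)) isCompact_univ hU
    (fun x _ => Set.mem_iUnion.2 (hcov x))
  have hleb' : ∀ x, ∃ i, Metric.ball x ℓ ⊆ U i := fun x => hleb x trivial
  choose i hi using hleb'
  have hne : ∀ x, x ∈ U (i x) := fun x => hi x (Metric.mem_ball_self hℓ)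
  by_cases hX : IsEmpty X
  · obtain ⟨Z, z1, z2, z3⟩ := h.ess 1 one_pos
    apply z3
    apply z1
    intro l hl _
    rcases l with _ | ⟨x, l⟩
    · simp at hl
    · exact hX.elim x
  rw [not_isEmpty_iff] at hX
  let p : ι → X := fun j => if hj : (U j).Nonempty then hj.some else Classical.arbitrary X
  have hp : ∀ x, p (i x) ∈ U (i x) := by
    intro x
    have hj : (U (i x)).Nonempty := ⟨x, hne x⟩
    show (if hj : (U (i x)).Nonempty then hj.some else Classical.arbitrary X) ∈ U (i x)
    rw [dif_pos hj]; exact hj.some_mem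
  letI : LinearOrder X := linearOrderOfSTO (WellOrderingRel (α := X))
  let φ : X → X := fun x => p (i x)
  obtain ⟨Z, z1, z2, z3⟩ := h.ess ℓ hℓ
  -- all relevant points are close
  have hclose : ∀ l : List X, Sm ℓ l → ∀ x0 ∈ l, ∀ y, (y ∈ l ∨ ∃ x ∈ l, y = φ x) → dist y x0 < ε := by
    intro l hs x0 hx0 y hy
    have hin : ∀ x ∈ l, x0 ∈ U (i x) := fun x hx => hi x (hs x0 hx0 x hx)
    rcases hy with hy | ⟨x, hx, rfl⟩
    · exact hdiam _ _ (hne y) _ (hin y hy)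
    · exact hdiam _ _ (hp x) _ (hin x hx)
  have hsm : ∀ l : List X, Sm ℓ l → ∀ l' : List X, (∀ y ∈ l', y ∈ l ∨ ∃ x ∈ l, y = φ x) → Sm δ l' := by
    intro l hs l' hl' x hx y hy
    obtain ⟨x0, hx0⟩ : ∃ x0, x0 ∈ l := by
      rcases hl' x hx with h | ⟨z, hz, _⟩
      · exact ⟨_, h⟩
      · exact ⟨_, hz⟩
    have a1 := hclose l hs x0 hx0 x (hl' x hx)
    have a2 := hclose l hs x0 hx0 y (hl' y hy)
    rw [dist_comm] at a2
    have := dist_triangle x x0 y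
    linarith
  apply z3
  have e : c = Sop φ c + Hop (Sop φ) (cobd c) + cobd (Hop (Sop φ) c) := by
    ext l; exact Sop_homotopy φ c l
  rw [e, map_add, map_add, z1 (Sop φ c), z1 (Hop (Sop φ) (cobd c)), z2]
  · simp
  · simp
  · intro A hA l hl hs hlA
    apply Hop_Sop_support
    intro l' h1 h3
    refine h.van l' (by omega) (hsm l hs l' h3) A hA ?_
    intro y hy
    obtain ⟨x0, hx0⟩ : ∃ x0, x0 ∈ l := by
      rcases h3 y hy with h | ⟨z, hz, _⟩
      · exact ⟨_, h⟩
      · exact ⟨_, hz⟩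
    exact ⟨x0, hlA x0 hx0, (hclose l hs x0 hx0 y (h3 y hy)).trans_le hεη⟩
  · intro l hl hs
    apply Hop_Sop_support
    intro l' h1 h3
    exact h.coc l' (by omega) (hsm l hs l' h3)
  · intro l hl hs
    apply Sop_support
    intro l' h1 h2 h3
    by_contra hne0
    have hnd : l'.Nodup := by
      apply nodup_of_sorted l' h2
      intro a x b e
      exact hne0 (by rw [e]; exact h.norm _ a x b rfl)
    obtain ⟨x0, hx0⟩ : ∃ x0, x0 ∈ l := by
      rcases l with _ | ⟨x, l⟩
      · simp at hl
      · exact ⟨x, by simp⟩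
    have c1 := hord x0 (l.toFinset.image i) (by
      intro j hj
      obtain ⟨x, hx, rfl⟩ := Finset.mem_image.1 hj
      exact hi x (hs x0 hx0 x (List.mem_toFinset.1 hx)))
    have c2 : l'.toFinset ⊆ (l.toFinset.image i).image p := by
      intro y hy
      obtain ⟨x, hx, rfl⟩ := h3 y (List.mem_toFinset.1 hy)
      exact Finset.mem_image_of_mem _ (Finset.mem_image_of_mem _ (List.mem_toFinset.2 hx))
    have c3 := Finset.card_le_card c2
    rw [List.toFinset_card_of_nodup hnd] at c3
    have c4 := Finset.card_image_le (s := l.toFinset.image i) (f := p)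
    omega
end Part4

section Part5
lemma card_le_ord {X : Type*} [TopologicalSpace X] {β : Set (Set X)} {x : X} {s : Finset (Set X)}
    (hs : ∀ U ∈ s, U ∈ β ∧ x ∈ U) {k : ℕ} (hk : ord β ≤ k) : s.card ≤ k + 1 := by
  by_contra hcon
  push Not at hcon
  obtain ⟨t, hts, htc⟩ := Finset.exists_subset_card_eq (n := k + 2) (s := s) (by omega)
  have e := t.equivFinOfCardEq htc
  have : ((k + 1 : ℕ) : ℕ∞) ≤ ord β := by
    unfold ord
    refine le_iSup₂_of_le (k + 1) ?_ le_rfl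
    refine ⟨fun i => (e.symm i : Set X), ?_, ?_, x, ?_⟩
    · exact Subtype.val_injective.comp e.symm.injective
    · intro i; exact (hs _ (hts (e.symm i).2)).1
    · rw [Set.mem_iInter]; intro i; exact (hs _ (hts (e.symm i).2)).2
  have h2 := this.trans hk
  rw [Nat.cast_le] at h2
  omega

lemma ord_le {X : Type*} [TopologicalSpace X] {β : Set (Set X)} {k : ℕ}
    (h : ∀ x, ∀ s : Finset (Set X), (∀ U ∈ s, U ∈ β ∧ x ∈ U) → s.card ≤ k + 1) : ord β ≤ k := by
  classical
  unfold ord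
  refine iSup₂_le ?_
  rintro m ⟨f, hf, hfβ, x, hx⟩
  rw [Set.mem_iInter] at hx
  have := h x (Finset.univ.image f) (by
    intro U hU
    obtain ⟨i, _, rfl⟩ := Finset.mem_image.1 hU
    exact ⟨hfβ i, hx i⟩)
  rw [Finset.card_image_of_injective _ hf, Finset.card_univ, Fintype.card_fin] at this
  exact_mod_cast (by omega : m ≤ k)

section compat
variable {X : Type*} [TopologicalSpace X] {d : X → X → ℝ}

@[reducible] noncomputable def IsCompatMetric.pm (hd : IsCompatMetric d) : PseudoMetricSpace X :=
  PseudoMetricSpace.ofDistTopology d hd.refl hd.symm hd.triangle (by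
    intro s
    rw [hd.isOpen_iff])

lemma IsCompatMetric.continuous (hd : IsCompatMetric d) : Continuous (fun p : X × X => d p.1 p.2) := by
  letI := hd.pm
  exact continuous_dist

lemma IsCompatMetric.nonneg (hd : IsCompatMetric d) (x y : X) : 0 ≤ d x y := by
  letI := hd.pm
  exact dist_nonneg (x := x) (y := y)

lemma IsCompatMetric.bdd [CompactSpace X] (hd : IsCompatMetric d) : ∃ B, 0 ≤ B ∧ ∀ x y, d x y ≤ B := by
  obtain ⟨B, hB⟩ := (isCompact_range hd.continuous).bddAbove
  refine ⟨max B 0, le_max_right _ _, fun x y => (hB ⟨(x, y), rfl⟩).trans (le_max_left _ _)⟩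

lemma IsCompatMetric.unif [CompactSpace X] (hd : IsCompatMetric d) {K : Type*} [MetricSpace K] (f : X → K)
    (hf : Continuous f) (ε : ℝ) (hε : 0 < ε) : ∃ ε' > 0, ∀ x y, d x y < ε' → dist (f x) (f y) < ε := by
  letI := hd.pm
  have := CompactSpace.uniformContinuous_of_continuous hf
  rw [Metric.uniformContinuous_iff] at this
  obtain ⟨ε', h1, h2⟩ := this ε hε
  exact ⟨ε', h1, fun x y h => h2 h⟩

lemma dynDist_le (T : X → X) (n : ℕ) (x y : X) {B : ℝ} (hB : 0 ≤ B) (h : ∀ i < n, d (T^[i] x) (T^[i] y) ≤ B) :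
    dynDist d T n x y ≤ B := by
  apply Real.sSup_le _ hB
  rintro r ⟨i, hi, rfl⟩
  exact h i hi

lemma le_dynDist (T : X → X) (n : ℕ) (x y : X) {B : ℝ} (h : ∀ x y, d x y ≤ B) (i : ℕ) (hi : i < n) :
    d (T^[i] x) (T^[i] y) ≤ dynDist d T n x y := by
  apply le_csSup
  · refine ⟨B, ?_⟩
    rintro r ⟨i, hi, rfl⟩
    exact h _ _
  · exact ⟨i, hi, rfl⟩

lemma le_mesh {B : ℝ} (hB : 0 ≤ B) (h : ∀ x y, d x y ≤ B) {α : Set (Set X)} {U : Set X} (hU : U ∈ α) {x y : X}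
    (hx : x ∈ U) (hy : y ∈ U) : d x y ≤ mesh d α := by
  have hdiam : ∀ V : Set X, diamD d V ≤ B := by
    intro V
    apply Real.sSup_le _ hB
    rintro r ⟨x, _, y, _, rfl⟩
    exact h x y
  have h1 : d x y ≤ diamD d U := by
    apply le_csSup
    · refine ⟨B, ?_⟩
      rintro r ⟨x, _, y, _, rfl⟩
      exact h x y
    · exact ⟨x, hx, y, hy, rfl⟩
  refine h1.trans (le_csSup ?_ ⟨U, hU, rfl⟩)
  refine ⟨B, ?_⟩
  rintro r ⟨V, _, rfl⟩
  exact hdiam V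

lemma mesh_le {B : ℝ} (hB : 0 ≤ B) {α : Set (Set X)} (h : ∀ U ∈ α, ∀ x ∈ U, ∀ y ∈ U, d x y ≤ B) : mesh d α ≤ B := by
  apply Real.sSup_le _ hB
  rintro r ⟨V, hV, rfl⟩
  apply Real.sSup_le _ hB
  rintro r ⟨x, hx, y, hy, rfl⟩
  exact h V hV x hx y hy

end compat

lemma shift_iter {K : Type*} (i : ℕ) (x : ℤ → K) (j : ℤ) : (shift K)^[i] x j = x (j + i) := by
  induction i generalizing x with
  | zero => simp
  | succ i ih =>
    rw [Function.iterate_succ_apply, ih]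
    simp only [shift]
    congr 1; push_cast; ring

theorem lower_bound {F : Type*} [Field F] {K : Type*} [MetricSpace K] [CompactSpace K] [Nonempty K] {n : ℕ} {δ η : ℝ}
    {c : List K → F} {𝒜 : Set (Set K)} (h : Rob F K n δ η c 𝒜) (hδ : 0 < δ) (hη : 0 < η)
    (d : (ℤ → K) → (ℤ → K) → ℝ) (hd : IsCompatMetric d) : (n : ℝ≥0∞) ≤ mdim (shift K) d := by
  set ε := min (δ / 2) η with hε
  have hεp : 0 < ε := lt_min (by linarith) hη
  obtain ⟨B, hB0, hB⟩ := hd.bdd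
  obtain ⟨ε', hε', hu⟩ := hd.unif (fun x : ℤ → K => x 0) (continuous_apply 0) ε hεp
  unfold mdim
  refine le_iSup₂_of_le ε' hε' ?_
  refine le_liminf_of_le (by isBoundedDefault) ?_
  have key : ∀ N : ℕ, ((n * N : ℕ) : ℕ∞) ≤ widim ε' (dynDist d (shift K) N) := by
    intro N
    by_cases h0 : n * N = 0
    · rw [h0]; simp
    unfold widim
    refine le_iInf₂ ?_
    rintro α ⟨hα, hmesh⟩
    unfold covD
    refine le_iInf₂ ?_
    rintro β ⟨hβ, href⟩
    by_contra hcon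
    rw [not_le] at hcon
    have hord : ord β ≤ ((n * N - 1 : ℕ) : ℕ∞) := by
      have : (n * N : ℕ) = (n * N - 1) + 1 := by omega
      rw [this] at hcon
      exact Order.le_of_lt_add_one (by exact_mod_cast hcon)
    obtain ⟨c', 𝒜', hR⟩ := h.pow hδ N
    let pt : K := Classical.arbitrary K
    let e : (Fin N → K) → ℤ → K := fun x j => if hj : 0 ≤ j ∧ j.toNat < N then x ⟨j.toNat, hj.2⟩ else pt
    have he : Continuous e := by
      apply continuous_pi
      intro j
      by_cases hj : 0 ≤ j ∧ j.toNat < N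
      · simp only [e, dif_pos hj]; exact continuous_apply _
      · simp only [e, dif_neg hj]; exact continuous_const
    have hBd : ∀ x y, dynDist d (shift K) N x y ≤ B := fun x y => dynDist_le _ _ _ _ hB0 (fun i _ => hB _ _)
    refine hR.width (ε := ε) (by have := min_le_left (δ/2) η; linarith) (min_le_right _ _)
      (fun V : β => e ⁻¹' V.1) ?_ ?_ ?_ ?_
    · intro V; exact (hβ.1 V.1 V.2).preimage he
    · intro x
      have : e x ∈ ⋃₀ β := by rw [hβ.2]; trivial
      obtain ⟨V, hV, hx⟩ := this
      exact ⟨⟨V, hV⟩, hx⟩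
    · rintro ⟨V, hV⟩ x hx y hy
      obtain ⟨U, hU, hVU⟩ := href V hV
      have h1 : dynDist d (shift K) N (e x) (e y) < ε' :=
        (le_mesh hB0 hBd hU (hVU hx) (hVU hy)).trans_lt hmesh
      rw [dist_pi_lt_iff hεp]
      intro j
      have h2 := (le_dynDist (d := d) (shift K) N (e x) (e y) hB j.1 j.2).trans_lt h1
      have h3 := hu _ _ h2
      simp only [shift_iter, zero_add, e] at h3
      have hj : (0 : ℤ) ≤ (j.1 : ℤ) ∧ ((j.1 : ℤ)).toNat < N := ⟨by positivity, by simp⟩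
      rw [dif_pos hj, dif_pos hj] at h3
      simpa using h3
    · intro x s hs
      classical
      have := card_le_ord (x := e x) (β := β) (s := s.image Subtype.val) (by
        intro U hU
        obtain ⟨V, hV, rfl⟩ := Finset.mem_image.1 hU
        exact ⟨V.2, hs V hV⟩) hord
      rw [Finset.card_image_of_injective _ Subtype.val_injective] at this
      omega
  filter_upwards [eventually_gt_atTop 0] with N hN
  rw [ENNReal.le_div_iff_mul_le (Or.inl (by exact_mod_cast hN.ne')) (Or.inl (by simp))]
  have := ENat.toENNReal_le.2 (key N)
  simpa using this
end Part5

section Part6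
/-- cumulative sums -/
noncomputable def cum {N : ℕ} (a : Fin N → ℝ) (k : ℕ) : ℝ := ∑ u : Fin N, if u.val < k then a u else 0

@[simp] lemma cum_zero {N : ℕ} (a : Fin N → ℝ) : cum a 0 = 0 := by simp [cum]

lemma cum_succ {N : ℕ} (a : Fin N → ℝ) (v : Fin N) : cum a (v.val + 1) = cum a v.val + a v := by
  unfold cum
  have : ∀ u : Fin N, (if u.val < v.val + 1 then a u else 0) = (if u.val < v.val then a u else 0) + (if u = v then a u else 0) := by
    intro u
    by_cases h : u = v
    · subst h; simp
    · have : u.val ≠ v.val := fun e => h (Fin.ext e)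
      rw [if_neg h, add_zero]
      congr 1
      apply propext; omega
  rw [Finset.sum_congr rfl (fun u _ => this u), Finset.sum_add_distrib]
  simp

lemma cum_top {N : ℕ} (a : Fin N → ℝ) {k : ℕ} (hk : N ≤ k) : cum a k = ∑ u, a u := by
  unfold cum
  apply Finset.sum_congr rfl
  intro u _
  rw [if_pos (u.2.trans_le hk)]

lemma cum_mono {N : ℕ} {a : Fin N → ℝ} (ha : ∀ u, 0 ≤ a u) : Monotone (cum a) := by
  intro k l hkl
  apply Finset.sum_le_sum
  intro u _
  by_cases h : u.val < k
  · rw [if_pos h, if_pos (h.trans_le hkl)]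
  · rw [if_neg h]; split_ifs
    · exact ha u
    · exact le_rfl

lemma cum_continuous {X : Type*} [TopologicalSpace X] {N : ℕ} {a : Fin N → X → ℝ} (ha : ∀ u, Continuous (a u)) (k : ℕ) :
    Continuous (fun x => cum (fun u => a u x) k) := by
  unfold cum
  apply continuous_finsetSum
  intro u _
  split_ifs
  · exact ha u
  · exact continuous_const

/-- fine partition of unity -/
structure PU {K : Type*} [MetricSpace K] (n : ℕ) (ε : ℝ) (N : ℕ) (lam : Fin N → K → ℝ) : Prop where
  cont : ∀ v, Continuous (lam v)
  nonneg : ∀ v x, 0 ≤ lam v x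
  sum : ∀ x, ∑ v, lam v x = 1
  small : ∀ v, ∃ p, ∀ x, 0 < lam v x → dist x p < ε
  card : ∀ x, (Finset.univ.filter (fun v => 0 < lam v x)).card ≤ n + 1

theorem exists_PU {K : Type*} [MetricSpace K] [CompactSpace K] {n : ℕ} (h : topDim K ≤ n) {ε : ℝ} (hε : 0 < ε) :
    ∃ N lam, PU (K := K) n ε N lam := by
  classical
  set α : Set (Set K) := Set.range (fun x => Metric.ball x ε) with hα
  have hαc : IsOpenCover α := by
    refine ⟨?_, ?_⟩
    · rintro _ ⟨x, rfl⟩; exact Metric.isOpen_ball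
    · ext x; simp only [Set.mem_sUnion, Set.mem_univ, iff_true]
      exact ⟨_, ⟨x, rfl⟩, Metric.mem_ball_self hε⟩
  have h1 : covD α ≤ n := (le_iSup₂ (f := fun (α : Set (Set K)) (_ : α ∈ {α : Set (Set K) | IsOpenCover α}) => covD α) α hαc).trans h
  have h2 : covD α < ((n + 1 : ℕ) : ℕ∞) := h1.trans_lt (by exact_mod_cast Nat.lt_succ_self n)
  unfold covD at h2
  simp only [iInf_lt_iff] at h2
  obtain ⟨β, ⟨hβ, href⟩, hord⟩ := h2
  have hord' : ord β ≤ n := Order.le_of_lt_add_one (by exact_mod_cast hord)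
  obtain ⟨t, ht⟩ := isCompact_univ.elim_finite_subcover (fun V : β => V.1) (fun V => hβ.1 V.1 V.2) (by
    intro x _
    have : x ∈ ⋃₀ β := by rw [hβ.2]; trivial
    obtain ⟨V, hV, hx⟩ := this
    exact Set.mem_iUnion.2 ⟨⟨V, hV⟩, hx⟩)
  obtain ⟨f, hf⟩ := PartitionOfUnity.exists_isSubordinate (s := (Set.univ : Set K)) isClosed_univ
    (fun V : t => V.1.1) (fun V => hβ.1 V.1.1 V.1.2) (by
    intro x hx
    obtain ⟨V, hV, hx⟩ := Set.mem_iUnion₂.1 (ht hx)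
    exact Set.mem_iUnion.2 ⟨⟨V, hV⟩, hx⟩)
  let e := t.equivFin
  have hpos : ∀ V : t, ∀ x, 0 < f V x → x ∈ V.1.1 := by
    intro V x hx
    exact hf V (subset_tsupport _ hx.ne')
  refine ⟨t.card, fun v => f (e.symm v), ⟨fun v => (f _).continuous, fun v x => f.nonneg _ x, ?_, ?_, ?_⟩⟩
  · intro x
    have := f.sum_eq_one (Set.mem_univ x)
    rw [finsum_eq_sum_of_fintype] at this
    rw [← this]
    exact Equiv.sum_comp e.symm (fun V => f V x)
  · intro v
    obtain ⟨U, ⟨p, rfl⟩, hU⟩ := href _ (e.symm v).1.2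
    exact ⟨p, fun x hx => hU (hpos _ x hx)⟩
  · intro x
    have := card_le_ord (x := x) (β := β) (s := (Finset.univ.filter (fun v => 0 < f (e.symm v) x)).image (fun v => (e.symm v).1.1)) (by
      intro U hU
      obtain ⟨v, hv, rfl⟩ := Finset.mem_image.1 hU
      exact ⟨(e.symm v).1.2, hpos _ _ (Finset.mem_filter.1 hv).2⟩) hord'
    rwa [Finset.card_image_of_injective] at this
    exact (Subtype.val_injective.comp Subtype.val_injective).comp e.symm.injective

section Col
variable {K : Type*} [MetricSpace K]

def colU {N : ℕ} (lam : Fin N → K → ℝ) (θ : ℝ) (v : Fin N) : Set K :=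
  {x | cum (fun u => lam u x) v.val < θ ∧ θ < cum (fun u => lam u x) (v.val + 1)}

lemma colU_open {N : ℕ} {lam : Fin N → K → ℝ} (h : ∀ v, Continuous (lam v)) (θ : ℝ) (v : Fin N) : IsOpen (colU lam θ v) :=
  (isOpen_lt (cum_continuous h _) continuous_const).inter (isOpen_lt continuous_const (cum_continuous h _))

lemma colU_pos {N : ℕ} {lam : Fin N → K → ℝ} {θ : ℝ} {v : Fin N} {x : K} (hx : x ∈ colU lam θ v) : 0 < lam v x := by
  obtain ⟨h1, h2⟩ := hx
  rw [cum_succ] at h2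
  linarith

lemma colU_disj {N : ℕ} {lam : Fin N → K → ℝ} (h : ∀ v x, 0 ≤ lam v x) {θ : ℝ} {v w : Fin N} {x : K}
    (hv : x ∈ colU lam θ v) (hw : x ∈ colU lam θ w) : v = w := by
  by_contra hne
  have hm := cum_mono (a := fun u => lam u x) (fun u => h u x)
  rcases lt_or_gt_of_ne (fun e => hne (Fin.ext e) : v.val ≠ w.val) with hlt | hlt
  · have := hm (show v.val + 1 ≤ w.val by omega)
    have h1 := hv.2; have h2 := hw.1; linarith
  · have := hm (show w.val + 1 ≤ v.val by omega)
    have h1 := hw.2; have h2 := hv.1; linarith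

lemma colU_miss {n N : ℕ} {ε : ℝ} {lam : Fin N → K → ℝ} (h : PU n ε N lam) {ι : Type*} (θ : ι → ℝ) (hθ : Function.Injective θ)
    (h0 : ∀ i, 0 < θ i) (h1 : ∀ i, θ i < 1) (x : K) (s : Finset ι) (hs : ∀ i ∈ s, ∀ v, x ∉ colU lam (θ i) v) :
    s.card ≤ n := by
  classical
  have hex : ∀ i ∈ s, ∃ v : Fin N, 0 < lam v x ∧ cum (fun u => lam u x) v.val = θ i := by
    intro i hi
    have hex : ∃ w, θ i < cum (fun u => lam u x) w := ⟨N, by rw [cum_top _ le_rfl, h.sum]; exact h1 i⟩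
    set w := Nat.find hex with hw
    have hw1 : θ i < cum (fun u => lam u x) w := Nat.find_spec hex
    have hw0 : w ≠ 0 := by
      intro e; rw [e, cum_zero] at hw1; exact absurd hw1 (not_lt.2 (h0 i).le)
    obtain ⟨v, hv⟩ := Nat.exists_eq_succ_of_ne_zero hw0
    have hvN : v < N := by
      by_contra hcon
      have : w ≤ N := Nat.find_min' hex (by rw [cum_top _ le_rfl, h.sum]; exact h1 i)
      omega
    have hle : cum (fun u => lam u x) v ≤ θ i := by
      by_contra hcon
      have := Nat.find_min' hex (not_le.1 hcon)
      omega
    have hge : ¬ cum (fun u => lam u x) v < θ i := by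
      intro hlt
      exact hs i hi ⟨v, hvN⟩ ⟨hlt, by simpa [hv] using hw1⟩
    have heq := le_antisymm hle (not_lt.1 hge)
    refine ⟨⟨v, hvN⟩, ?_, heq⟩
    have := cum_succ (fun u => lam u x) ⟨v, hvN⟩
    simp only at this
    rw [hv] at hw1
    simp only [Nat.succ_eq_add_one] at hw1
    linarith
  rcases s.eq_empty_or_nonempty with rfl | ⟨i0, hi0⟩
  · simp
  have hNe : Nonempty (Fin N) := ⟨(hex i0 hi0).choose⟩
  choose! v hv1 hv2 using hex
  set S := Finset.univ.filter (fun v => 0 < lam v x) with hS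
  have hSne : S.Nonempty := ⟨v i0, by simp [hS, hv1 i0 hi0]⟩
  have hcard : s.card ≤ (S.erase (S.min' hSne)).card := by
    apply Finset.card_le_card_of_injOn v
    · intro i hi
      rw [Finset.mem_coe, Finset.mem_erase]
      refine ⟨?_, by simp [hS, hv1 i hi]⟩
      intro e
      have hz : cum (fun u => lam u x) (v i).val = 0 := by
        unfold cum
        apply Finset.sum_eq_zero
        intro u _
        split_ifs with hu
        · by_contra hne
          have : u ∈ S := by simp [hS]; exact lt_of_le_of_ne (h.nonneg u x) (Ne.symm hne)
          have := S.min'_le u this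
          rw [← e] at this
          exact absurd hu (not_lt.2 this)
        · rfl
      have := h0 i
      rw [← hv2 i hi, hz] at this
      exact lt_irrefl _ this
    · intro i hi j hj e
      apply hθ
      rw [← hv2 i hi, ← hv2 j hj, e]
  rw [Finset.card_erase_of_mem (S.min'_mem hSne)] at hcard
  have e1 := h.card x
  have e : S.card ≤ n + 1 := by convert e1
  omega

end Col

lemma compat_window {K : Type*} [MetricSpace K] [CompactSpace K] {d : (ℤ → K) → (ℤ → K) → ℝ} (hd : IsCompatMetric d)
    {ε : ℝ} (hε : 0 < ε) : ∃ (L : ℕ) (η : ℝ), 0 < η ∧ ∀ x y : ℤ → K, (∀ j : ℤ, |j| ≤ L → dist (x j) (y j) < η) → d x y < ε := by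
  by_contra hcon
  push Not at hcon
  let C : ℕ → Set ((ℤ → K) × (ℤ → K)) := fun L => {p | (∀ j : ℤ, |j| ≤ L → dist (p.1 j) (p.2 j) ≤ 1 / ((L : ℝ) + 1)) ∧ ε ≤ d p.1 p.2}
  have hcl : ∀ L, IsClosed (C L) := by
    intro L
    refine IsClosed.inter (s₁ := {p : (ℤ → K) × (ℤ → K) | ∀ j : ℤ, |j| ≤ L → dist (p.1 j) (p.2 j) ≤ 1 / ((L : ℝ) + 1)}) (s₂ := {p : (ℤ → K) × (ℤ → K) | ε ≤ d p.1 p.2}) ?_ ?_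
    · have : IsClosed (⋂ (j : ℤ) (_ : |j| ≤ L), {p : (ℤ → K) × (ℤ → K) | dist (p.1 j) (p.2 j) ≤ 1 / ((L : ℝ) + 1)}) := by
        refine isClosed_iInter fun j => isClosed_iInter fun _ => ?_
        exact isClosed_le (((continuous_apply j).comp continuous_fst).dist ((continuous_apply j).comp continuous_snd)) continuous_const
      convert this using 1
      ext p; simp only [Set.mem_iInter, Set.mem_setOf_eq]
    · exact isClosed_le continuous_const hd.continuous
  have hne := IsCompact.nonempty_iInter_of_sequence_nonempty_isCompact_isClosed C (by
      rintro L p ⟨h1, h2⟩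
      refine ⟨fun j hj => (h1 j (by push_cast; linarith)).trans ?_, h2⟩
      apply one_div_le_one_div_of_le (by positivity); push_cast; linarith) (by
      intro L
      obtain ⟨x, y, h1, h2⟩ := hcon L (1 / ((L : ℝ) + 1)) (by positivity)
      exact ⟨(x, y), fun j hj => (h1 j hj).le, h2⟩) (hcl 0).isCompact hcl
  obtain ⟨⟨x, y⟩, hxy⟩ := hne
  rw [Set.mem_iInter] at hxy
  have hxy2 : x = y := by
    ext j
    apply eq_of_forall_dist_le
    intro e he
    obtain ⟨m, hm⟩ := exists_nat_one_div_lt he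
    have := (hxy (max m j.natAbs)).1 j (by rw [Int.abs_eq_natAbs]; exact_mod_cast le_max_right _ _)
    refine this.trans (le_trans ?_ hm.le)
    apply one_div_le_one_div_of_le (by positivity)
    push_cast
    have := le_max_left (m : ℝ) (j.natAbs : ℝ)
    linarith
  have := (hxy 0).2
  subst hxy2
  simp only [hd.refl] at this
  linarith

theorem upper_bound {K : Type*} [MetricSpace K] [CompactSpace K] {n : ℕ} (hn : topDim K ≤ n)
    (d : (ℤ → K) → (ℤ → K) → ℝ) (hd : IsCompatMetric d) : mdim (shift K) d ≤ n := by
  classical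
  unfold mdim
  refine iSup₂_le ?_
  intro ε hε
  obtain ⟨L, η, hη, hLη⟩ := compat_window hd (half_pos hε)
  obtain ⟨N', lam, hPU⟩ := exists_PU hn (half_pos hη)
  have key : ∀ N : ℕ, widim ε (dynDist d (shift K) N) ≤ ((n * (N + (2 * L + 1)) : ℕ) : ℕ∞) := by
    intro N
    set J : Finset ℤ := Finset.Icc (-(L:ℤ)) (N + L) with hJ
    have hJc : J.card = N + (2 * L + 1) := by
      rw [hJ, Int.card_Icc]; omega
    set M := n * J.card with hM
    let θ : Fin (M + 1) → ℝ := fun i => ((i.val : ℝ) + 1) / (M + 2)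
    have hθi : Function.Injective θ := by
      intro i j hij
      have h2 : (0:ℝ) < M + 2 := by positivity
      have : ((i.val : ℝ) + 1) = ((j.val : ℝ) + 1) := by
        have := hij
        simp only [θ] at this
        field_simp at this
        linarith
      apply Fin.ext
      have h3 : (i.val : ℝ) = j.val := by linarith
      exact_mod_cast h3
    have hθ0 : ∀ i, 0 < θ i := fun i => by positivity
    have hθ1 : ∀ i, θ i < 1 := by
      intro i
      have h2 : (0:ℝ) < M + 2 := by positivity
      rw [div_lt_one h2]
      have : (i.val : ℝ) + 1 ≤ (M : ℝ) + 1 := by exact_mod_cast i.2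
      linarith
    let S : Fin (M + 1) × (J → Fin N') → Set (ℤ → K) := fun p => {x | ∀ j : J, x j ∈ colU lam (θ p.1) (p.2 j)}
    have hcov : IsOpenCover (Set.range S) := by
      refine ⟨?_, ?_⟩
      · rintro _ ⟨p, rfl⟩
        have : S p = ⋂ j : J, (fun x : ℤ → K => x j) ⁻¹' (colU lam (θ p.1) (p.2 j)) := by
          ext x; simp [S]
        rw [this]
        apply isOpen_iInter_of_finite
        intro j
        exact (colU_open hPU.cont _ _).preimage (continuous_apply (j : ℤ))
      · ext x
        simp only [Set.mem_sUnion, Set.mem_univ, iff_true]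
        let miss : ℤ → Finset (Fin (M + 1)) := fun j => Finset.univ.filter (fun i => ∀ v, x j ∉ colU lam (θ i) v)
        have hmiss : ∀ j, (miss j).card ≤ n := fun j =>
          colU_miss hPU θ hθi hθ0 hθ1 (x j) (miss j) (fun i hi => (Finset.mem_filter.1 hi).2)
        have hb : (J.biUnion miss).card ≤ M := by
          refine (Finset.card_biUnion_le_card_mul J miss n (fun j _ => hmiss j)).trans ?_
          rw [hM, mul_comm]
        obtain ⟨i, hi⟩ : ∃ i, i ∉ J.biUnion miss := by
          by_contra hcon
          push Not at hcon
          have : J.biUnion miss = Finset.univ := Finset.eq_univ_iff_forall.2 hcon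
          rw [this, Finset.card_univ, Fintype.card_fin] at hb
          omega
        have hv : ∀ j : J, ∃ v, x j ∈ colU lam (θ i) v := by
          intro j
          by_contra hcon
          push Not at hcon
          exact hi (Finset.mem_biUnion.2 ⟨j, j.2, Finset.mem_filter.2 ⟨Finset.mem_univ _, hcon⟩⟩)
        choose v hv using hv
        exact ⟨S (i, v), ⟨_, rfl⟩, hv⟩
    have hmesh : mesh (dynDist d (shift K) N) (Set.range S) ≤ ε / 2 := by
      apply mesh_le (half_pos hε).le
      rintro _ ⟨p, rfl⟩ x hx y hy
      apply dynDist_le _ _ _ _ (half_pos hε).le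
      intro i hi
      apply (hLη _ _ _).le
      intro j hj
      rw [shift_iter, shift_iter]
      rw [abs_le] at hj
      have hmem : j + i ∈ J := by rw [hJ, Finset.mem_Icc]; omega
      obtain ⟨q, hq⟩ := hPU.small (p.2 ⟨j + i, hmem⟩)
      have h1 := hq _ (colU_pos (hx ⟨j + i, hmem⟩))
      have h2 := hq _ (colU_pos (hy ⟨j + i, hmem⟩))
      have := dist_triangle_right (x (j + i)) (y (j + i)) q
      simp only at h1 h2
      linarith
    have hord : ord (Set.range S) ≤ (M : ℕ∞) := by
      apply ord_le
      intro x s hs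
      have hex : ∀ U ∈ s, ∃ p, U = S p ∧ x ∈ S p := by
        intro U hU
        obtain ⟨⟨p, rfl⟩, hx⟩ := hs U hU
        exact ⟨p, rfl, hx⟩
      rcases s.eq_empty_or_nonempty with rfl | ⟨U0, hU0⟩
      · simp
      have hNe : Nonempty (Fin (M + 1) × (J → Fin N')) := ⟨(hex U0 hU0).choose⟩
      choose! p hp1 hp2 using hex
      have : s.card ≤ (Finset.univ : Finset (Fin (M + 1))).card := by
        apply Finset.card_le_card_of_injOn (fun U => (p U).1) (fun _ _ => Finset.mem_coe.2 (Finset.mem_univ _))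
        intro U hU V hV e
        have hUV : p U = p V := by
          apply Prod.ext e
          ext j : 1
          have h1 := hp2 U hU j
          have h2 := hp2 V hV j
          simp only at e
          rw [← e] at h2
          exact colU_disj hPU.nonneg h1 h2
        rw [hp1 U hU, hp1 V hV, hUV]
      simpa using this
    rw [← hJc, ← hM]
    refine le_trans ?_ hord
    unfold widim
    refine (iInf₂_le (Set.range S) ⟨hcov, by linarith⟩).trans ?_
    unfold covD
    exact iInf₂_le (Set.range S) ⟨hcov, fun V hV => ⟨V, hV, le_rfl⟩⟩
  have hlim : Tendsto (fun N : ℕ => (n : ℝ≥0∞) + (n * (2 * L + 1) : ℕ) * ((N : ℝ≥0∞))⁻¹) atTop (nhds ((n : ℝ≥0∞) + (n * (2 * L + 1) : ℕ) * 0)) := by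
    apply Tendsto.const_add
    apply ENNReal.Tendsto.const_mul ENNReal.tendsto_inv_nat_nhds_zero
    right; exact ENNReal.natCast_ne_top _
  rw [mul_zero, add_zero] at hlim
  rw [← hlim.liminf_eq]
  refine liminf_le_liminf ?_ (by isBoundedDefault) (by isBoundedDefault)
  filter_upwards [eventually_gt_atTop 0] with N hN
  have h1 := ENat.toENNReal_le.2 (key N)
  refine (ENNReal.div_le_div_right h1 _).trans ?_
  have : ((((n * (N + (2 * L + 1)) : ℕ) : ℕ∞) : ℝ≥0∞)) = (n : ℝ≥0∞) * N + (n * (2 * L + 1) : ℕ) := by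
    simp only [ENat.toENNReal_coe]; push_cast; ring
  rw [this, ENNReal.div_eq_inv_mul, mul_add, mul_comm _ ((n : ℝ≥0∞) * N), mul_assoc, ENNReal.mul_inv_cancel (by exact_mod_cast hN.ne') (by simp), mul_one, mul_comm]
end Part6

section Part7
/-- Borsuk homotopy extension for maps avoiding the origin. -/
theorem hep {Y ι : Type*} [TopologicalSpace Y] [CompactSpace Y] [T2Space Y] [Fintype ι]
    (C : Set Y) (hC : IsClosed C) (G : Y → ι → ℝ) (hG : Continuous G) (hG0 : ∀ y, G y ≠ 0)
    (H : Y → ℝ → ι → ℝ) (hH : ContinuousOn (fun p : Y × ℝ => H p.1 p.2) (C ×ˢ Set.Icc 0 1))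
    (hH0 : ∀ y ∈ C, ∀ s ∈ Set.Icc (0:ℝ) 1, H y s ≠ 0) (hHG : ∀ y ∈ C, H y 0 = G y) :
    ∃ G' : Y → ι → ℝ, Continuous G' ∧ (∀ y, G' y ≠ 0) ∧ ∀ y ∈ C, G' y = H y 1 := by
  classical
  let D : Set (Y × Set.Icc (0:ℝ) 1) := {p | p.1 ∈ C}
  have hD : IsClosed D := hC.preimage continuous_fst
  have hcont : Continuous (fun p : D => fun i => H p.1.1 p.1.2 i - G p.1.1 i) := by
    have h1 : Continuous (fun p : D => H p.1.1 p.1.2) := by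
      have := hH.comp_continuous (f := fun p : D => ((p.1.1, (p.1.2 : ℝ)) : Y × ℝ)) (by fun_prop)
        (fun p => ⟨p.2, p.1.2.2⟩)
      exact this
    have h2 : Continuous (fun p : D => G p.1.1) := hG.comp (by fun_prop)
    exact continuous_pi fun i => ((continuous_apply i).comp h1).sub ((continuous_apply i).comp h2)
  have hext : ∀ i : ι, ∃ g : C((Y × Set.Icc (0:ℝ) 1), ℝ), ∀ p : D, g p.1 = H p.1.1 p.1.2 i - G p.1.1 i := by
    intro i
    obtain ⟨g, hg⟩ := ContinuousMap.exists_restrict_eq hD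
      (⟨fun p : D => H p.1.1 p.1.2 i - G p.1.1 i, (continuous_apply i).comp hcont⟩ : C(D, ℝ))
    refine ⟨g, fun p => ?_⟩
    have := DFunLike.congr_fun hg p
    exact this
  choose e he using hext
  let z0 : Set.Icc (0:ℝ) 1 := ⟨0, by simp⟩
  let Φ : (Y × Set.Icc (0:ℝ) 1) → ι → ℝ := fun p i => G p.1 i + e i p - e i (p.1, z0)
  have hΦ : Continuous Φ := by
    refine continuous_pi fun i => ?_
    have h2 : Continuous (fun p : (Y × Set.Icc (0:ℝ) 1) => G p.1 i) := (continuous_apply i).comp (hG.comp continuous_fst)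
    exact (h2.add (e i).continuous).sub ((e i).continuous.comp (continuous_fst.prodMk continuous_const))
  have hΦC : ∀ y ∈ C, ∀ s : Set.Icc (0:ℝ) 1, Φ (y, s) = H y s := by
    intro y hy s
    ext i
    have h1 := he i ⟨(y, s), hy⟩
    have h2 := he i ⟨(y, z0), hy⟩
    simp only [Φ]
    simp only at h1 h2
    rw [h1, h2]
    have h3 : H y (z0 : ℝ) = G y := hHG y hy
    rw [h3]; ring
  let B : Set Y := Prod.fst '' {p : (Y × Set.Icc (0:ℝ) 1) | Φ p = 0}
  have hB : IsClosed B := by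
    have : IsCompact {p : (Y × Set.Icc (0:ℝ) 1) | Φ p = 0} := (isClosed_eq hΦ continuous_const).isCompact
    exact (this.image continuous_fst).isClosed
  have hdisj : Disjoint B C := by
    rw [Set.disjoint_left]
    rintro y ⟨⟨y', s⟩, hp, rfl⟩ hy
    have := hΦC y' hy s
    rw [show Φ (y', s) = 0 from hp] at this
    exact hH0 y' hy s s.2 this.symm
  obtain ⟨χ, hχ0, hχ1, hχI⟩ := exists_continuous_zero_one_of_isClosed hB hC hdisj
  refine ⟨fun y => Φ (y, ⟨χ y, hχI y⟩), ?_, ?_, ?_⟩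
  · exact hΦ.comp (continuous_id.prodMk (by fun_prop))
  · intro y hy
    have hyB : y ∈ B := ⟨_, hy, rfl⟩
    have h0 : χ y = 0 := hχ0 hyB
    apply hG0 y
    rw [← hy]
    ext i
    have : (⟨χ y, hχI y⟩ : Set.Icc (0:ℝ) 1) = z0 := Subtype.ext h0
    simp only [Φ, this]; ring
  · intro y hy
    have h1 : χ y = 1 := hχ1 hy
    show Φ _ = _
    rw [hΦC y hy]
    simp [h1]

noncomputable def clip (x : ℝ) : ℝ := max 0 (min 1 x)

lemma clip_continuous : Continuous clip := by unfold clip; fun_prop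
lemma clip_zero {x : ℝ} (h : x ≤ 0) : clip x = 0 := by
  unfold clip; rw [max_eq_left]; exact (min_le_right _ _).trans h
lemma clip_one {x : ℝ} (h : 1 ≤ x) : clip x = 1 := by
  unfold clip; rw [min_eq_left h]; norm_num
lemma clip_mid {x : ℝ} (h : 0 ≤ x) (h1 : x ≤ 1) : clip x = x := by
  unfold clip; rw [min_eq_right h1, max_eq_right h]
lemma clip_nonneg (x : ℝ) : 0 ≤ clip x := le_max_left _ _
lemma clip_le (x : ℝ) : clip x ≤ 1 := max_le (by norm_num) (min_le_left _ _)
lemma clip_pos {x : ℝ} (h : 0 < clip x) : 0 < x := by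
  by_contra hc; rw [clip_zero (not_lt.1 hc)] at h; exact lt_irrefl _ h
lemma clip_lt {x : ℝ} (h : clip x < 1) : x < 1 := by
  by_contra hc; rw [clip_one (not_lt.1 hc)] at h; exact lt_irrefl _ h

noncomputable def psi (q : ℕ) (c : ℕ → ℝ) : ℝ := ∏ j ∈ Finset.Ioc 1 q, (1 - |2 * c j - 1|)

noncomputable def bub (q : ℕ) (r : ℝ) (c : ℕ → ℝ) : Fin (q + 1) → ℝ := fun i =>
  if i.val = 0 then - Real.sin (2 * Real.pi * r) * psi q c
  else if i.val = q then (1 - Real.cos (2 * Real.pi * r)) * psi q c - 1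
  else (c (i.val + 1) - 1 / 2) * psi q c * (1 - Real.cos (2 * Real.pi * r))

def star (q : ℕ) : Fin (q + 1) → ℝ := fun i => if i.val = q then -1 else 0

lemma star_ne (q : ℕ) : star q ≠ 0 := by
  intro h
  have := congrFun h ⟨q, by omega⟩
  simp [star] at this

lemma bub_periodic (q : ℕ) (r : ℝ) (k : ℤ) (c : ℕ → ℝ) : bub q (r + k) c = bub q r c := by
  have h1 : Real.sin (2 * Real.pi * (r + k)) = Real.sin (2 * Real.pi * r) := by
    rw [show 2 * Real.pi * (r + k) = 2 * Real.pi * r + k * (2 * Real.pi) by ring, Real.sin_add_int_mul_two_pi]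
  have h2 : Real.cos (2 * Real.pi * (r + k)) = Real.cos (2 * Real.pi * r) := by
    rw [show 2 * Real.pi * (r + k) = 2 * Real.pi * r + k * (2 * Real.pi) by ring, Real.cos_add_int_mul_two_pi]
  unfold bub; simp only [h1, h2]

lemma bub_psi {q : ℕ} (hq : 1 ≤ q) (r : ℝ) {c : ℕ → ℝ} (h : psi q c = 0) : bub q r c = star q := by
  ext i
  unfold bub star
  simp only [h]
  split_ifs <;> first | omega | simp

lemma bub_int {q : ℕ} (hq : 1 ≤ q) (k : ℤ) (c : ℕ → ℝ) : bub q k c = star q := by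
  have := bub_periodic q 0 k c
  rw [zero_add] at this
  rw [this]
  ext i
  unfold bub star
  split_ifs <;> first | omega | simp

lemma psi_zero {q : ℕ} {c : ℕ → ℝ} {j : ℕ} (h1 : 2 ≤ j) (h2 : j ≤ q) (h : c j = 0 ∨ c j = 1) : psi q c = 0 := by
  unfold psi
  apply Finset.prod_eq_zero (i := j) (by simp; omega)
  rcases h with h | h <;> rw [h] <;> norm_num

lemma bub_ne {q : ℕ} (hq : 1 ≤ q) (r : ℝ) (c : ℕ → ℝ) : bub q r c ≠ 0 := by
  intro h
  have h0 := congrFun h ⟨0, by omega⟩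
  have h1 := congrFun h ⟨q, by omega⟩
  have hq0 : q ≠ 0 := by omega
  simp only [bub, if_true, Pi.zero_apply, hq0, if_false] at h0 h1
  have hpsi : psi q c ≠ 0 := by intro e; rw [e] at h1; norm_num at h1
  have hsin : Real.sin (2 * Real.pi * r) = 0 := by
    rcases mul_eq_zero.1 h0 with h | h
    · linarith
    · exact absurd h hpsi
  have hcos : (1 - Real.cos (2 * Real.pi * r)) ≠ 0 := by intro e; rw [e] at h1; norm_num at h1
  have hcos2 : Real.cos (2 * Real.pi * r) = -1 := by
    have := Real.sin_sq_add_cos_sq (2 * Real.pi * r)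
    rw [hsin] at this
    have h3 : (1 - Real.cos (2 * Real.pi * r)) * (1 + Real.cos (2 * Real.pi * r)) = 0 := by linarith
    rcases mul_eq_zero.1 h3 with h | h
    · exact absurd h hcos
    · linarith
  have hc : ∀ j ∈ Finset.Ioc 1 q, (1 - |2 * c j - 1|) = 1 := by
    intro j hj
    rw [Finset.mem_Ioc] at hj
    have h2 := congrFun h ⟨j - 1, by omega⟩
    simp only [bub, Pi.zero_apply] at h2
    rw [if_neg (by omega), if_neg (by omega), show j - 1 + 1 = j by omega] at h2
    have : c j - 1 / 2 = 0 := by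
      rcases mul_eq_zero.1 h2 with h | h
      · rcases mul_eq_zero.1 h with h | h
        · exact h
        · exact absurd h hpsi
      · exact absurd h hcos
    rw [show c j = 1 / 2 by linarith]; norm_num
  have : psi q c = 1 := Finset.prod_eq_one hc
  rw [this, hcos2] at h1
  norm_num at h1

lemma bub_continuous {Y : Type*} [TopologicalSpace Y] (q : ℕ) {r : Y → ℝ} {c : ℕ → Y → ℝ} (hr : Continuous r)
    (hc : ∀ j, Continuous (c j)) : Continuous (fun y => bub q (r y) (fun j => c j y)) := by
  have hpsi : Continuous (fun y => psi q (fun j => c j y)) := by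
    unfold psi; exact continuous_finset_prod _ fun j _ => by have := hc j; fun_prop
  refine continuous_pi fun i => ?_
  unfold bub
  have := hc (i.val + 1)
  split_ifs <;> fun_prop

/-- cut-off in the `i`-th interval -/
noncomputable def cc (q i : ℕ) (x : ℝ) : ℝ := clip ((4 * ((q:ℝ) + 1) * x - (4 * i - 3)) / 2)

lemma cc_continuous (q i : ℕ) : Continuous (cc q i) := by
  unfold cc; exact clip_continuous.comp (by fun_prop)
lemma cc_pos {q i : ℕ} {x : ℝ} (h : 0 < cc q i x) : (4 * i - 3 : ℝ) < 4 * ((q:ℝ) + 1) * x := by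
  have := clip_pos h; linarith
lemma cc_lt {q i : ℕ} {x : ℝ} (h : cc q i x < 1) : 4 * ((q:ℝ) + 1) * x < (4 * i - 1 : ℝ) := by
  have := clip_lt h; linarith
lemma cc_sep {q i j : ℕ} {x y : ℝ} (hij : i < j) (h : cc q i x < 1) (h' : 0 < cc q j y) : x < y := by
  have h1 := cc_lt h
  have h2 := cc_pos h'
  have h3 : (i:ℝ) + 1 ≤ j := by exact_mod_cast hij
  have h4 : (0:ℝ) < (q:ℝ) + 1 := by positivity
  by_contra hc
  have : (4 * ((q:ℝ) + 1)) * y ≤ (4 * ((q:ℝ) + 1)) * x := mul_le_mul_of_nonneg_left (not_lt.1 hc) (by positivity)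
  linarith

def Act (q : ℕ) (M : ℕ → ℝ) : Prop := ∀ j, 1 ≤ j → j ≤ q → 0 < cc q j (M j) ∧ cc q j (M j) < 1

lemma bub_not_act {q : ℕ} (hq : 1 ≤ q) {M : ℕ → ℝ} (h : ¬ Act q M) {r : ℝ}
    (hr0 : cc q 1 (M 1) = 0 → ∃ k : ℤ, r = k) (hr1 : cc q 1 (M 1) = 1 → ∃ k : ℤ, r = k) :
    bub q r (fun j => cc q j (M j)) = star q := by
  unfold Act at h
  push Not at h
  obtain ⟨j, h1, h2, h3⟩ := h
  have h4 : cc q j (M j) = 0 ∨ cc q j (M j) = 1 := by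
    rcases (clip_nonneg _ : 0 ≤ cc q j (M j)).eq_or_lt with h | h
    · exact Or.inl h.symm
    · exact Or.inr (le_antisymm (clip_le _) (h3 h))
  rcases Nat.lt_or_ge 1 j with h5 | h5
  · exact bub_psi hq _ (psi_zero h5 h2 h4)
  · have : j = 1 := by omega
    subst this
    rcases h4 with h4 | h4
    · obtain ⟨k, rfl⟩ := hr0 h4; exact bub_int hq k _
    · obtain ⟨k, rfl⟩ := hr1 h4; exact bub_int hq k _

/-- an active sequence has no degenerate step -/
lemma Act.strict {q : ℕ} (hq : 1 ≤ q) {M : ℕ → ℝ} (h : Act q M) (h0 : M 0 = 0) (h1 : M (q + 1) = 1) {i : ℕ} (hi : i ≤ q) :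
    M i ≠ M (i + 1) := by
  intro e
  rcases Nat.eq_zero_or_pos i with rfl | hpos
  · have := cc_pos (h 1 le_rfl hq).1
    rw [zero_add] at e
    rw [← e, h0] at this
    norm_num at this
  · rcases Nat.lt_or_ge i q with hlt | hge
    · have := cc_sep (Nat.lt_succ_self i) (h i hpos hi).2 (h (i+1) (by omega) (by omega)).1
      rw [e] at this
      exact lt_irrefl _ this
    · have : i = q := by omega
      subst this
      have h2 := cc_lt (h i hpos hi).2
      rw [e, h1] at h2
      linarith
end Part7

section Part8
/-- drop the entry `i+1` of a sequence -/
def tau (i : ℕ) (m : ℕ → ℝ) : ℕ → ℝ := fun j => if j ≤ i then m j else m (j + 1)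

/-- half cut-offs -/
noncomputable def gh (q i : ℕ) (x : ℝ) : ℝ :=
  if Even i then clip (2 * ((4 * ((q:ℝ) + 1) * x - 1) / 2)) else clip (2 * ((4 * ((q:ℝ) + 1) * x - 1) / 2) - 1)

lemma gh_continuous (q i : ℕ) : Continuous (gh q i) := by
  unfold gh; split_ifs <;> exact clip_continuous.comp (by fun_prop)

lemma cc1 (q : ℕ) (x : ℝ) : cc q 1 x = clip ((4 * ((q:ℝ) + 1) * x - 1) / 2) := by
  unfold cc; norm_num

lemma gh_zero {q : ℕ} (i : ℕ) {x : ℝ} (h : cc q 1 x = 0) : gh q i x = 0 := by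
  rw [cc1] at h
  set y := (4 * ((q:ℝ) + 1) * x - 1) / 2
  have hy : y ≤ 0 := by
    by_contra hc
    have h0 : 0 < y := not_le.1 hc
    have : 0 < clip y := lt_max_of_lt_right (lt_min one_pos h0)
    linarith
  change (if Even i then clip (2 * y) else clip (2 * y - 1)) = 0
  split_ifs <;> exact clip_zero (by linarith)

lemma gh_one {q : ℕ} (i : ℕ) {x : ℝ} (h : cc q 1 x = 1) : gh q i x = 1 := by
  rw [cc1] at h
  set y := (4 * ((q:ℝ) + 1) * x - 1) / 2
  have hy : 1 ≤ y := by
    by_contra hc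
    have : clip y < 1 := max_lt one_pos (min_lt_of_right_lt (not_le.1 hc))
    linarith
  change (if Even i then clip (2 * y) else clip (2 * y - 1)) = 1
  split_ifs <;> exact clip_one (by linarith)

lemma gh_parity (q i : ℕ) (x : ℝ) : (gh q i x = 0 ∨ gh q i x = 1) ∨ (gh q (i+1) x = 0 ∨ gh q (i+1) x = 1) := by
  unfold gh
  set y := (4 * ((q:ℝ) + 1) * x - 1) / 2
  have key : clip (2 * y) = 1 ∨ clip (2 * y - 1) = 0 := by
    rcases le_total y (1/2) with h | h
    · exact Or.inr (clip_zero (by linarith))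
    · exact Or.inl (clip_one (by linarith))
  rcases Nat.even_or_odd i with h | h
  · have h2 : ¬ Even (i+1) := by rw [Nat.even_add_one]; simpa using h
    rw [if_pos h, if_neg h2]; tauto
  · have h1 : ¬ Even i := Nat.not_even_iff_odd.2 h
    have h2 : Even (i+1) := by rw [Nat.even_add_one]; exact h1
    rw [if_neg h1, if_pos h2]; tauto

lemma gh_add_two (q i : ℕ) (x : ℝ) : gh q (i + 2) x = gh q i x := by
  unfold gh; simp [Nat.even_add]

noncomputable def tube (q : ℕ) (A : ℕ → ℤ) (i : ℕ) (m : ℕ → ℝ) : Fin (q+1) → ℝ :=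
  bub q (A (i+1) * gh q i (tau i m 1)) (fun j => cc q j (tau i m j))

lemma tube_not_act {q : ℕ} (hq : 1 ≤ q) (A : ℕ → ℤ) (i : ℕ) (m : ℕ → ℝ) (h : ¬ Act q (tau i m)) : tube q A i m = star q := by
  unfold tube
  apply bub_not_act hq h
  · intro e; exact ⟨0, by rw [gh_zero i e]; simp⟩
  · intro e; exact ⟨A (i+1), by rw [gh_one i e]; simp⟩

lemma tube_not_half {q : ℕ} (hq : 1 ≤ q) (A : ℕ → ℤ) (i : ℕ) (m : ℕ → ℝ)
    (h : gh q i (tau i m 1) = 0 ∨ gh q i (tau i m 1) = 1) : tube q A i m = star q := by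
  unfold tube
  rcases h with e | e <;> rw [e]
  · have := bub_int hq 0 (fun j => cc q j (tau i m j)); simpa using this
  · have := bub_int hq (A (i+1)) (fun j => cc q j (tau i m j)); simpa using this

lemma tube_ne {q : ℕ} (hq : 1 ≤ q) (A : ℕ → ℤ) (i : ℕ) (m : ℕ → ℝ) : tube q A i m ≠ 0 := bub_ne hq _ _

lemma gh_even_lt {q i : ℕ} (hi : Even i) {x : ℝ} (h : ¬ (gh q i x = 0 ∨ gh q i x = 1)) :
    (4 * ((q:ℝ) + 1) * x - 1) / 2 < 1 / 2 := by
  by_contra hc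
  apply h; right
  unfold gh; rw [if_pos hi]; exact clip_one (by linarith)

lemma gh_odd_lt {q i : ℕ} (hi : ¬ Even i) {x : ℝ} (h : ¬ (gh q i x = 0 ∨ gh q i x = 1)) :
    1 / 2 < (4 * ((q:ℝ) + 1) * x - 1) / 2 := by
  by_contra hc
  apply h; left
  unfold gh; rw [if_neg hi]; exact clip_zero (by linarith)

lemma tube_disj {q : ℕ} (hq : 1 ≤ q) (A : ℕ → ℤ) {i i' : ℕ} (hii : i < i') (hi : i' ≤ q) (m : ℕ → ℝ)
    (hm : m 1 ≤ m 2) : tube q A i m = star q ∨ tube q A i' m = star q := by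
  by_contra hc
  push Not at hc
  have a1 : Act q (tau i m) := by by_contra h; exact hc.1 (tube_not_act hq A i m h)
  have a2 : Act q (tau i' m) := by by_contra h; exact hc.2 (tube_not_act hq A i' m h)
  have b1 : ¬ (gh q i (tau i m 1) = 0 ∨ gh q i (tau i m 1) = 1) := fun h => hc.1 (tube_not_half hq A i m h)
  have b2 : ¬ (gh q i' (tau i' m 1) = 0 ∨ gh q i' (tau i' m 1) = 1) := fun h => hc.2 (tube_not_half hq A i' m h)
  rcases Nat.lt_or_ge (i+1) i' with h | h
  · have h1 := (a1 (i+1) (by omega) (by omega)).2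
    have h2 := (a2 (i+2) (by omega) (by omega)).1
    simp only [tau] at h1 h2
    rw [if_neg (by omega)] at h1
    rw [if_pos (by omega)] at h2
    exact lt_irrefl _ (cc_sep (by omega) h1 h2)
  · have : i' = i + 1 := by omega
    subst this
    rcases Nat.eq_zero_or_pos i with rfl | hpos
    · have h1 := gh_even_lt (by simp) b1
      have h2 := gh_odd_lt (by simp) b2
      simp only [tau] at h1 h2
      norm_num at h1 h2
      have h4 : (0:ℝ) < (q:ℝ) + 1 := by positivity
      nlinarith
    · simp only [tau] at b1 b2
      rw [if_pos (by omega)] at b1 b2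
      have := gh_parity q i (m 1)
      tauto

lemma tau_face {j : ℕ} {m : ℕ → ℝ} (h : m (j+1) = m (j+2)) : tau j m = tau (j+1) m := by
  ext i
  unfold tau
  rcases lt_trichotomy i (j+1) with h1 | h1 | h1
  · rw [if_pos (by omega), if_pos (by omega)]
  · subst h1; rw [if_neg (by omega), if_pos le_rfl, h]
  · rw [if_neg (by omega), if_neg (by omega)]

lemma tau_strict {q : ℕ} (hq : 1 ≤ q) {i : ℕ} {m : ℕ → ℝ} (h0 : m 0 = 0) (h1 : m (q + 2) = 1)
    (hi : i ≤ q ∨ m (q + 1) = 1) (h : Act q (tau i m)) {j : ℕ} (hj : j ≤ q) : tau i m j ≠ tau i m (j+1) := by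
  apply h.strict hq _ _ hj
  · simp [tau, h0]
  · unfold tau
    split_ifs with h2
    · rcases hi with hi | hi
      · omega
      · exact hi
    · exact h1

/-- on the face `j` only the tubes `j-1`, `j` are visible -/
lemma face_act {q : ℕ} (hq : 1 ≤ q) {i j : ℕ} {m : ℕ → ℝ} (h0 : m 0 = 0) (h1 : m (q + 2) = 1)
    (hi : i ≤ q) (hj : j ≤ q + 1) (hf : m j = m (j+1)) (h : Act q (tau i m)) : i = j ∨ i + 1 = j := by
  by_contra hc
  rcases Nat.lt_or_ge j i with h2 | h2
  · apply tau_strict hq h0 h1 (Or.inl hi) h (j := j) (by omega)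
    unfold tau; rw [if_pos (by omega), if_pos (by omega), hf]
  · apply tau_strict hq h0 h1 (Or.inl hi) h (j := j - 1) (by omega)
    unfold tau; rw [if_neg (by omega), if_neg (by omega), show j - 1 + 1 = j by omega, hf]

lemma face_face {q : ℕ} (hq : 1 ≤ q) {j j' : ℕ} {m : ℕ → ℝ} (h0 : m 0 = 0) (h1 : m (q + 2) = 1)
    (hj : j ≤ q + 1) (hj' : j' ≤ q + 1) (hne : j ≠ j') (hf : m j = m (j+1)) (hf' : m j' = m (j'+1)) : ¬ Act q (tau j m) := by
  intro h
  have hi : j ≤ q ∨ m (q + 1) = 1 := by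
    rcases Nat.lt_or_ge q j with h2 | h2
    · have : j = q + 1 := by omega
      subst this; right; rw [hf, h1]
    · exact Or.inl h2
  rcases lt_or_gt_of_ne hne with h2 | h2
  · apply tau_strict hq h0 h1 hi h (j := j' - 1) (by omega)
    rcases Nat.lt_or_ge (j+1) j' with h3 | h3
    · unfold tau; rw [if_neg (by omega), if_neg (by omega), show j' - 1 + 1 = j' by omega, hf']
    · have : j' = j + 1 := by omega
      subst this
      unfold tau; rw [if_pos (by omega), if_neg (by omega)]; simp [hf, hf']
  · apply tau_strict hq h0 h1 hi h (j := j') (by omega)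
    unfold tau; rw [if_pos (by omega), if_pos (by omega), hf']

noncomputable def faceH (q : ℕ) (A k : ℕ → ℤ) (j : ℕ) (s : ℝ) (m : ℕ → ℝ) : Fin (q+1) → ℝ :=
  bub q ((1 - s) * (A (j+1) * gh q j (tau j m 1) + A j * gh q (j+1) (tau j m 1)) + s * (k j * cc q 1 (tau j m 1)))
    (fun i => cc q i (tau j m i))

lemma faceH_not_act {q : ℕ} (hq : 1 ≤ q) {A k : ℕ → ℤ} {j : ℕ} (hA : k j = A j + A (j+1)) (s : ℝ) (m : ℕ → ℝ)
    (h : ¬ Act q (tau j m)) : faceH q A k j s m = star q := by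
  unfold faceH
  apply bub_not_act hq h
  · intro e; exact ⟨0, by rw [gh_zero _ e, gh_zero _ e, e]; simp⟩
  · intro e; exact ⟨k j, by rw [gh_one _ e, gh_one _ e, e, hA]; push_cast; ring⟩

noncomputable def tubes (q : ℕ) (A : ℕ → ℤ) (m : ℕ → ℝ) : Fin (q+1) → ℝ :=
  star q + ∑ i ∈ Finset.range (q + 2), (tube q A i m - star q)

lemma tube_last {q : ℕ} (hq : 1 ≤ q) {A : ℕ → ℤ} (h : A (q+2) = 0) (m : ℕ → ℝ) : tube q A (q+1) m = star q := by
  unfold tube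
  rw [h]
  have := bub_int hq 0 (fun j => cc q j (tau (q+1) m j)); simpa using this

lemma tubes_ne {q : ℕ} (hq : 1 ≤ q) {A : ℕ → ℤ} (h : A (q+2) = 0) (m : ℕ → ℝ) (hm : m 1 ≤ m 2) : tubes q A m ≠ 0 := by
  unfold tubes
  by_cases hex : ∃ i ∈ Finset.range (q+2), tube q A i m ≠ star q
  · obtain ⟨i, hi, hne⟩ := hex
    rw [Finset.sum_eq_single i]
    · rw [add_sub_cancel]; exact tube_ne hq A i m
    · intro b hb hbi
      rw [Finset.mem_range] at hi hb
      have hiq : i ≤ q := by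
        by_contra hc
        have : i = q + 1 := by omega
        subst this; exact hne (tube_last hq h m)
      rw [sub_eq_zero]
      rcases Nat.lt_or_ge q b with h2 | h2
      · have : b = q + 1 := by omega
        subst this; exact tube_last hq h m
      rcases lt_or_gt_of_ne hbi with h3 | h3
      · rcases tube_disj hq A h3 hiq m hm with h4 | h4
        · exact h4
        · exact absurd h4 hne
      · rcases tube_disj hq A h3 h2 m hm with h4 | h4
        · exact absurd h4 hne
        · exact h4
    · intro hc; exact absurd hi hc
  · push Not at hex
    rw [Finset.sum_eq_zero (fun i hi => by rw [hex i hi, sub_self]), add_zero]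
    exact star_ne q

lemma tubes_face {q : ℕ} (hq : 1 ≤ q) {A k : ℕ → ℤ} (hA0 : A 0 = 0) (h : A (q+2) = 0) {j : ℕ} (hj : j ≤ q + 1)
    (hA : k j = A j + A (j+1)) (m : ℕ → ℝ) (h0 : m 0 = 0) (h1 : m (q + 2) = 1) (hf : m j = m (j+1)) :
    tubes q A m = faceH q A k j 0 m := by
  have hother : ∀ i ∈ Finset.range (q+2), i ≠ j → i + 1 ≠ j → tube q A i m - star q = 0 := by
    intro i hi h2 h3
    rw [Finset.mem_range] at hi
    rw [sub_eq_zero]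
    rcases Nat.lt_or_ge q i with h4 | h4
    · have : i = q + 1 := by omega
      subst this; exact tube_last hq h m
    · apply tube_not_act hq
      intro hact
      rcases face_act hq h0 h1 h4 hj hf hact with h5 | h5 <;> tauto
  unfold tubes
  rcases Nat.eq_zero_or_pos j with rfl | hpos
  · rw [Finset.sum_eq_single 0 (fun b hb hb0 => hother b hb hb0 (by omega)) (fun hc => absurd (Finset.mem_range.2 (by omega)) hc)]
    rw [add_sub_cancel]
    unfold tube faceH
    rw [hA0]; simp
  · obtain ⟨j, rfl⟩ := Nat.exists_eq_succ_of_ne_zero hpos.ne'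
    simp only [Nat.succ_eq_add_one] at *
    have htau : tau j m = tau (j+1) m := tau_face hf
    rw [Finset.sum_eq_add j (j+1) (by omega) (fun b hb hb0 => hother b hb hb0.2 (by omega))
      (fun hc => absurd (Finset.mem_range.2 (by omega)) hc) (fun hc => absurd (Finset.mem_range.2 (by omega)) hc)]
    set x := tau (j+1) m 1 with hx
    have e1 : tube q A j m = bub q (A (j+1) * gh q j x) (fun i => cc q i (tau (j+1) m i)) := by
      unfold tube; rw [htau]
    have e2 : tube q A (j+1) m = bub q (A (j+2) * gh q (j+1) x) (fun i => cc q i (tau (j+1) m i)) := rfl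
    have e3 : faceH q A k (j+1) 0 m = bub q (A (j+2) * gh q (j+1) x + A (j+1) * gh q j x) (fun i => cc q i (tau (j+1) m i)) := by
      unfold faceH; rw [gh_add_two]; simp [hx]
    have hbub_int : ∀ a : ℤ, bub q a (fun i => cc q i (tau (j+1) m i)) = star q := fun a => bub_int hq a _
    have hp : ∀ i, (gh q i x = 0 ∨ gh q i x = 1) → ∀ a : ℤ, ∃ b : ℤ, a * gh q i x = b := by
      rintro i (e | e) a
      · exact ⟨0, by rw [e]; simp⟩
      · exact ⟨a, by rw [e]; simp⟩
    rcases gh_parity q j x with hpar | hpar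
    · obtain ⟨b, hb⟩ := hp j hpar (A (j+1))
      rw [e1, e2, e3, hb, bub_periodic, hbub_int b]; abel
    · obtain ⟨b, hb⟩ := hp (j+1) hpar (A (j+2))
      rw [e1, e2, e3, hb, add_comm (b:ℝ), bub_periodic, hbub_int b]; abel

lemma faceH_one (q : ℕ) (A k : ℕ → ℤ) (j : ℕ) (m : ℕ → ℝ) :
    faceH q A k j 1 m = bub q (k j * cc q 1 (tau j m 1)) (fun i => cc q i (tau j m i)) := by
  unfold faceH; simp

lemma tau_continuous {Y : Type*} [TopologicalSpace Y] {M : ℕ → Y → ℝ} (hM : ∀ j, Continuous (M j)) (i j : ℕ) :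
    Continuous (fun y => tau i (fun j => M j y) j) := by
  unfold tau; split_ifs
  · exact hM _
  · exact hM _

lemma faceH_continuous {Y : Type*} [TopologicalSpace Y] {q : ℕ} {M : ℕ → Y → ℝ} (hM : ∀ j, Continuous (M j)) (A k : ℕ → ℤ) (j : ℕ) :
    Continuous (fun p : Y × ℝ => faceH q A k j p.2 (fun i => M i p.1)) := by
  have ht : ∀ i, Continuous (fun p : Y × ℝ => tau j (fun i => M i p.1) i) :=
    fun i => (tau_continuous hM j i).comp continuous_fst
  have e1 : Continuous (fun p : Y × ℝ => gh q j (tau j (fun i => M i p.1) 1)) := (gh_continuous q j).comp (ht 1)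
  have e2 : Continuous (fun p : Y × ℝ => gh q (j+1) (tau j (fun i => M i p.1) 1)) := (gh_continuous q (j+1)).comp (ht 1)
  have e3 : Continuous (fun p : Y × ℝ => cc q 1 (tau j (fun i => M i p.1) 1)) := (cc_continuous q 1).comp (ht 1)
  have er : Continuous (fun p : Y × ℝ => (1 - p.2) * (A (j+1) * gh q j (tau j (fun i => M i p.1) 1) + A j * gh q (j+1) (tau j (fun i => M i p.1) 1)) + p.2 * (k j * cc q 1 (tau j (fun i => M i p.1) 1))) :=
    ((continuous_const.sub continuous_snd).mul ((continuous_const.mul e1).add (continuous_const.mul e2))).add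
      (continuous_snd.mul (continuous_const.mul e3))
  have ec : ∀ i, Continuous (fun p : Y × ℝ => cc q i (tau j (fun i => M i p.1) i)) := fun i => (cc_continuous q i).comp (ht i)
  have h := bub_continuous q er ec
  unfold faceH
  exact h

lemma tubes_continuous {Y : Type*} [TopologicalSpace Y] {q : ℕ} {M : ℕ → Y → ℝ} (hM : ∀ j, Continuous (M j)) (A : ℕ → ℤ) :
    Continuous (fun y => tubes q A (fun i => M i y)) := by
  unfold tubes tube
  refine continuous_const.add (continuous_finset_sum _ fun i _ => Continuous.sub ?_ continuous_const)
  have ht : ∀ j, Continuous (fun y => tau i (fun i => M i y) j) := tau_continuous hM i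
  have er : Continuous (fun y => (A (i+1) : ℝ) * gh q i (tau i (fun i => M i y) 1)) :=
    continuous_const.mul ((gh_continuous q i).comp (ht 1))
  exact bub_continuous q (c := fun j y => cc q j (tau i (fun i => M i y) j)) er (fun j => (cc_continuous q j).comp (ht j))

theorem simplex_ext {Y : Type*} [TopologicalSpace Y] [CompactSpace Y] [T2Space Y] {q : ℕ} (hq : 1 ≤ q)
    (M : ℕ → Y → ℝ) (hM : ∀ j, Continuous (M j)) (hmono : ∀ y, M 1 y ≤ M 2 y) (h0 : ∀ y, M 0 y = 0)
    (h1 : ∀ y, M (q+2) y = 1) (k : ℕ → ℤ) (hk : ∑ i ∈ Finset.range (q+2), (-1)^i * k i = 0) :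
    ∃ g : Y → Fin (q+1) → ℝ, Continuous g ∧ (∀ y, g y ≠ 0) ∧ ∀ y, ∀ j ≤ q + 1, M j y = M (j+1) y →
      g y = bub q (k j * cc q 1 (tau j (fun i => M i y) 1)) (fun i => cc q i (tau j (fun i => M i y) i)) := by
  classical
  let A : ℕ → ℤ := fun n => (-1)^(n+1) * ∑ i ∈ Finset.range n, (-1)^i * k i
  have hA0 : A 0 = 0 := by simp [A]
  have hAq : A (q+2) = 0 := by simp only [A, hk, mul_zero]
  have hA : ∀ j, k j = A j + A (j+1) := by
    intro j
    simp only [A, Finset.sum_range_succ]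
    have : ((-1:ℤ))^j * (-1)^j = 1 := by rw [← mul_pow]; simp
    ring_nf
    rw [show j * 2 = j + j by ring, pow_add, this]; ring
  let C : ℕ → Set Y := fun j => {y | M j y = M (j+1) y}
  have hC : ∀ j, IsClosed (C j) := fun j => isClosed_eq (hM _) (hM _)
  let D : Set Y := ⋃ j : Fin (q+2), C j
  have hD : IsClosed D := isClosed_iUnion_of_finite fun j => hC _
  let jj : Y → ℕ := fun y => if h : ∃ j : Fin (q+2), y ∈ C j then (h.choose : ℕ) else 0
  have hjj : ∀ y ∈ D, jj y ≤ q + 1 ∧ y ∈ C (jj y) := by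
    intro y hy
    have h : ∃ j : Fin (q+2), y ∈ C j := by simpa [D] using hy
    simp only [jj, dif_pos h]
    exact ⟨by have := h.choose.2; omega, h.choose_spec⟩
  let H : Y → ℝ → Fin (q+1) → ℝ := fun y s => faceH q A k (jj y) s (fun i => M i y)
  have hHj : ∀ j ≤ q + 1, ∀ y ∈ C j, ∀ s, H y s = faceH q A k j s (fun i => M i y) := by
    intro j hj y hy s
    have hyD : y ∈ D := Set.mem_iUnion.2 ⟨⟨j, by omega⟩, hy⟩
    obtain ⟨h2, h3⟩ := hjj y hyD
    by_cases e : jj y = j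
    · simp only [H, e]
    · simp only [H]
      rw [faceH_not_act hq (hA _) _ _ (face_face (m := fun i => M i y) hq (h0 y) (h1 y) h2 hj e h3 hy),
        faceH_not_act hq (hA _) _ _ (face_face (m := fun i => M i y) hq (h0 y) (h1 y) hj h2 (Ne.symm e) hy h3)]
  have hcontF : ∀ j, Continuous (fun p : Y × ℝ => faceH q A k j p.2 (fun i => M i p.1)) := faceH_continuous hM A k
  have hHc : ContinuousOn (fun p : Y × ℝ => H p.1 p.2) (D ×ˢ Set.Icc 0 1) := by
    have hU : D ×ˢ Set.Icc (0:ℝ) 1 = ⋃ j : Fin (q+2), C j ×ˢ Set.Icc (0:ℝ) 1 := by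
      simp only [D]; rw [Set.iUnion_prod_const]
    rw [hU]
    apply LocallyFinite.continuousOn_iUnion (locallyFinite_of_finite _) (fun j : Fin (q+2) => (hC j).prod isClosed_Icc)
    intro j
    apply (hcontF j).continuousOn.congr
    rintro ⟨y, s⟩ ⟨hy, -⟩
    exact hHj j (by have := j.2; omega) y hy s
  have hHne : ∀ y ∈ D, ∀ s ∈ Set.Icc (0:ℝ) 1, H y s ≠ 0 := fun y _ s _ => bub_ne hq _ _
  have hHG : ∀ y ∈ D, H y 0 = tubes q A (fun i => M i y) := by
    intro y hy
    obtain ⟨h2, h3⟩ := hjj y hy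
    exact (tubes_face hq hA0 hAq h2 (hA _) (fun i => M i y) (h0 y) (h1 y) h3).symm
  obtain ⟨g, hg1, hg2, hg3⟩ := hep D hD (fun y => tubes q A (fun i => M i y)) (tubes_continuous hM A)
    (fun y => tubes_ne hq hAq _ (hmono y)) H hHc hHne hHG
  refine ⟨g, hg1, hg2, ?_⟩
  intro y j hj hy
  rw [hg3 y (Set.mem_iUnion.2 ⟨⟨j, by omega⟩, hy⟩), hHj j hj y hy, faceH_one]
end Part8

section Part9
lemma cobd_eraseIdx {V R : Type*} [CommRing R] (l : List V) (c : List V → R) :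
    cobd c l = ∑ i ∈ Finset.range l.length, (-1)^i * c (l.eraseIdx i) := by
  induction l generalizing c with
  | nil => simp [cobd_nil]
  | cons x l ih =>
    rw [cobd_cons, ih, List.length_cons, Finset.sum_range_succ']
    simp only [List.eraseIdx_cons_succ, List.eraseIdx_cons_zero, pow_succ, pow_zero, sl]
    rw [sub_eq_add_neg, ← Finset.sum_neg_distrib, add_comm, one_mul]
    congr 1
    exact Finset.sum_congr rfl fun i _ => by ring

/-- the iterated product of threshold cochains -/
def Wn {V R : Type*} [CommRing R] : ℕ → (ℕ → V → R) → (V → R) → List V → R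
  | 0, _, g, [x] => g x
  | n+1, H, g, x :: y :: l => (H 0 y - H 0 x) * Wn n (fun i => H (i+1)) g (y :: l)
  | _, _, _, _ => 0

lemma Wn_eq_prod {V R : Type*} [CommRing R] (v0 : V) (n : ℕ) (H : ℕ → V → R) (g : V → R) (l : List V) (hl : l.length = n + 1) :
    Wn n H g l = (∏ i ∈ Finset.range n, (H i (l.getD (i+1) v0) - H i (l.getD i v0))) * g (l.getD n v0) := by
  induction n generalizing H l with
  | zero =>
    obtain ⟨x, rfl⟩ := List.length_eq_one_iff.1 hl
    simp [Wn]
  | succ n ih =>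
    match l, hl with
    | x :: y :: l, hl =>
      rw [Wn, ih _ _ (by simpa using hl), Finset.prod_range_succ']
      simp only [List.getD_cons_succ, List.getD_cons_zero]
      ring

noncomputable def MM {V : Type*} (f : V → ℝ) (l : List V) (j : ℕ) : ℝ := ((l.take j).map f).sum

lemma MM_zero {V : Type*} (f : V → ℝ) (l : List V) : MM f l 0 = 0 := by simp [MM]

lemma MM_succ {V : Type*} (f : V → ℝ) (l : List V) {j : ℕ} (hj : j < l.length) : MM f l (j+1) = MM f l j + f l[j] := by
  unfold MM; rw [List.take_succ_eq_append_getElem hj, List.map_append, List.sum_append, List.map_singleton, List.sum_singleton]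

lemma MM_mono {V : Type*} {f : V → ℝ} (hf : ∀ v, 0 ≤ f v) (l : List V) : Monotone (MM f l) := by
  refine monotone_nat_of_le_succ fun j => ?_
  rcases lt_or_ge j l.length with h | h
  · rw [MM_succ f l h]; linarith [hf l[j]]
  · unfold MM; rw [List.take_of_length_le h, List.take_of_length_le (by omega)]

lemma MM_strict {V : Type*} {f : V → ℝ} {l : List V} (hf : ∀ v ∈ l, 0 < f v) {i j : ℕ} (h : i < j) (hj : j ≤ l.length) : MM f l i < MM f l j := by
  induction j, h using Nat.le_induction with
  | base => rw [MM_succ f l (by omega)]; linarith [hf l[i] (by simp)]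
  | succ j hij ih => rw [MM_succ f l (by omega)]; linarith [hf l[j] (by simp), ih (by omega)]

lemma MM_eraseIdx {V : Type*} (f : V → ℝ) (l : List V) (j i : ℕ) (hj : j < l.length) (h : f l[j] = 0) :
    MM f (l.eraseIdx j) i = tau j (MM f l) i := by
  induction l generalizing i j with
  | nil => simp at hj
  | cons x l ih =>
    cases i with
    | zero => simp [MM, tau]
    | succ i =>
      cases j with
      | zero => simp at h; simp [MM, tau, h]
      | succ j =>
        have := ih j i (by simpa using hj) (by simpa using h)
        simp only [MM, tau, List.eraseIdx_cons_succ, List.take_succ_cons, List.map_cons, List.sum_cons] at this ⊢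
        rw [this]
        by_cases hij : i ≤ j
        · simp [hij]
        · rw [if_neg hij, if_neg (by omega)]

lemma MM_continuous {Z V : Type*} [TopologicalSpace Z] {ω : V → Z → ℝ} (h : ∀ v, Continuous (ω v)) (l : List V) (j : ℕ) :
    Continuous (fun z => MM (fun v => ω v z) l j) := by
  unfold MM
  induction (l.take j) with
  | nil => simpa using continuous_const
  | cons x l ih => simp only [List.map_cons, List.sum_cons]; exact (h x).add ih

lemma thr {V : Type*} (v0 : V) (P : V → Prop) [DecidablePred P] (l : List V) (h : l.Pairwise (fun a b => P b → P a)) :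
    ∃ τ ≤ l.length, (∀ j < l.length, P (l.getD j v0) ↔ j < τ) ∧ ∀ f : V → ℝ, (l.map (fun v => if P v then f v else 0)).sum = MM f l τ := by
  induction l with
  | nil => exact ⟨0, by simp, by simp, by simp [MM]⟩
  | cons a l ih =>
    rw [List.pairwise_cons] at h
    obtain ⟨τ, h1, h2, h3⟩ := ih h.2
    by_cases ha : P a
    · refine ⟨τ + 1, by simpa using h1, ?_, ?_⟩
      · intro j hj
        cases j with
        | zero => simpa using ha
        | succ j => rw [List.getD_cons_succ, h2 j (by simpa using hj)]; omega
      · intro f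
        have := h3 f
        simp only [List.map_cons, List.sum_cons, if_pos ha, this, MM, List.take_succ_cons]
    · have hn : ∀ b ∈ l, ¬ P b := fun b hb hp => ha (h.1 b hb hp)
      refine ⟨0, by simp, ?_, ?_⟩
      · intro j hj
        have hm : (a :: l).getD j v0 ∈ a :: l := by rw [List.getD_eq_getElem _ _ hj]; exact List.getElem_mem _
        refine iff_of_false ?_ (by omega)
        rcases List.mem_cons.1 hm with e | e
        · rw [e]; exact ha
        · exact hn _ e
      · intro f
        rw [MM_zero]
        apply List.sum_eq_zero
        intro x hx
        rw [List.mem_map] at hx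
        obtain ⟨v, hv, rfl⟩ := hx
        rw [if_neg]
        rcases List.mem_cons.1 hv with e | e
        · rw [e]; exact ha
        · exact hn _ e

noncomputable def bet {V : Type*} (q : ℕ) (f : V → ℝ) (k : ℤ) (l : List V) : Fin (q+1) → ℝ :=
  bub q (k * cc q 1 (MM f l 1)) (fun i => cc q i (MM f l i))

lemma bet_not_act {V : Type*} {q : ℕ} (hq : 1 ≤ q) (f : V → ℝ) (k : ℤ) (l : List V) (h : ¬ Act q (MM f l)) : bet q f k l = star q := by
  unfold bet
  refine bub_not_act hq h ?_ ?_
  · intro e; exact ⟨0, by rw [e]; simp⟩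
  · intro e; exact ⟨k, by rw [e]; simp⟩

lemma bet_degen {V : Type*} {q : ℕ} (hq : 1 ≤ q) (f : V → ℝ) (k : ℤ) (l : List V) (hl : l.length = q + 1) (h1 : MM f l (q+1) = 1)
    {v : V} (hv : v ∈ l) (h : f v = 0) : bet q f k l = star q := by
  apply bet_not_act hq
  intro ha
  obtain ⟨j, hj, rfl⟩ := List.getElem_of_mem hv
  refine ha.strict hq (MM_zero _ _) h1 (i := j) (by omega) ?_
  rw [MM_succ f l hj, h, add_zero]

lemma MM_top {V : Type*} [Fintype V] {f : V → ℝ} (h1 : ∑ v, f v = 1) {l : List V} (hn : l.Nodup) (hs : ∀ v, f v ≠ 0 → v ∈ l) :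
    MM f l l.length = 1 := by
  classical
  unfold MM
  rw [List.take_length, ← List.sum_toFinset f hn, ← h1]
  apply Finset.sum_subset (Finset.subset_univ _)
  intro v _ hv
  by_contra hc
  exact hv (List.mem_toFinset.2 (hs v hc))

/-- data for the gluing theorem -/
structure GT (Z : Type*) [TopologicalSpace Z] (V : Type*) [Fintype V] [LinearOrder V] (q : ℕ) where
  ω : V → Z → ℝ
  H : ℕ → V → ℤ
  d : List V → ℤ
  NN : Finset V → Prop
  hq : 1 ≤ q
  cont : ∀ v, Continuous (ω v)
  nonneg : ∀ v z, 0 ≤ ω v z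
  sum : ∀ z, ∑ v, ω v z = 1
  H01 : ∀ i v, H i v = 0 ∨ H i v = 1
  down : ∀ s t, s ⊆ t → NN t → NN s
  card : ∀ z, (Finset.univ.filter fun v => 0 < ω v z).card ≤ q + 2
  mono : ∀ z i v v', 0 < ω v z → 0 < ω v' z → v ≤ v' → H i v' = 0 → H i v = 0
  ha : ∀ z, (Finset.univ.filter fun v => 0 < ω v z).card = q + 2 → cobd d ((Finset.univ.filter fun v => 0 < ω v z).sort) = 0
  hb : ∀ z, NN (Finset.univ.filter fun v => 0 < ω v z) → (Finset.univ.filter fun v => 0 < ω v z).card = q + 1 →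
    d ((Finset.univ.filter fun v => 0 < ω v z).sort) = Wn q H (fun v => 1 - H q v) ((Finset.univ.filter fun v => 0 < ω v z).sort)
  hc : ∀ z, NN (Finset.univ.filter fun v => 0 < ω v z) → (Finset.univ.filter fun v => 0 < ω v z).card = q + 2 →
    Wn (q+1) H (fun _ => 1) ((Finset.univ.filter fun v => 0 < ω v z).sort) = 0

namespace GT
variable {Z : Type*} [TopologicalSpace Z] {V : Type*} [Fintype V] [LinearOrder V] {q : ℕ} (D : GT Z V q)

noncomputable def supp (z : Z) : Finset V := Finset.univ.filter fun v => 0 < D.ω v z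

noncomputable def ll (z : Z) : List V := (D.supp z).sort

lemma mem_supp {z : Z} {v : V} : v ∈ D.supp z ↔ 0 < D.ω v z := by simp [supp]

lemma mem_ll {z : Z} {v : V} : v ∈ D.ll z ↔ 0 < D.ω v z := by rw [ll, Finset.mem_sort, mem_supp]

lemma len_ll (z : Z) : (D.ll z).length = (D.supp z).card := by rw [ll, Finset.length_sort]

lemma zero_of_not {z : Z} {v : V} (h : v ∉ D.supp z) : D.ω v z = 0 :=
  le_antisymm (not_lt.1 fun hc => h (D.mem_supp.2 hc)) (D.nonneg v z)

lemma top {z : Z} {l : List V} (hn : l.Nodup) (hs : ∀ v ∈ D.supp z, v ∈ l) : MM (fun v => D.ω v z) l l.length = 1 :=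
  MM_top (D.sum z) hn fun v hv => hs v (by by_contra hc; exact hv (D.zero_of_not hc))

/-- `mu i` here is the mass `μ_i`; indices start from one. -/
noncomputable def mu (z : Z) (i : ℕ) : ℝ := ∑ v, if D.H (i-1) v = 0 then D.ω v z else 0

lemma mu_continuous (i : ℕ) : Continuous fun z => D.mu z i := by
  unfold mu
  refine continuous_finset_sum _ fun v _ => ?_
  split_ifs
  · exact D.cont v
  · exact continuous_const

noncomputable def low (z : Z) : Fin (q+1) → ℝ :=
  if (D.supp z).card ≤ q then star q else bet q (fun v => D.ω v z) (D.d (D.ll z)) (D.ll z)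

lemma low_eq {z : Z} {l : List V} (hl : l.Pairwise (· < ·)) (hlen : l.length = q + 1) (hs : ∀ v ∈ D.supp z, v ∈ l) :
    D.low z = bet q (fun v => D.ω v z) (D.d l) l := by
  have hnd : l.Nodup := hl.imp (fun h => h.ne)
  have hsub : D.supp z ⊆ l.toFinset := fun v hv => List.mem_toFinset.2 (hs v hv)
  have hc : l.toFinset.card = q + 1 := by rw [List.toFinset_card_of_nodup hnd, hlen]
  unfold low
  split_ifs with h
  · obtain ⟨v, hv, hv'⟩ := Finset.exists_mem_notMem_of_card_lt_card (s := D.supp z) (t := l.toFinset) (by omega)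
    rw [bet_degen D.hq _ _ l hlen (hlen ▸ D.top hnd hs) (List.mem_toFinset.1 hv) (D.zero_of_not hv')]
  · have he : D.supp z = l.toFinset := Finset.eq_of_subset_of_card_le hsub (by omega)
    have : D.ll z = l := by
      unfold ll; rw [he]
      refine List.Perm.eq_of_pairwise (le := (· ≤ ·)) (fun a b _ _ => le_antisymm) (Finset.pairwise_sort _ _) (hl.imp (fun h => h.le)) ?_
      rw [List.perm_ext_iff_of_nodup (Finset.sort_nodup _ _) hnd]
      simp
    rw [this]

lemma thr (z : Z) (v0 : V) (i : ℕ) : ∃ τ ≤ (D.ll z).length, (∀ j < (D.ll z).length, D.H i ((D.ll z).getD j v0) = 0 ↔ j < τ) ∧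
    D.mu z (i+1) = MM (fun v => D.ω v z) (D.ll z) τ := by
  have hp : (D.ll z).Pairwise (fun a b => D.H i b = 0 → D.H i a = 0) := by
    refine (List.Pairwise.and_mem.1 (Finset.pairwise_sort (D.supp z) (· ≤ ·))).imp ?_
    rintro a b ⟨h1, h2, h3⟩ h4
    exact D.mono z i a b (D.mem_ll.1 h1) (D.mem_ll.1 h2) h3 h4
  obtain ⟨τ, h1, h2, h3⟩ := MeanDimPaper.thr v0 (fun v => D.H i v = 0) (D.ll z) hp
  refine ⟨τ, h1, h2, ?_⟩
  rw [← h3, ← List.sum_toFinset _ (by exact Finset.sort_nodup _ _), mu, Nat.add_sub_cancel]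
  symm
  apply Finset.sum_subset (Finset.subset_univ _)
  intro v _ hv
  have : D.ω v z = 0 := D.zero_of_not (by rw [← Finset.mem_sort (· ≤ ·)]; exact fun h => hv (List.mem_toFinset.2 h))
  simp [this]

/-- strictly increasing masses force a pattern -/
lemma pattern (z : Z) (v0 : V) (r : ℕ) (h0 : 0 < D.mu z 1) (hinc : ∀ i, 1 ≤ i → i < r → D.mu z i < D.mu z (i+1)) (hr : 1 ≤ r) (h1 : D.mu z r < 1) :
    r + 1 ≤ (D.ll z).length ∧ ((D.ll z).length = r + 1 → ∀ i < r, D.mu z (i+1) = MM (fun v => D.ω v z) (D.ll z) (i+1) ∧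
      ∀ j ≤ r, D.H i ((D.ll z).getD j v0) = 0 ↔ j ≤ i) := by
  choose τ hτ1 hτ2 hτ3 using D.thr z v0
  have hnd : (D.ll z).Nodup := Finset.sort_nodup _ _
  have htop : MM (fun v => D.ω v z) (D.ll z) (D.ll z).length = 1 := D.top hnd (fun v hv => D.mem_ll.2 (D.mem_supp.1 hv))
  have hmm := MM_mono (fun v => D.nonneg v z) (D.ll z)
  have a0 : 0 < τ 0 := by
    by_contra hc
    have h2 := hτ3 0
    rw [show τ 0 = 0 by omega, MM_zero, zero_add] at h2
    linarith
  have ainc : ∀ i, i + 1 < r → τ i < τ (i+1) := by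
    intro i hi
    by_contra hc
    have h2 := hinc (i+1) (by omega) hi
    rw [hτ3, hτ3] at h2
    exact absurd (hmm (not_lt.1 hc)) (not_le.2 h2)
  have atop : τ (r-1) < (D.ll z).length := by
    by_contra hc
    have h2 := hτ3 (r-1)
    rw [Nat.sub_add_cancel hr] at h2
    have h3 := hmm (not_lt.1 hc)
    linarith
  have low : ∀ i < r, i + 1 ≤ τ i := by
    intro i
    induction i with
    | zero => intro _; omega
    | succ i ih => intro hi; have := ainc i hi; have := ih (by omega); omega
  have up : ∀ k i, i + k + 1 = r → τ i + k + 1 ≤ (D.ll z).length := by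
    intro k
    induction k with
    | zero => intro i hi; rw [show i = r - 1 by omega]; omega
    | succ k ih => intro i hi; have := ainc i (by omega); have := ih (i+1) (by omega); omega
  refine ⟨by have := low (r-1) (by omega); omega, ?_⟩
  intro hlen i hi
  have e : τ i = i + 1 := by
    have := low i hi
    have := up (r - 1 - i) i (by omega)
    omega
  refine ⟨by rw [hτ3, e], ?_⟩
  intro j hj
  rw [hτ2 i j (by omega), e]; omega

/-- on `NN` the masses cannot be strictly increasing -/
lemma no_full (z : Z) (hz : D.NN (D.supp z)) (h0 : 0 < D.mu z 1) (hinc : ∀ i, 1 ≤ i → i ≤ q → D.mu z i < D.mu z (i+1)) (h1 : D.mu z (q+1) < 1) : False := by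
  have hne : (D.supp z).Nonempty := by
    by_contra hc
    rw [Finset.not_nonempty_iff_eq_empty] at hc
    have := D.sum z
    rw [Finset.sum_eq_zero (fun v _ => D.zero_of_not (by rw [hc]; simp))] at this
    norm_num at this
  obtain ⟨v0, -⟩ := hne
  have hcard : (D.supp z).card ≤ q + 2 := D.card z
  obtain ⟨p1, p2⟩ := D.pattern z v0 (q+1) h0 (fun i a b => hinc i a (by omega)) (by omega) h1
  have hl := D.len_ll z
  have p3 := p2 (by omega)
  have hw := D.hc z hz (by change (D.supp z).card = _; omega)
  change Wn (q+1) D.H (fun _ => 1) (D.ll z) = 0 at hw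
  rw [Wn_eq_prod v0 _ _ _ _ (by omega), mul_one, Finset.prod_eq_zero_iff] at hw
  obtain ⟨i, hi, he⟩ := hw
  rw [Finset.mem_range] at hi
  have q1 := ((p3 i hi).2 i (by omega)).2 le_rfl
  have q2 : D.H i ((D.ll z).getD (i+1) v0) ≠ 0 := fun h => by
    have := ((p3 i hi).2 (i+1) (by omega)).1 h; omega
  rw [q1, sub_zero] at he
  exact q2 he

noncomputable def bb (q i : ℕ) : ℝ := (4 * i - 2) / (4 * ((q:ℝ)+1))

lemma act_facts {q : ℕ} (hq : 1 ≤ q) {M : ℕ → ℝ} (h : Act q M) : 0 < M 1 ∧ (∀ i, 1 ≤ i → i < q → M i < M (i+1)) ∧ M q < bb q (q+1) := by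
  have hp : (0:ℝ) < 4 * ((q:ℝ)+1) := by positivity
  refine ⟨?_, ?_, ?_⟩
  · have := cc_pos (h 1 le_rfl hq).1
    by_contra hc
    have : 4 * ((q:ℝ)+1) * M 1 ≤ 0 := mul_nonpos_of_nonneg_of_nonpos hp.le (not_lt.1 hc)
    push_cast at *; linarith
  · intro i h1 h2
    exact cc_sep (Nat.lt_succ_self i) (h i h1 h2.le).2 (h (i+1) (by omega) h2).1
  · have := cc_lt (h q hq le_rfl).2
    unfold bb
    rw [lt_div_iff₀ hp]
    push_cast; linarith

lemma bb_lt_one (q i : ℕ) (hi : i ≤ q + 1) : bb q i < 1 := by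
  unfold bb
  rw [div_lt_one (by positivity)]
  have : (i:ℝ) ≤ q + 1 := by exact_mod_cast hi
  linarith

lemma bb_pos (q i : ℕ) (hi : 1 ≤ i) : 0 < bb q i := by
  unfold bb
  have : (1:ℝ) ≤ i := by exact_mod_cast hi
  apply div_pos <;> [linarith; positivity]

lemma bb_lt (q i : ℕ) : bb q i < bb q (i+1) := by
  unfold bb
  apply div_lt_div_of_pos_right _ (by positivity)
  push_cast; linarith

noncomputable def Fstd (z : Z) : Fin (q+1) → ℝ :=
  if bb q (q+1) ≤ D.mu z (q+1) then bub q (cc q 1 (D.mu z 1)) (fun i => cc q i (D.mu z i)) else star q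

lemma bub_not_act' {q : ℕ} (hq : 1 ≤ q) {M : ℕ → ℝ} (h : ¬ Act q M) : bub q (cc q 1 (M 1)) (fun i => cc q i (M i)) = star q :=
  bub_not_act hq h (fun e => ⟨0, by rw [e]; simp⟩) (fun e => ⟨1, by rw [e]; simp⟩)

lemma mu_le_one (z : Z) (i : ℕ) : D.mu z i ≤ 1 := by
  rw [← D.sum z]
  unfold mu
  refine Finset.sum_le_sum fun v _ => ?_
  split_ifs
  · exact le_rfl
  · exact D.nonneg v z

lemma Fstd_continuousOn : ContinuousOn D.Fstd {z | D.NN (D.supp z)} := by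
  rw [continuousOn_iff_continuous_restrict]
  unfold Fstd
  refine Continuous.if_le (f := fun _ => bb q (q+1)) (g := fun z : {z | D.NN (D.supp z)} => D.mu z.1 (q+1))
    (f' := fun z => bub q (cc q 1 (D.mu z.1 1)) (fun i => cc q i (D.mu z.1 i))) (g' := fun _ => star q) ?_ continuous_const continuous_const
    ((D.mu_continuous _).comp continuous_subtype_val) ?_
  · exact bub_continuous q (c := fun i (z : {z | D.NN (D.supp z)}) => cc q i (D.mu z.1 i)) ((cc_continuous q 1).comp ((D.mu_continuous _).comp continuous_subtype_val)) 
      (fun i => (cc_continuous q i).comp ((D.mu_continuous _).comp continuous_subtype_val))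
  · rintro ⟨z, hz⟩ he
    by_cases hA : Act q (D.mu z)
    · exfalso
      obtain ⟨h1, h2, h3⟩ := act_facts D.hq hA
      refine D.no_full z hz h1 ?_ ?_
      · intro i a b
        rcases lt_or_eq_of_le b with b | rfl
        · exact h2 i a b
        · exact lt_of_lt_of_le h3 (le_of_eq he)
      · have he' : bb q (q+1) = D.mu z (q+1) := he
        rw [← he']; exact bb_lt_one _ _ le_rfl
    · exact bub_not_act' D.hq hA

lemma Fstd_eq_low (z : Z) (hz : D.NN (D.supp z)) (hc : (D.supp z).card ≤ q + 1) : D.Fstd z = D.low z := by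
  have hne : (D.supp z).Nonempty := by
    by_contra hc
    rw [Finset.not_nonempty_iff_eq_empty] at hc
    have := D.sum z
    rw [Finset.sum_eq_zero (fun v _ => D.zero_of_not (by rw [hc]; simp))] at this
    norm_num at this
  obtain ⟨v0, -⟩ := hne
  have hl := D.len_ll z
  have hq := D.hq
  have key : bb q (q+1) ≤ D.mu z (q+1) → Act q (D.mu z) → (D.ll z).length = q + 1 ∧
      (∀ i < q, D.mu z (i+1) = MM (fun v => D.ω v z) (D.ll z) (i+1)) ∧ Wn q D.H (fun v => 1 - D.H q v) (D.ll z) = 1 := by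
    intro h1 h2
    obtain ⟨a1, a2, a3⟩ := act_facts hq h2
    obtain ⟨p1, p2⟩ := D.pattern z v0 q a1 a2 hq (a3.trans (bb_lt_one _ _ le_rfl))
    have hlen : (D.ll z).length = q + 1 := by omega
    have p3 := p2 hlen
    refine ⟨hlen, fun i hi => (p3 i hi).1, ?_⟩
    rw [Wn_eq_prod v0 _ _ _ _ hlen, Finset.prod_eq_one]
    · -- threshold of the last function
      obtain ⟨τ, t1, t2, t3⟩ := D.thr z v0 q
      have : q < τ := by
        by_contra hcon
        have h5 := MM_mono (fun v => D.nonneg v z) (D.ll z) (not_lt.1 hcon)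
        have h6 := (p3 (q-1) (by omega)).1
        rw [Nat.sub_add_cancel hq] at h6
        linarith
      rw [(t2 q (by omega)).2 this]; norm_num
    · intro i hi
      rw [Finset.mem_range] at hi
      have q1 := ((p3 i hi).2 i (by omega)).2 le_rfl
      have q2 : D.H i ((D.ll z).getD (i+1) v0) ≠ 0 := fun h => by
        have := ((p3 i hi).2 (i+1) (by omega)).1 h; omega
      have q3 := (D.H01 i ((D.ll z).getD (i+1) v0)).resolve_left q2
      rw [q1, q3]; norm_num
  by_cases hact : bb q (q+1) ≤ D.mu z (q+1) ∧ Act q (D.mu z)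
  · obtain ⟨k1, k2, k3⟩ := key hact.1 hact.2
    unfold Fstd low
    rw [if_pos hact.1, if_neg (by omega)]
    have hd := D.hb z hz (by change (D.supp z).card = _; omega)
    change D.d (D.ll z) = Wn q D.H (fun v => 1 - D.H q v) (D.ll z) at hd
    rw [hd, k3]
    unfold bet
    rw [Int.cast_one, one_mul, ← k2 0 (by omega), zero_add]
    have hpsi : psi q (fun i => cc q i (D.mu z i)) = psi q (fun i => cc q i (MM (fun v => D.ω v z) (D.ll z) i)) := by
      unfold psi
      refine Finset.prod_congr rfl fun j hj => ?_
      rw [Finset.mem_Ioc] at hj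
      have := k2 (j-1) (by omega)
      rw [Nat.sub_add_cancel (by omega)] at this
      simp only [this]
    ext i
    unfold bub
    rw [hpsi]
    split_ifs with c1 c2
    · rfl
    · rfl
    · simp only [k2 i (by omega)]
  · have hF : D.Fstd z = star q := by
      unfold Fstd
      split_ifs with h
      · exact bub_not_act' hq (fun h' => hact ⟨h, h'⟩)
      · rfl
    rw [hF]
    unfold low
    split_ifs with hcq
    · rfl
    have hlen : (D.ll z).length = q + 1 := by omega
    by_cases hA : Act q (MM (fun v => D.ω v z) (D.ll z))
    swap
    · exact (bet_not_act hq _ _ _ hA).symm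
    have hd := D.hb z hz (by change (D.supp z).card = _; omega)
    change D.d (D.ll z) = Wn q D.H (fun v => 1 - D.H q v) (D.ll z) at hd
    by_cases hw : Wn q D.H (fun v => 1 - D.H q v) (D.ll z) = 0
    · rw [hd, hw]; unfold bet
      rw [Int.cast_zero, zero_mul]
      have := bub_int hq 0 (fun i => cc q i (MM (fun v => D.ω v z) (D.ll z) i))
      rw [Int.cast_zero] at this
      exact this.symm
    · exfalso
      rw [Wn_eq_prod v0 _ _ _ _ hlen, ← ne_eq, mul_ne_zero_iff, Finset.prod_ne_zero_iff] at hw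
      choose τ t1 t2 t3 using D.thr z v0
      have hmu : ∀ i < q, D.mu z (i+1) = MM (fun v => D.ω v z) (D.ll z) (i+1) := by
        intro i hi
        have h1 := hw.1 i (Finset.mem_range.2 hi)
        have b1 := t2 i i (by omega)
        have b2 := t2 i (i+1) (by omega)
        have : τ i = i + 1 := by
          rcases D.H01 i ((D.ll z).getD i v0) with e | e <;> rcases D.H01 i ((D.ll z).getD (i+1) v0) with e' | e' <;> rw [e, e'] at h1 <;> simp at h1
          · have := b1.1 e
            have : ¬ (i + 1 < τ i) := fun h => by rw [b2.2 h] at e'; norm_num at e'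
            omega
          · have := b2.1 e'
            have := b1.2 (by omega)
            rw [this] at e; norm_num at e
        rw [t3, this]
      refine hact ⟨?_, ?_⟩
      · have h1 := hw.2
        have : D.H q ((D.ll z).getD q v0) = 0 := by
          rcases D.H01 q ((D.ll z).getD q v0) with e | e
          · exact e
          · rw [e] at h1; norm_num at h1
        have h2 := (t2 q q (by omega)).1 this
        have h3 : τ q = (D.ll z).length := by have := t1 q; omega
        rw [t3, h3, D.top (by exact Finset.sort_nodup _ _) (fun v hv => D.mem_ll.2 (D.mem_supp.1 hv))]
        exact (bb_lt_one _ _ le_rfl).le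
      · intro j h1 h2
        have := hmu (j-1) (by omega)
        rw [Nat.sub_add_cancel h1] at this
        rw [this]; exact hA j h1 h2

end GT
end Part9

section Part10
namespace GT
variable {Z : Type*} [TopologicalSpace Z] {V : Type*} [Fintype V] [LinearOrder V] {q : ℕ} (D : GT Z V q)

lemma closed_piece (t : Finset V) : IsClosed {z | D.supp z ⊆ t} := by
  have : {z | D.supp z ⊆ t} = ⋂ v ∈ (Finset.univ \ t), {z | D.ω v z = 0} := by
    ext z
    simp only [mem_setOf_eq, mem_iInter, Finset.mem_sdiff, Finset.mem_univ, true_and]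
    constructor
    · intro h v hv
      exact D.zero_of_not fun hc => hv (h hc)
    · intro h v hv
      by_contra hc
      have := h v hc
      rw [mem_supp, this] at hv; exact lt_irrefl _ hv
  rw [this]
  exact isClosed_biInter fun v _ => isClosed_eq (D.cont v) continuous_const

lemma closed_NN : IsClosed {z | D.NN (D.supp z)} := by
  have : {z | D.NN (D.supp z)} = ⋃ t ∈ {t : Finset V | D.NN t}, {z | D.supp z ⊆ t} := by
    ext z
    simp only [mem_setOf_eq, mem_iUnion, exists_prop]
    exact ⟨fun h => ⟨_, h, subset_rfl⟩, fun ⟨t, h1, h2⟩ => D.down _ _ h2 h1⟩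
  rw [this]
  exact Set.Finite.isClosed_biUnion (Set.toFinite _) fun t _ => D.closed_piece t

lemma local_ext [CompactSpace Z] [T2Space Z] (z0 : Z) : ∃ g : Z → Fin (q+1) → ℝ, Continuous g ∧ (∀ z, g z ≠ 0) ∧
    ∀ z, D.supp z ⊆ D.supp z0 → (D.supp z).card ≤ q + 1 → g z = D.low z := by
  have hq := D.hq
  have hcard : (D.supp z0).card ≤ q + 2 := D.card z0
  have hl := D.len_ll z0
  have hlt : (D.ll z0).Pairwise (· < ·) := by
    have := (Finset.sortedLT_sort (D.supp z0)).pairwise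
    exact this
  have hnd : (D.ll z0).Nodup := Finset.sort_nodup _ _
  rcases Nat.lt_or_ge (D.supp z0).card (q+1) with h | h
  · refine ⟨fun _ => star q, continuous_const, fun _ => star_ne q, ?_⟩
    intro z hz _
    unfold low
    rw [if_pos ((Finset.card_le_card hz).trans (by omega))]
  rcases Nat.lt_or_ge (D.supp z0).card (q+2) with h' | h'
  · refine ⟨fun z => bet q (fun v => D.ω v z) (D.d (D.ll z0)) (D.ll z0), ?_, fun z => bub_ne hq _ _, ?_⟩
    · unfold bet
      have hm := fun j => MM_continuous D.cont (D.ll z0) j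
      exact bub_continuous q (c := fun i z => cc q i (MM (fun v => D.ω v z) (D.ll z0) i)) (continuous_const.mul ((cc_continuous q 1).comp (hm 1)))
        (fun i => (cc_continuous q i).comp (hm i))
    · intro z hz _
      exact (D.low_eq hlt (by omega) (fun v hv => D.mem_ll.2 (D.mem_supp.1 (hz hv)))).symm
  have hlen : (D.ll z0).length = q + 2 := by omega
  let M : ℕ → Z → ℝ := fun j z => if j = q + 2 then 1 else MM (fun v => D.ω v z) (D.ll z0) j
  have hM : ∀ j, Continuous (M j) := by
    intro j
    by_cases hj : j = q + 2
    · have : M j = fun _ => 1 := by funext z; simp [M, hj]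
      rw [this]; exact continuous_const
    · have : M j = fun z => MM (fun v => D.ω v z) (D.ll z0) j := by funext z; simp [M, hj]
      rw [this]; exact MM_continuous D.cont _ _
  have hcob := D.ha z0 (by change (D.supp z0).card = _; omega)
  change cobd D.d (D.ll z0) = 0 at hcob
  rw [cobd_eraseIdx, hlen] at hcob
  have hmono : ∀ y, M 1 y ≤ M 2 y := by
    intro y
    have e1 : M 1 y = MM (fun v => D.ω v y) (D.ll z0) 1 := by simp [M, show (1:ℕ) ≠ q + 2 by omega]
    have e2 : M 2 y = MM (fun v => D.ω v y) (D.ll z0) 2 := by exact if_neg (by omega)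
    rw [e1, e2]
    exact MM_mono (fun v => D.nonneg v y) _ (by norm_num)
  have h0 : ∀ y, M 0 y = 0 := by intro y; simp [M, MM_zero]
  have h1 : ∀ y, M (q+2) y = 1 := by intro y; simp [M]
  obtain ⟨g, g1, g2, g3⟩ := simplex_ext hq M hM hmono h0 h1 (fun j => D.d ((D.ll z0).eraseIdx j)) hcob
  refine ⟨g, g1, g2, ?_⟩
  intro z hz hzc
  have hMz : ∀ j, j ≤ q + 2 → M j z = MM (fun v => D.ω v z) (D.ll z0) j := by
    intro j hj
    by_cases hj' : j = q + 2
    · rw [hj', h1, ← hlen, D.top hnd fun v hv => D.mem_ll.2 (D.mem_supp.1 (hz hv))]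
    · simp [M, hj']
  obtain ⟨v, hv, hv'⟩ := Finset.exists_mem_notMem_of_card_lt_card (s := D.supp z) (t := D.supp z0) (by omega)
  have hvl : v ∈ D.ll z0 := D.mem_ll.2 (D.mem_supp.1 hv)
  obtain ⟨j, hj, rfl⟩ := List.getElem_of_mem hvl
  have hω : D.ω (D.ll z0)[j] z = 0 := D.zero_of_not hv'
  have hstep : M j z = M (j+1) z := by
    rw [hMz j (by omega), hMz (j+1) (by omega), MM_succ _ _ hj, hω, add_zero]
  rw [g3 z j (by omega) hstep]
  have hsub : ∀ w ∈ D.supp z, w ∈ (D.ll z0).eraseIdx j := by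
    intro w hw
    have hwl : w ∈ D.ll z0 := D.mem_ll.2 (D.mem_supp.1 (hz hw))
    obtain ⟨k, hk, rfl⟩ := List.getElem_of_mem hwl
    rw [List.mem_eraseIdx_iff_getElem]
    refine ⟨k, hk, ?_, rfl⟩
    rintro rfl
    exact hv' hw
  rw [D.low_eq (l := (D.ll z0).eraseIdx j) (hlt.sublist (List.eraseIdx_sublist _ _)) (by rw [List.length_eraseIdx]; simp [hj]; omega) hsub]
  unfold bet
  have hM' : ∀ i, 1 ≤ i → i ≤ q → tau j (fun i => M i z) i = MM (fun v => D.ω v z) ((D.ll z0).eraseIdx j) i := by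
    intro i hi1 hi
    rw [MM_eraseIdx _ _ _ _ hj hω]
    unfold tau
    simp only [hMz i (by omega), hMz (i+1) (by omega)]
  have hpsi : psi q (fun i => cc q i (tau j (fun i => M i z) i)) = psi q (fun i => cc q i (MM (fun v => D.ω v z) ((D.ll z0).eraseIdx j) i)) := by
    unfold psi
    refine Finset.prod_congr rfl fun k hk => ?_
    rw [Finset.mem_Ioc] at hk
    simp only [hM' k (by omega) (by omega)]
  ext i
  unfold bub
  rw [hpsi, hM' 1 le_rfl hq]
  split_ifs with c1 c2
  · rfl
  · rfl
  · simp only [hM' (i+1) (by omega) (by omega)]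

theorem glue [CompactSpace Z] [T2Space Z] : ∃ G : Z → Fin (q+1) → ℝ, Continuous G ∧ (∀ z, G z ≠ 0) ∧ ∀ z, D.NN (D.supp z) → G z = D.Fstd z := by
  classical
  choose g g1 g2 g3 using D.local_ext
  -- make the choice depend on the support only
  have hch : ∃ e : Finset V → (Z → Fin (q+1) → ℝ), ∀ t, (∃ z0, D.supp z0 = t) → Continuous (e t) ∧ (∀ z, e t z ≠ 0) ∧
      ∀ z, D.supp z ⊆ t → (D.supp z).card ≤ q + 1 → e t z = D.low z := by
    refine ⟨fun t => if h : ∃ z0, D.supp z0 = t then g h.choose else fun _ => 0, ?_⟩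
    intro t ht
    simp only [dif_pos ht]
    have h2 := ht.choose_spec
    refine ⟨g1 _, g2 _, fun z hz => g3 _ z (by rw [h2]; exact hz)⟩
  obtain ⟨e, he⟩ := hch
  let G : Z → Fin (q+1) → ℝ := fun z => if D.NN (D.supp z) then D.Fstd z else e (D.supp z) z
  have hGN : ∀ z, D.NN (D.supp z) → G z = D.Fstd z := fun z hz => if_pos hz
  refine ⟨G, ?_, ?_, hGN⟩
  · let S : Option (Finset V) → Set Z := fun o => match o with
      | none => {z | D.NN (D.supp z)}
      | some t => {z | D.supp z ⊆ t ∧ (∃ z0, D.supp z0 = t) ∧ ¬ D.NN t}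
    refine LocallyFinite.continuous (f := S) (locallyFinite_of_finite _) ?_ ?_ ?_
    · ext z
      simp only [mem_iUnion, mem_univ, iff_true]
      by_cases h : D.NN (D.supp z)
      · exact ⟨none, h⟩
      · exact ⟨some (D.supp z), subset_rfl, ⟨z, rfl⟩, h⟩
    · rintro (_ | t)
      · exact D.closed_NN
      · by_cases h : (∃ z0, D.supp z0 = t) ∧ ¬ D.NN t
        · have : S (some t) = {z | D.supp z ⊆ t} := by ext z; exact ⟨fun hz => hz.1, fun hz => ⟨hz, h⟩⟩
          rw [this]; exact D.closed_piece t
        · have : S (some t) = ∅ := by ext z; exact ⟨fun hz => h hz.2, fun hz => hz.elim⟩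
          rw [this]; exact isClosed_empty
    · rintro (_ | t)
      · exact D.Fstd_continuousOn.congr hGN
      · by_cases h : (∃ z0, D.supp z0 = t) ∧ ¬ D.NN t
        · refine (he t h.1).1.continuousOn.congr ?_
          rintro z ⟨hz, -, -⟩
          by_cases hzt : D.supp z = t
          · simp only [G]
            rw [if_neg (by rw [hzt]; exact h.2), hzt]
          · have hlt := Finset.card_lt_card (Finset.ssubset_iff_subset_ne.2 ⟨hz, hzt⟩)
            obtain ⟨z0, hz0⟩ := h.1
            have hc : (D.supp z0).card ≤ q + 2 := D.card z0
            rw [hz0] at hc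
            have hzc : (D.supp z).card ≤ q + 1 := by omega
            rw [(he t h.1).2.2 z hz hzc]
            simp only [G]
            split_ifs with hN
            · exact D.Fstd_eq_low z hN hzc
            · exact (he _ ⟨z, rfl⟩).2.2 z subset_rfl hzc
        · have : S (some t) = ∅ := by ext z; exact ⟨fun hz => h hz.2, fun hz => hz.elim⟩
          rw [this]; exact continuousOn_empty _
  · intro z
    simp only [G]
    split_ifs with h
    · unfold Fstd
      split_ifs
      · exact bub_ne D.hq _ _
      · exact star_ne q
    · exact (he _ ⟨z, rfl⟩).2.1 z

lemma bb_cc (q i : ℕ) : cc q i (bb q i) = 1/2 := by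
  unfold cc bb
  have : (4 * ((q:ℝ)+1)) ≠ 0 := by positivity
  rw [mul_div_cancel₀ _ this]
  rw [clip_mid] <;> linarith

lemma cc_sign_pos {q i : ℕ} {x : ℝ} (h : bb q i < x) : 1/2 < cc q i x := by
  unfold bb at h
  rw [div_lt_iff₀ (by positivity)] at h
  unfold cc clip
  refine lt_max_of_lt_right (lt_min (by norm_num) ?_)
  linarith

lemma cc_sign_neg {q i : ℕ} {x : ℝ} (h : x < bb q i) : cc q i x < 1/2 := by
  unfold bb at h
  rw [lt_div_iff₀ (by positivity)] at h
  unfold cc clip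
  refine max_lt (by norm_num) (min_lt_of_right_lt ?_)
  linarith

/-- the target map -/
noncomputable def Ft (z : Z) : Fin (q+1) → ℝ := fun i => D.mu z (i.val+1) - bb q (i.val+1)

lemma Ft_ne (z : Z) (hz : D.NN (D.supp z)) : D.Ft z ≠ 0 := by
  intro h
  have h1 : ∀ i, i ≤ q → D.mu z (i+1) = bb q (i+1) := by
    intro i hi
    have := congrFun h ⟨i, by omega⟩
    simp only [Ft, Pi.zero_apply] at this
    linarith
  refine D.no_full z hz ?_ ?_ ?_
  · rw [h1 0 (by omega)]; exact bb_pos _ _ le_rfl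
  · intro i a b
    have := h1 (i-1) (by omega)
    rw [Nat.sub_add_cancel a] at this
    rw [this, h1 i b]; exact bb_lt _ _
  · rw [h1 q le_rfl]; exact bb_lt_one _ _ le_rfl

lemma psi_nonneg (q : ℕ) (c : ℕ → ℝ) (h0 : ∀ i, 0 ≤ c i) (h1 : ∀ i, c i ≤ 1) : 0 ≤ psi q c := by
  unfold psi
  refine Finset.prod_nonneg fun j _ => ?_
  have : |2 * c j - 1| ≤ 1 := by rw [abs_le]; constructor <;> linarith [h0 j, h1 j]
  linarith

lemma homotopy_ne (z : Z) (hz : D.NN (D.supp z)) (s : ℝ) (hs0 : 0 ≤ s) (hs1 : s ≤ 1) :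
    (fun i => (1 - s) * D.Fstd z i + s * D.Ft z i) ≠ 0 := by
  have hq := D.hq
  rcases eq_or_lt_of_le hs1 with rfl | hs1
  · have := D.Ft_ne z hz
    intro h; apply this; rw [← h]; funext i; ring
  rcases eq_or_lt_of_le hs0 with rfl | hs0
  · intro h
    have : D.Fstd z ≠ 0 := by
      unfold Fstd
      split_ifs
      · exact bub_ne hq _ _
      · exact star_ne q
    apply this; rw [← h]; funext i; ring
  intro h
  have hcoord : ∀ i : Fin (q+1), (1 - s) * D.Fstd z i + s * D.Ft z i = 0 := fun i => congrFun h i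
  have h1s : 0 < 1 - s := by linarith
  have hlast := hcoord ⟨q, by omega⟩
  have hFl : D.Ft z ⟨q, by omega⟩ = D.mu z (q+1) - bb q (q+1) := rfl
  rw [hFl] at hlast
  by_cases hb : bb q (q+1) ≤ D.mu z (q+1)
  swap
  · have : D.Fstd z ⟨q, by omega⟩ = -1 := by unfold Fstd star; rw [if_neg hb]; simp
    rw [this] at hlast
    have := mul_pos hs0 (sub_pos.2 (not_le.1 hb))
    nlinarith
  have hF : D.Fstd z = bub q (cc q 1 (D.mu z 1)) (fun i => cc q i (D.mu z i)) := if_pos hb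
  rw [hF] at hcoord hlast
  set P := psi q (fun i => cc q i (D.mu z i)) with hP
  have hP0 : 0 ≤ P := psi_nonneg _ _ (fun i => clip_nonneg _) (fun i => clip_le _)
  set r := cc q 1 (D.mu z 1) with hr
  have hr0 : 0 ≤ r := clip_nonneg _
  have hr1 : r ≤ 1 := clip_le _
  have hcos : 0 ≤ 1 - Real.cos (2 * Real.pi * r) := by linarith [Real.cos_le_one (2 * Real.pi * r)]
  have hmu : ∀ i, i < q → D.mu z (i+1) = bb q (i+1) := by
    intro i hi
    have hc := hcoord ⟨i, by omega⟩
    simp only [bub, Ft] at hc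
    by_contra hne
    by_cases hi0 : i = 0
    · subst hi0
      rw [if_pos rfl] at hc
      rcases lt_or_gt_of_ne hne with hlt | hgt
      · have hx := cc_sign_neg hlt
        have hsin : 0 ≤ Real.sin (2 * Real.pi * r) := by
          apply Real.sin_nonneg_of_nonneg_of_le_pi
          · have := Real.pi_pos; positivity
          · have := Real.pi_pos; rw [zero_add, ← hr] at hx; nlinarith
        have a1 := mul_nonneg h1s.le (mul_nonneg hsin hP0)
        have a2 := mul_pos hs0 (sub_pos.2 hlt)
        nlinarith
      · have hx := cc_sign_pos hgt
        have hsin : Real.sin (2 * Real.pi * r) ≤ 0 := by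
          rw [show 2 * Real.pi * r = -(2 * Real.pi * (1 - r)) + 2 * Real.pi by ring, Real.sin_add_two_pi, Real.sin_neg]
          rw [neg_nonpos]
          apply Real.sin_nonneg_of_nonneg_of_le_pi
          · have := Real.pi_pos; have : 0 ≤ 1 - r := by linarith
            positivity
          · have := Real.pi_pos; rw [zero_add, ← hr] at hx; nlinarith
        have a1 := mul_nonneg h1s.le (mul_nonneg (neg_nonneg.2 hsin) hP0)
        have a2 := mul_pos hs0 (sub_pos.2 hgt)
        nlinarith
    · rw [if_neg hi0, if_neg (by omega)] at hc
      have hPc := mul_nonneg h1s.le (mul_nonneg hP0 hcos)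
      rcases lt_or_gt_of_ne hne with hlt | hgt
      · have hx := cc_sign_neg hlt
        have a1 := mul_nonneg hPc (sub_nonneg.2 hx.le)
        have a2 := mul_pos hs0 (sub_pos.2 hlt)
        nlinarith
      · have hx := cc_sign_pos hgt
        have a1 := mul_nonneg hPc (sub_nonneg.2 hx.le)
        have a2 := mul_pos hs0 (sub_pos.2 hgt)
        nlinarith
  have hP1 : P = 1 := by
    rw [hP]; unfold psi
    refine Finset.prod_eq_one fun j hj => ?_
    rw [Finset.mem_Ioc] at hj
    have := hmu (j-1) (by omega)
    rw [Nat.sub_add_cancel (by omega)] at this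
    simp only [this, bb_cc]; norm_num
  have hr2 : r = 1/2 := by rw [hr]; have := hmu 0 (by omega); rw [zero_add] at this; rw [this, bb_cc]
  simp only [bub] at hlast
  rw [if_neg (by omega), if_true, ← hP, hP1, hr2, show 2 * Real.pi * (1/2) = Real.pi by ring, Real.cos_pi] at hlast
  nlinarith

theorem main [CompactSpace Z] [T2Space Z] : ∃ G : Z → Fin (q+1) → ℝ, Continuous G ∧ (∀ z, G z ≠ 0) ∧
    ∀ z, D.NN (D.supp z) → G z = D.Ft z := by
  obtain ⟨G, g1, g2, g3⟩ := D.glue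
  have hFt : Continuous D.Ft := continuous_pi fun i => (D.mu_continuous _).sub continuous_const
  obtain ⟨G', h1, h2, h3⟩ := hep {z | D.NN (D.supp z)} D.closed_NN G g1 g2
    (fun z s i => (1 - s) * G z i + s * D.Ft z i) (Continuous.continuousOn (by
      refine continuous_pi fun i => ?_
      have a := (continuous_apply i).comp (g1.comp (continuous_fst (X := Z) (Y := ℝ)))
      have b := (continuous_apply i).comp (hFt.comp (continuous_fst (X := Z) (Y := ℝ)))
      have e := continuous_snd (X := Z) (Y := ℝ)
      exact ((continuous_const.sub e).mul a).add (e.mul b)))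
    (fun z hz s hs => by
      have := D.homotopy_ne z hz s hs.1 hs.2
      rw [← g3 z hz] at this; exact this)
    (fun z _ => by funext i; ring)
  refine ⟨G', h1, h2, fun z hz => ?_⟩
  rw [h3 z hz]; funext i; ring

end GT
end Part10

section Part11
/-- closed thickening -/
def Th {K : Type*} [MetricSpace K] (A : Set K) (r : ℝ) : Set K := {x | ∃ a ∈ A, dist x a ≤ r}

lemma Th_mono {K : Type*} [MetricSpace K] (A : Set K) {r s : ℝ} (h : r ≤ s) : Th A r ⊆ Th A s :=
  fun _ ⟨a, ha, hd⟩ => ⟨a, ha, hd.trans h⟩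

lemma Th_near {K : Type*} [MetricSpace K] (A : Set K) {r s η : ℝ} (h : r + η ≤ s) {x y : K} (hy : y ∈ Th A r) (hd : dist x y ≤ η) : x ∈ Th A s := by
  obtain ⟨a, ha, h1⟩ := hy
  exact ⟨a, ha, (dist_triangle x y a).trans (by linarith)⟩

section
variable {K : Type*} [MetricSpace K]

lemma div_step {n p : ℕ} (hpp : p.Prime) (hp : Vanish (ZMod p) K n) (A : Set K) (c : List K → ℤ) {δ r R : ℝ} (hδ : 0 < δ) (hr : r < R)
    (hcoc : ∀ l : List K, l.length = n + 2 → Sm δ l → cobd c l = 0)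
    (hvan : ∀ l : List K, l.length = n + 1 → Sm δ l → (∀ x ∈ l, x ∈ Th A R) → c l = 0) :
    ∃ δ' > 0, ∃ e b : List K → ℤ, (∀ l : List K, l.length = n + 1 → Sm δ' l → c l = p * e l + cobd b l) ∧
      (∀ l : List K, l.length = n + 2 → Sm δ' l → cobd e l = 0) ∧
      (∀ l : List K, l.length = n + 1 → Sm δ' l → (∀ x ∈ l, x ∈ Th A r) → e l = 0) ∧
      (∀ l : List K, l.length = n → Sm δ' l → (∀ x ∈ l, x ∈ Th A r) → b l = 0) := by
  haveI : NeZero p := ⟨hpp.ne_zero⟩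
  have hp0 : (p:ℤ) ≠ 0 := by exact_mod_cast hpp.ne_zero
  obtain ⟨δ1, hδ1, b0, hb1, hb2⟩ := hp (Th A r) (fun l => ((c l : ℤ) : ZMod p)) δ (R - r) hδ (by linarith)
    (by
      intro l h1 h2
      have := cobd_ringHom (Int.castRingHom (ZMod p)) c l
      simp only [eq_intCast] at this
      rw [this, hcoc l h1 h2]; simp)
    (by
      intro l h1 h2 h3
      rw [hvan l h1 h2]
      · simp
      · intro x hx
        obtain ⟨a, ha, hd⟩ := h3 x hx
        exact Th_near A (by linarith) ha hd.le)
  let b : List K → ℤ := fun l => ((b0 l).val : ℤ)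
  have hbb : ∀ l, ((b l : ℤ) : ZMod p) = b0 l := by intro l; simp [b]
  have hdvd : ∀ l : List K, l.length = n + 1 → Sm δ1 l → (p:ℤ) ∣ c l - cobd b l := by
    intro l h1 h2
    rw [← ZMod.intCast_zmod_eq_zero_iff_dvd]
    push_cast
    have h3 := hb1 l h1 h2
    have := cobd_ringHom (Int.castRingHom (ZMod p)) b l
    simp only [eq_intCast, hbb] at this
    rw [h3, ← this]; exact sub_self _
  have hbz : ∀ l : List K, l.length = n → Sm δ1 l → (∀ x ∈ l, x ∈ Th A r) → b l = 0 := by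
    intro l h1 h2 h3
    simp only [b, hb2 l h1 h2 h3, ZMod.val_zero, Nat.cast_zero]
  let e : List K → ℤ := fun l => (c l - cobd b l) / p
  have he : ∀ l : List K, l.length = n + 1 → Sm δ1 l → p * e l = c l - cobd b l := fun l h1 h2 =>
    Int.mul_ediv_cancel' (hdvd l h1 h2)
  refine ⟨min δ δ1, lt_min hδ hδ1, e, b, ?_, ?_, ?_, ?_⟩
  · intro l h1 h2
    rw [he l h1 (h2.mono (min_le_right _ _))]; ring
  · intro l h1 h2
    have h3 : (p:ℤ) * cobd e l = 0 := by
      rw [← cobd_smul', cobd_congr (c' := c - cobd b), cobd_sub, cobd_cobd, hcoc l h1 (h2.mono (min_le_left _ _)), sub_zero]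
      intro l' h4 h5
      exact he l' (by omega) ((h2.of_subset fun x hx => h4.subset hx).mono (min_le_right _ _))
    exact (mul_eq_zero.1 h3).resolve_left hp0
  · intro l h1 h2 h3
    have h4 := he l h1 (h2.mono (min_le_right _ _))
    rw [hvan l h1 (h2.mono (min_le_left _ _)) (fun x hx => Th_mono A hr.le (h3 x hx)), cobd_zero', sub_zero] at h4
    · exact (mul_eq_zero.1 h4).resolve_left hp0
    · intro l' h5 h6
      exact hbz l' (by omega) ((h2.of_subset fun x hx => h5.subset hx).mono (min_le_right _ _)) (fun x hx => h3 x (h5.subset hx))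
  · intro l h1 h2 h3
    exact hbz l h1 (h2.mono (min_le_right _ _)) h3

lemma div_all {n : ℕ} (hp : ∀ p : ℕ, p.Prime → Vanish (ZMod p) K n) (A : Set K) (k : ℕ) (hk : k ≠ 0) : ∀ (c : List K → ℤ) {δ r R : ℝ} (hδ : 0 < δ) (hr : r < R)
    (hcoc : ∀ l : List K, l.length = n + 2 → Sm δ l → cobd c l = 0)
    (hvan : ∀ l : List K, l.length = n + 1 → Sm δ l → (∀ x ∈ l, x ∈ Th A R) → c l = 0),
    ∃ δ' > 0, ∃ e b : List K → ℤ, (∀ l : List K, l.length = n + 1 → Sm δ' l → c l = k * e l + cobd b l) ∧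
      (∀ l : List K, l.length = n + 2 → Sm δ' l → cobd e l = 0) ∧
      (∀ l : List K, l.length = n + 1 → Sm δ' l → (∀ x ∈ l, x ∈ Th A r) → e l = 0) ∧
      (∀ l : List K, l.length = n → Sm δ' l → (∀ x ∈ l, x ∈ Th A r) → b l = 0) := by
  induction k using induction_on_primes with
  | zero => exact absurd rfl hk
  | one =>
    intro c δ r R hδ hr hcoc hvan
    refine ⟨δ, hδ, c, 0, ?_, hcoc, fun l h1 h2 h3 => hvan l h1 h2 fun x hx => Th_mono A hr.le (h3 x hx), fun _ _ _ _ => rfl⟩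
    intro l _ _; simp
  | prime_mul p k hpp ih =>
    intro c δ r R hδ hr hcoc hvan
    obtain ⟨δ1, d1, e1, b1, h1, h2, h3, h4⟩ := ih (fun h => hk (by rw [h, mul_zero])) c (r := (r + R)/2) (R := R) hδ (by linarith) hcoc hvan
    obtain ⟨δ2, d2, e2, b2, g1, g2, g3, g4⟩ := div_step hpp (hp p hpp) A e1 (r := r) (R := (r+R)/2) d1 (by linarith) h2 h3
    refine ⟨min δ1 δ2, lt_min d1 d2, e2, (fun l => (k:ℤ) * b2 l) + b1, ?_, ?_, ?_, ?_⟩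
    · intro l q1 q2
      rw [cobd_add, cobd_smul', h1 l q1 (q2.mono (min_le_left _ _)), g1 l q1 (q2.mono (min_le_right _ _))]
      push_cast; ring
    · intro l q1 q2
      exact g2 l q1 (q2.mono (min_le_right _ _))
    · intro l q1 q2
      exact g3 l q1 (q2.mono (min_le_right _ _))
    · intro l q1 q2 q3
      rw [Pi.add_apply, g4 l q1 (q2.mono (min_le_right _ _)) q3, h4 l q1 (q2.mono (min_le_left _ _)) (fun x hx => Th_mono A (by linarith) (q3 x hx))]
      simp

lemma exists_net [CompactSpace K] {s : ℝ} (hs : 0 < s) : ∃ (t : Set K) (ρ : K → K), t.Finite ∧ (∀ x, ρ x ∈ t) ∧ ∀ x, dist x (ρ x) < s := by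
  obtain ⟨t, -, ht, hc⟩ := finite_cover_balls_of_compact (X := K) isCompact_univ hs
  have : ∀ x : K, ∃ y ∈ t, dist x y < s := by
    intro x
    have := hc (mem_univ x)
    simpa using this
  choose ρ h1 h2 using this
  exact ⟨t, ρ, ht, h1, h2⟩

lemma exists_denom {n : ℕ} {t : Set K} (ht : t.Finite) (b : List K → ℚ) : ∃ k : ℕ, k ≠ 0 ∧ ∃ b1 : List K → ℤ,
    (∀ l : List K, l.length = n → (∀ x ∈ l, x ∈ t) → (b1 l : ℚ) = k * b l) ∧ ∀ l, b l = 0 → b1 l = 0 := by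
  haveI : Finite t := ht
  have hf : {l : List t | l.length = n}.Finite := List.finite_length_eq t n
  refine ⟨∏ l ∈ hf.toFinset, (b (l.map Subtype.val)).den, ?_, fun l => ((∏ l ∈ hf.toFinset, (b (l.map Subtype.val)).den : ℕ) * b l).num, ?_, ?_⟩
  · rw [Finset.prod_ne_zero_iff]
    exact fun l _ => (b _).den_ne_zero
  · intro l h1 h2
    lift l to List t using h2
    have hd := Finset.dvd_prod_of_mem (fun l : List t => (b (l.map Subtype.val)).den) (hf.mem_toFinset.2 (show l.length = n by simpa using h1))
    obtain ⟨m, hm⟩ := hd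
    rw [hm]
    have h3 : ((((b (l.map Subtype.val)).den * m : ℕ) : ℚ)) * b (l.map Subtype.val) = ((m * (b (l.map Subtype.val)).num : ℤ) : ℚ) := by
      push_cast
      have := Rat.den_mul_eq_num (b (l.map Subtype.val))
      rw [mul_right_comm, this]; ring
    beta_reduce
    rw [h3, Rat.num_intCast]
  · intro l hl
    simp [hl]

lemma torsion [CompactSpace K] {n : ℕ} (hQ : Vanish ℚ K n) (A : Set K) (c : List K → ℤ) {δ r R : ℝ} (hδ : 0 < δ) (hr : r < R)
    (hcoc : ∀ l : List K, l.length = n + 2 → Sm δ l → cobd c l = 0)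
    (hvan : ∀ l : List K, l.length = n + 1 → Sm δ l → (∀ x ∈ l, x ∈ Th A R) → c l = 0) :
    ∃ k : ℕ, k ≠ 0 ∧ ∃ δ' > 0, ∃ b : List K → ℤ, (∀ l : List K, l.length = n + 1 → Sm δ' l → k * c l = cobd b l) ∧
      (∀ l : List K, l.length = n → Sm δ' l → (∀ x ∈ l, x ∈ Th A r) → b l = 0) := by
  obtain ⟨δ1, hδ1, b0, hb1, hb2⟩ := hQ (Th A ((r+R)/2)) (fun l => ((c l : ℤ) : ℚ)) δ ((R - r)/2) hδ (by linarith)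
    (by
      intro l h1 h2
      have := cobd_ringHom (Int.castRingHom ℚ) c l
      simp only [eq_intCast] at this
      rw [this, hcoc l h1 h2]; simp)
    (by
      intro l h1 h2 h3
      rw [hvan l h1 h2]
      · simp
      · intro x hx
        obtain ⟨a, ha, hd⟩ := h3 x hx
        exact Th_near A (by linarith) ha hd.le)
  set s := min (min δ δ1) (R - r) / 4 with hs
  have hs0 : 0 < s := by rw [hs]; have := lt_min (lt_min hδ hδ1) (show 0 < R - r by linarith); linarith
  have hsδ : 4 * s ≤ δ := by rw [hs]; linarith [min_le_left (min δ δ1) (R - r), min_le_left δ δ1]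
  have hsδ1 : 4 * s ≤ δ1 := by rw [hs]; linarith [min_le_left (min δ δ1) (R - r), min_le_right δ δ1]
  have hsR : 4 * s ≤ R - r := by rw [hs]; linarith [min_le_right (min δ δ1) (R - r)]
  obtain ⟨t, ρ, ht, hρt, hρ⟩ := exists_net (K := K) hs0
  obtain ⟨k, hk, b1, hk1, hk2⟩ := exists_denom (n := n) ht b0
  have hmapSm : ∀ l : List K, Sm s l → Sm (4*s) (l.map ρ) := by
    intro l hl x hx y hy
    obtain ⟨x', hx', rfl⟩ := List.mem_map.1 hx
    obtain ⟨y', hy', rfl⟩ := List.mem_map.1 hy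
    have := hl x' hx' y' hy'
    have h1 := hρ x'
    have h2 := hρ y'
    have h3 := dist_triangle (ρ x') x' (ρ y')
    have h4 := dist_triangle x' y' (ρ y')
    rw [dist_comm (ρ x') x'] at h3
    linarith
  let T : (List K → ℤ) → List K → ℤ := fun c l => c (l.map ρ)
  have hHop : ∀ (c' : List K → ℤ) (l : List K), (∀ l' : List K, l'.length = l.length + 1 → (∀ y ∈ l', y ∈ l ∨ ∃ x ∈ l, y = ρ x) → c' l' = 0) → Hop T c' l = 0 := by
    intro c' l h
    rw [Hop_congr T c' 0 {y | y ∈ l ∨ ∃ x ∈ l, y = ρ x} l (fun x hx => Or.inl hx) _ h]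
    · have := Hop_sub T (fun _ _ _ => rfl) (0 : List K → ℤ) 0 l
      simpa using this
    · intro c c' τ hτ hcc
      refine hcc _ (by simp) ?_
      intro y hy
      obtain ⟨x, hx, rfl⟩ := List.mem_map.1 hy
      exact Or.inr ⟨x, hτ x hx, rfl⟩
  have hSmU : ∀ l l' : List K, Sm s l → (∀ y ∈ l', y ∈ l ∨ ∃ x ∈ l, y = ρ x) → Sm (4*s) l' := by
    intro l l' hl hl' 
    have : ∀ y ∈ l', ∃ x ∈ l, dist x y < s := by
      intro y hy
      rcases hl' y hy with h | ⟨x, hx, rfl⟩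
      · exact ⟨y, h, by rw [dist_self]; exact hs0⟩
      · exact ⟨x, hx, hρ x⟩
    intro x hx y hy
    obtain ⟨x', hx', h1⟩ := this x hx
    obtain ⟨y', hy', h2⟩ := this y hy
    have h5 := hl x' hx' y' hy'
    have h3 := dist_triangle x x' y
    have h4 := dist_triangle x' y' y
    rw [dist_comm x x'] at h3
    linarith
  refine ⟨k, hk, s, hs0, (fun l => b1 (l.map ρ)) + fun l => (k:ℤ) * Hop T c l, ?_, ?_⟩
  · intro l h1 h2
    have hid := Hop_identity T (fun _ _ _ => rfl) (fun c l => (cobd_map ρ c l).symm) (fun _ => rfl) c l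
    have hz : Hop T (cobd c) l = 0 := by
      apply hHop
      intro l' h3 h4
      exact hcoc l' (by omega) ((hSmU l l' h2 h4).mono hsδ)
    rw [cobd_add, cobd_map, cobd_smul']
    have hcm : (k:ℤ) * c (l.map ρ) = cobd b1 (l.map ρ) := by
      have h3 := hb1 (l.map ρ) (by simpa using h1) ((hmapSm l h2).mono hsδ1)
      have h4 : (((k:ℤ) * c (l.map ρ) : ℤ) : ℚ) = ((cobd b1 (l.map ρ) : ℤ) : ℚ) := by
        push_cast
        rw [h3, ← cobd_smul', ← eq_intCast (Int.castRingHom ℚ), ← cobd_ringHom]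
        apply cobd_congr
        intro l' h5 h6
        rw [eq_intCast, hk1 l' (by simp at h6; omega)]
        intro x hx
        obtain ⟨y, _, rfl⟩ := List.mem_map.1 (h5.subset hx)
        exact hρt y
      exact_mod_cast h4
    rw [← hcm]
    rw [hz] at hid
    have hT : T c l = c (l.map ρ) := rfl
    rw [hT] at hid
    linear_combination (k:ℤ) * hid
  · intro l h1 h2 h3
    have e1 : b1 (l.map ρ) = 0 := by
      apply hk2
      refine hb2 _ (by simpa using h1) ((hmapSm l h2).mono hsδ1) ?_
      intro x hx
      obtain ⟨y, hy, rfl⟩ := List.mem_map.1 hx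
      exact Th_near A (η := s) (by linarith) (h3 y hy) (by rw [dist_comm]; exact (hρ y).le)
    have e2 : Hop T c l = 0 := by
      apply hHop
      intro l' h4 h5
      refine hvan l' (by omega) ((hSmU l l' h2 h5).mono hsδ) ?_
      intro y hy
      rcases h5 y hy with h | ⟨x, hx, rfl⟩
      · exact Th_mono A hr.le (h3 y h)
      · exact Th_near A (η := s) (by linarith) (h3 x hx) (by rw [dist_comm]; exact (hρ x).le)
    simp [e1, e2]

theorem prod_cobound [CompactSpace K] {n : ℕ} (hn : 1 ≤ n) (hp : ∀ p : ℕ, p.Prime → Vanish (ZMod p) K n) (hQ : Vanish ℚ K n) (A : Set K)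
    (c : List K → ℤ) {δ r R : ℝ} (hδ : 0 < δ) (hr : r < R)
    (hcoc : ∀ l : List K, l.length = n + 2 → Sm δ l → cobd c l = 0)
    (hvan : ∀ l : List K, l.length = n + 1 → Sm δ l → (∀ x ∈ l, x ∈ Th A R) → c l = 0) :
    ∃ δ' > 0, ∃ B : List (K × K) → ℤ,
      (∀ l : List (K × K), l.length = 2 * n + 1 → Sm δ' (l.map Prod.fst) → Sm δ' (l.map Prod.snd) → cross Prod.fst Prod.snd n c c l = cobd B l) ∧
      (∀ l : List (K × K), l.length = 2 * n → Sm δ' (l.map Prod.fst) → Sm δ' (l.map Prod.snd) →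
        ((∀ x ∈ l, x.1 ∈ Th A r) ∨ (∀ x ∈ l, x.2 ∈ Th A r)) → B l = 0) := by
  obtain ⟨k, hk, δ1, hδ1, b, t1, t2⟩ := torsion hQ A c hδ hr hcoc hvan
  obtain ⟨δ2, hδ2, e, b', d1, d2, d3, d4⟩ := div_all hp A k hk c hδ hr hcoc hvan
  have zl : ∀ (m : ℕ) (κ : List K → ℤ) (l : List (K × K)), cross Prod.fst Prod.snd m 0 κ l = 0 := by
    intro m κ l
    have := cross_sub_left (R := ℤ) (Prod.fst : K × K → K) (Prod.snd : K × K → K) m 0 0 κ l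
    simpa using this
  have zr : ∀ (m : ℕ) (κ : List K → ℤ) (l : List (K × K)), cross Prod.fst Prod.snd m κ 0 l = 0 := by
    intro m κ l
    have := cross_mul_right (R := ℤ) (Prod.fst : K × K → K) (Prod.snd : K × K → K) m 0 κ 0 l
    simp only [zero_mul] at this
    exact this
  refine ⟨min δ (min δ1 δ2), lt_min hδ (lt_min hδ1 hδ2), cross Prod.fst Prod.snd (n-1) b' c + fun l => (-1)^n * cross Prod.fst Prod.snd n e b l, ?_, ?_⟩
  · intro l hl s1 s2
    have g : min δ (min δ1 δ2) ≤ δ := min_le_left _ _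
    have g1 : min δ (min δ1 δ2) ≤ δ1 := (min_le_right _ _).trans (min_le_left _ _)
    have g2 : min δ (min δ1 δ2) ≤ δ2 := (min_le_right _ _).trans (min_le_right _ _)
    rw [cobd_add, cobd_smul', cobd_cross _ _ _ _ _ _ (by omega), cobd_cross _ _ _ _ _ _ (by omega), Nat.sub_add_cancel hn]
    have e1 : cross Prod.fst Prod.snd (n-1) b' (cobd c) l = 0 := by
      rw [cross_congr _ _ (n-1) b' b' (cobd c) 0 l (by omega) (fun _ _ _ => rfl), zr]
      intro a ha hs
      exact hcoc a (by omega) ((s2.of_subset fun x hx => hs.subset hx).mono g)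
    have e2 : cross Prod.fst Prod.snd (n+1) (cobd e) b l = 0 := by
      rw [cross_congr _ _ (n+1) (cobd e) 0 b b l (by omega) _ (fun _ _ _ => rfl), zl]
      intro a ha hs
      exact d2 a (by omega) ((s1.of_subset fun x hx => hs.subset hx).mono g2)
    have e3 : cross Prod.fst Prod.snd n e (cobd b) l = k * cross Prod.fst Prod.snd n e c l := by
      rw [← cross_mul_right]
      refine cross_congr _ _ n e e _ _ l (by omega) (fun _ _ _ => rfl) ?_
      intro a ha hs
      exact (t1 a (by omega) ((s2.of_subset fun x hx => hs.subset hx).mono g1)).symm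
    have e4 : cross Prod.fst Prod.snd n c c l = k * cross Prod.fst Prod.snd n e c l + cross Prod.fst Prod.snd n (cobd b') c l := by
      rw [← cross_mul_left, ← cross_add_left]
      refine cross_congr _ _ n _ _ _ _ l (by omega) ?_ (fun _ _ _ => rfl)
      intro a ha hs
      exact d1 a (by omega) ((s1.of_subset fun x hx => hs.subset hx).mono g2)
    rw [e1, e2, e3, e4]
    have : ((-1:ℤ))^n * (-1)^n = 1 := by rw [← pow_add, ← two_mul, pow_mul]; norm_num
    linear_combination (- (k:ℤ) * cross Prod.fst Prod.snd n e c l) * this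
  · intro l hl s1 s2 h
    have g : min δ (min δ1 δ2) ≤ δ := min_le_left _ _
    have g1 : min δ (min δ1 δ2) ≤ δ1 := (min_le_right _ _).trans (min_le_left _ _)
    have g2 : min δ (min δ1 δ2) ≤ δ2 := (min_le_right _ _).trans (min_le_right _ _)
    rw [Pi.add_apply]
    rcases h with h | h
    · have h' : ∀ a : List K, a.Sublist (l.map Prod.fst) → ∀ x ∈ a, x ∈ Th A r := by
        intro a hs x hx
        obtain ⟨z, hz, rfl⟩ := List.mem_map.1 (hs.subset hx)
        exact h z hz
      rw [cross_congr _ _ (n-1) b' 0 c c l (by omega) _ (fun _ _ _ => rfl), zl, cross_congr _ _ n e 0 b b l (by omega) _ (fun _ _ _ => rfl), zl]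
      · simp
      · intro a ha hs
        exact d3 a (by omega) ((s1.of_subset fun x hx => hs.subset hx).mono g2) (h' a hs)
      · intro a ha hs
        exact d4 a (by omega) ((s1.of_subset fun x hx => hs.subset hx).mono g2) (h' a hs)
    · have h' : ∀ a : List K, a.Sublist (l.map Prod.snd) → ∀ x ∈ a, x ∈ Th A r := by
        intro a hs x hx
        obtain ⟨z, hz, rfl⟩ := List.mem_map.1 (hs.subset hx)
        exact h z hz
      rw [cross_congr _ _ (n-1) b' b' c 0 l (by omega) (fun _ _ _ => rfl), zr, cross_congr _ _ n e e b 0 l (by omega) (fun _ _ _ => rfl), zr]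
      · simp
      · intro a ha hs
        exact t2 a (by omega) ((s2.of_subset fun x hx => hs.subset hx).mono g1) (h' a hs)
      · intro a ha hs
        exact hvan a (by omega) ((s2.of_subset fun x hx => hs.subset hx).mono g) (fun x hx => Th_mono A hr.le (h' a hs x hx))

end
end Part11

section Part12
/-- overlap of the intervals of two subdivisions of `[0,1]` -/
noncomputable def ov {N N' : ℕ} (a : Fin N → ℝ) (a' : Fin N' → ℝ) (v : Fin N) (v' : Fin N') : ℝ :=
  min (cum a (v.val+1)) (cum a' (v'.val+1)) - min (cum a v.val) (cum a' (v'.val+1))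
    - min (cum a (v.val+1)) (cum a' v'.val) + min (cum a v.val) (cum a' v'.val)

lemma ov_continuous {Z : Type*} [TopologicalSpace Z] {N N' : ℕ} {a : Fin N → Z → ℝ} {a' : Fin N' → Z → ℝ}
    (ha : ∀ u, Continuous (a u)) (ha' : ∀ u, Continuous (a' u)) (v : Fin N) (v' : Fin N') :
    Continuous (fun z => ov (fun u => a u z) (fun u => a' u z) v v') := by
  unfold ov
  have h1 := cum_continuous ha
  have h2 := cum_continuous ha'
  exact ((((h1 _).min (h2 _)).sub ((h1 _).min (h2 _))).sub ((h1 _).min (h2 _))).add ((h1 _).min (h2 _))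

lemma ov_comm {N N' : ℕ} (a : Fin N → ℝ) (a' : Fin N' → ℝ) (v : Fin N) (v' : Fin N') : ov a a' v v' = ov a' a v' v := by
  unfold ov
  rw [min_comm (cum a (v.val+1)) (cum a' (v'.val+1)), min_comm (cum a v.val) (cum a' (v'.val+1)),
    min_comm (cum a (v.val+1)) (cum a' v'.val), min_comm (cum a v.val) (cum a' v'.val)]
  ring

section
variable {N N' : ℕ} {a : Fin N → ℝ} {a' : Fin N' → ℝ} (ha : ∀ u, 0 ≤ a u) (ha' : ∀ u, 0 ≤ a' u)

lemma ov_eq (ha : ∀ u, 0 ≤ a u) (ha' : ∀ u, 0 ≤ a' u) (v : Fin N) (v' : Fin N') :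
    ov a a' v v' = max 0 (min (cum a (v.val+1)) (cum a' (v'.val+1)) - max (cum a v.val) (cum a' v'.val)) := by
  have h1 := cum_mono ha (Nat.le_succ v.val)
  have h2 := cum_mono ha' (Nat.le_succ v'.val)
  unfold ov
  simp only [Nat.succ_eq_add_one] at h1 h2
  generalize cum a (v.val+1) = s1 at *
  generalize cum a v.val = s0 at *
  generalize cum a' (v'.val+1) = t1 at *
  generalize cum a' v'.val = t0 at *
  simp only [min_def, max_def]
  split_ifs <;> linarith

lemma ov_nonneg (ha : ∀ u, 0 ≤ a u) (ha' : ∀ u, 0 ≤ a' u) (v : Fin N) (v' : Fin N') : 0 ≤ ov a a' v v' := by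
  rw [ov_eq ha ha']; exact le_max_left _ _

lemma ov_pos (ha : ∀ u, 0 ≤ a u) (ha' : ∀ u, 0 ≤ a' u) {v : Fin N} {v' : Fin N'} (h : 0 < ov a a' v v') :
    0 < a v ∧ 0 < a' v' ∧ cum a v.val < cum a' (v'.val+1) ∧ cum a' v'.val < cum a (v.val+1) := by
  rw [ov_eq ha ha'] at h
  have h1 := cum_succ a v
  have h2 := cum_succ a' v'
  have h3 : max (cum a v.val) (cum a' v'.val) < min (cum a (v.val+1)) (cum a' (v'.val+1)) := by
    rcases lt_max_iff.1 h with h | h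
    · exact absurd h (lt_irrefl _)
    · linarith
  rw [max_lt_iff, lt_min_iff, lt_min_iff] at h3
  refine ⟨by linarith [h3.1.1], by linarith [h3.2.2], h3.1.2, h3.2.1⟩

lemma ov_chain (ha : ∀ u, 0 ≤ a u) (ha' : ∀ u, 0 ≤ a' u) {v w : Fin N} {v' w' : Fin N'} (h : 0 < ov a a' v v')
    (h' : 0 < ov a a' w w') (hvw : v < w) : v' ≤ w' := by
  by_contra hc
  push Not at hc
  have h1 := (ov_pos ha ha' h).2.2.2
  have h2 := (ov_pos ha ha' h').2.2.1
  have h3 := cum_mono ha (show v.val + 1 ≤ w.val from hvw)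
  have h4 := cum_mono ha' (show w'.val + 1 ≤ v'.val from hc)
  linarith

lemma ov_sum_right (ha : ∀ u, 0 ≤ a u) (hs : ∑ u, a u = 1) (hs' : ∑ u, a' u = 1) (v : Fin N) :
    ∑ v', ov a a' v v' = a v := by
  have key : ∀ v' : Fin N', ov a a' v v' = (fun k : ℕ => (min (cum a (v.val+1)) (cum a' (k+1)) - min (cum a v.val) (cum a' (k+1)))
      - (min (cum a (v.val+1)) (cum a' k) - min (cum a v.val) (cum a' k))) v'.val := by
    intro v'; unfold ov; ring
  rw [Finset.sum_congr rfl (fun v' _ => key v'), Fin.sum_univ_eq_sum_range (n := N')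
    (fun k : ℕ => (min (cum a (v.val+1)) (cum a' (k+1)) - min (cum a v.val) (cum a' (k+1)))
      - (min (cum a (v.val+1)) (cum a' k) - min (cum a v.val) (cum a' k))),
    Finset.sum_range_sub (fun k => min (cum a (v.val+1)) (cum a' k) - min (cum a v.val) (cum a' k))]
  have e1 : cum a' N' = 1 := by rw [cum_top a' le_rfl, hs']
  have hle : ∀ k, k ≤ N → cum a k ≤ 1 := fun k hk => by rw [← hs, ← cum_top a le_rfl]; exact cum_mono ha hk
  have hge : ∀ k, 0 ≤ cum a k := fun k => by rw [← cum_zero a]; exact cum_mono ha (Nat.zero_le _)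
  rw [e1, cum_zero, min_eq_left (hle _ v.2), min_eq_left (hle _ v.2.le), min_eq_right (hge _), min_eq_right (hge _), cum_succ]
  ring

lemma ov_sum_left (ha' : ∀ u, 0 ≤ a' u) (hs : ∑ u, a u = 1) (hs' : ∑ u, a' u = 1) (v' : Fin N') :
    ∑ v, ov a a' v v' = a' v' := by
  simp only [ov_comm a a']
  exact ov_sum_right ha' hs' hs v'

lemma ov_card (ha : ∀ u, 0 ≤ a u) (ha' : ∀ u, 0 ≤ a' u) {p q m : ℕ}
    (hp : (Finset.univ.filter fun v => 0 < a v).card ≤ p) (hq : (Finset.univ.filter fun v => 0 < a' v).card ≤ q)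
    (hm : p + q ≤ m + 1) :
    (Finset.univ.filter fun t : Fin N × Fin N' => 0 < ov a a' t.1 t.2).card ≤ m := by
  classical
  set r : Fin N → ℕ := fun v => (Finset.univ.filter fun w => 0 < a w ∧ w < v).card with hr
  set r' : Fin N' → ℕ := fun v => (Finset.univ.filter fun w => 0 < a' w ∧ w < v).card with hr'
  have rm : ∀ v w, v ≤ w → r v ≤ r w := by
    intro v w h
    apply Finset.card_le_card
    intro u hu
    simp only [Finset.mem_filter, Finset.mem_univ, true_and] at hu ⊢
    exact ⟨hu.1, hu.2.trans_le h⟩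
  have rm' : ∀ v w, v ≤ w → r' v ≤ r' w := by
    intro v w h
    apply Finset.card_le_card
    intro u hu
    simp only [Finset.mem_filter, Finset.mem_univ, true_and] at hu ⊢
    exact ⟨hu.1, hu.2.trans_le h⟩
  have rs : ∀ v w, 0 < a v → v < w → r v < r w := by
    intro v w h0 h
    apply Finset.card_lt_card
    rw [Finset.ssubset_iff_of_subset]
    · exact ⟨v, by simp [h0, h], by simp⟩
    · intro u hu
      simp only [Finset.mem_filter, Finset.mem_univ, true_and] at hu ⊢
      exact ⟨hu.1, hu.2.trans h⟩
  have rs' : ∀ v w, 0 < a' v → v < w → r' v < r' w := by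
    intro v w h0 h
    apply Finset.card_lt_card
    rw [Finset.ssubset_iff_of_subset]
    · exact ⟨v, by simp [h0, h], by simp⟩
    · intro u hu
      simp only [Finset.mem_filter, Finset.mem_univ, true_and] at hu ⊢
      exact ⟨hu.1, hu.2.trans h⟩
  have rp : ∀ v, 0 < a v → r v < p := by
    intro v h0
    refine lt_of_lt_of_le ?_ hp
    apply Finset.card_lt_card
    rw [Finset.ssubset_iff_of_subset]
    · exact ⟨v, by simp [h0], by simp⟩
    · intro u hu
      simp only [Finset.mem_filter, Finset.mem_univ, true_and] at hu ⊢
      exact hu.1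
  have rp' : ∀ v, 0 < a' v → r' v < q := by
    intro v h0
    refine lt_of_lt_of_le ?_ hq
    apply Finset.card_lt_card
    rw [Finset.ssubset_iff_of_subset]
    · exact ⟨v, by simp [h0], by simp⟩
    · intro u hu
      simp only [Finset.mem_filter, Finset.mem_univ, true_and] at hu ⊢
      exact hu.1
  have : m = (Finset.range m).card := by simp
  rw [this]
  have lt : ∀ s t : Fin N × Fin N', 0 < ov a a' s.1 s.2 → 0 < ov a a' t.1 t.2 → r s.1 + r' s.2 = r t.1 + r' t.2 → ¬ s.1 < t.1 := by
    intro s t hs ht he h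
    have h1 := rm' _ _ (ov_chain ha ha' hs ht h)
    have h2 := rs _ _ (ov_pos ha ha' hs).1 h
    omega
  apply Finset.card_le_card_of_injOn (fun t => r t.1 + r' t.2)
  · intro t ht
    simp only [Finset.coe_filter, Finset.mem_univ, true_and, Set.mem_setOf_eq] at ht
    have h1 := rp _ (ov_pos ha ha' ht).1
    have h2 := rp' _ (ov_pos ha ha' ht).2.1
    simp only [Finset.coe_range, Set.mem_Iio]; omega
  · intro s hs t ht he
    simp only [Finset.coe_filter, Finset.mem_univ, true_and, Set.mem_setOf_eq] at hs ht
    have he' : r s.1 + r' s.2 = r t.1 + r' t.2 := he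
    have e1 : s.1 = t.1 := le_antisymm (not_lt.1 (lt t s ht hs he'.symm)) (not_lt.1 (lt s t hs ht he'))
    rw [e1] at he'
    have e2 : r' s.2 = r' t.2 := by omega
    have e3 : s.2 = t.2 := by
      rcases lt_trichotomy s.2 t.2 with h | h | h
      · exact absurd (rs' _ _ (ov_pos ha ha' hs).2.1 h) (by omega)
      · exact h
      · exact absurd (rs' _ _ (ov_pos ha ha' ht).2.1 h) (by omega)
    exact Prod.ext e1 e3
end
end Part12

section Part13
lemma cobd_Wn {V R : Type*} [CommRing R] (n : ℕ) (H : ℕ → V → R) (g : V → R) (l : List V) (hl : l.length = n + 2) :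
    cobd (Wn n H g) l = (-1)^n * Wn (n+1) (fun i => if i = n then g else H i) (fun _ => 1) l := by
  induction n generalizing H l with
  | zero =>
    obtain ⟨x, y, rfl⟩ := List.length_eq_two.1 hl
    simp [Wn, cobd_cons]
  | succ n ih =>
    match l, hl with
    | x :: y :: z :: l, hl =>
      have h1 := ih (fun i => H (i+1)) (y :: z :: l) (by simpa using hl)
      have e1 : Wn (n+1+1) (fun i => if i = n+1 then g else H i) (fun _ => 1) (x :: y :: z :: l)
          = (H 0 y - H 0 x) * Wn (n+1) (fun i => if i = n then g else H (i+1)) (fun _ => 1) (y :: z :: l) := by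
        rw [Wn]
        simp
      rw [e1]
      rw [cobd_cons] at h1
      rw [cobd_cons, cobd_cons]
      have e2 : sl (sl (Wn (n+1) H g) x) y = fun l' => (H 0 y - H 0 x) * sl (Wn n (fun i => H (i+1)) g) y l' := by
        funext l'; simp [sl, Wn]
      rw [e2, cobd_smul']
      simp only [sl_apply, Wn] at h1 ⊢
      rw [pow_succ]
      linear_combination (-(H 0 y - H 0 x)) * h1

lemma Wn_cons {V R : Type*} [CommRing R] (n : ℕ) (H : ℕ → V → R) (g : V → R) (x y : V) (l : List V) :
    Wn (n+1) H g (x :: y :: l) = (H 0 y - H 0 x) * Wn n (fun i => H (i+1)) g (y :: l) := rfl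

lemma Wn_normalized {V R : Type*} [CommRing R] (n : ℕ) (H : ℕ → V → R) (g : V → R) : Normalized (Wn n H g) := by
  suffices h : ∀ a x b, Wn n H g (a ++ x :: x :: b) = 0 from fun m a x b _ => h a x b
  intro a x b
  induction a generalizing n H with
  | nil => cases n <;> simp [Wn]
  | cons y a ih =>
    cases n with
    | zero =>
      cases a <;> simp [Wn]
    | succ n =>
      obtain ⟨z, m, hz⟩ : ∃ z m, a ++ x :: x :: b = z :: m := by cases a <;> simp
      have := ih n (fun i => H (i+1))
      rw [List.cons_append, hz, Wn_cons, ← hz, this, mul_zero]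

lemma Wn_map {V W R : Type*} [CommRing R] (f : W → V) (n : ℕ) (H : ℕ → V → R) (g : V → R) (l : List W) :
    Wn n H g (l.map f) = Wn n (fun i w => H i (f w)) (fun w => g (f w)) l := by
  induction l generalizing n H with
  | nil => cases n <;> rfl
  | cons x l ih =>
    cases n with
    | zero => cases l <;> rfl
    | succ n =>
      cases l with
      | nil => rfl
      | cons y l => 
        have := ih n (fun i => H (i+1))
        rw [List.map_cons, List.map_cons, Wn_cons, Wn_cons, ← this, List.map_cons]

lemma cross_head {X Y W R : Type*} [CommRing R] (f : W → X) (g : W → Y) (n : ℕ) (c c' : List X → R) (κ : List Y → R)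
    (p : W) (ps : List W) (h : ∀ a, c (f p :: a) = c' (f p :: a)) : cross f g n c κ (p :: ps) = cross f g n c' κ (p :: ps) := by
  cases n with
  | zero => rw [cross_zero, cross_zero, h]
  | succ n =>
    rw [cross_succ, cross_succ]
    have : sl c (f p) = sl c' (f p) := funext h
    rw [this]

lemma cross_Wn {X Y W R : Type*} [CommRing R] (f : W → X) (g : W → Y) (n m : ℕ) (h : ℕ → X → R) (h' : ℕ → Y → R) (l : List W) :
    cross f g n (Wn n h (fun _ => 1)) (Wn m h' (fun _ => 1)) l
      = Wn (m+n) (fun i w => if i < n then h i (f w) else h' (i-n) (g w)) (fun _ => 1) l := by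
  induction n generalizing h l with
  | zero =>
    cases l with
    | nil => cases m <;> simp [Wn]
    | cons p l => 
      rw [cross_zero, Wn_map]
      simp [Wn]
  | succ n ih =>
    match l with
    | [] => simp [Wn]
    | [p] => simp [Wn, cross_succ]
    | p :: q :: l =>
      rw [cross_succ, cross_head f g n _ (fun a => (h 0 (f q) - h 0 (f p)) * Wn n (fun i => h (i+1)) (fun _ => 1) a), cross_mul_left, ih,
        ← add_assoc, Wn_cons]
      · simp
      · intro a; rfl

lemma Wn_color {V : Type*} (n : ℕ) (L : V → ℕ) (l : List V) (hl : l.length = n + 1) (hp : l.Pairwise (fun x y => L x ≤ L y))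
    (hn : ∀ x ∈ l, L x ≤ n) (h0 : Wn n (fun i x => if i < L x then (1:ℤ) else 0) (fun _ => 1) l ≠ 0) :
    ∀ i ≤ n, ∃ x ∈ l, L x = i := by
  have hne : l ≠ [] := by rintro rfl; simp at hl
  set v0 := l.head hne
  rw [Wn_eq_prod v0 n _ _ l hl, mul_one, Finset.prod_ne_zero_iff] at h0
  have hmem : ∀ i ≤ n, l.getD i v0 ∈ l := by
    intro i hi
    rw [List.getD_eq_getElem _ _ (by omega)]
    exact List.getElem_mem _
  have hstep : ∀ i < n, L (l.getD i v0) ≤ i ∧ i < L (l.getD (i+1) v0) := by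
    intro i hi
    have h1 := h0 i (Finset.mem_range.2 hi)
    have h2 : L (l.getD i v0) ≤ L (l.getD (i+1) v0) := by
      rw [List.getD_eq_getElem _ _ (by omega), List.getD_eq_getElem _ _ (by omega)]
      exact List.pairwise_iff_getElem.1 hp i (i+1) (by omega) (by omega) (by omega)
    split_ifs at h1 <;> first | (exfalso; omega) | omega
  intro i hi
  refine ⟨_, hmem i hi, le_antisymm ?_ ?_⟩
  · rcases hi.lt_or_eq with h | h
    · exact (hstep i h).1
    · rw [h]; exact hn _ (hmem n le_rfl)
  · rcases i with _ | i
    · exact Nat.zero_le _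
    · exact (hstep i (by omega)).2
end Part13

section Part14
lemma Wn_flip {V : Type*} (q : ℕ) (H : ℕ → V → ℤ) (l : List V) (hl : l.length = q + 2) :
    Wn (q+1) (fun i => if i = q then (fun v => 1 - H q v) else H i) (fun _ => 1) l = - Wn (q+1) H (fun _ => 1) l := by
  have hne : l ≠ [] := by rintro rfl; simp at hl
  rw [Wn_eq_prod (l.head hne) _ _ _ _ hl, Wn_eq_prod (l.head hne) _ _ _ _ hl, Finset.prod_range_succ, Finset.prod_range_succ]
  have : ∀ i ∈ Finset.range q, ((if i = q then (fun v => 1 - H q v) else H i) (l.getD (i+1) (l.head hne)) -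
      (if i = q then (fun v => 1 - H q v) else H i) (l.getD i (l.head hne))) =
      H i (l.getD (i+1) (l.head hne)) - H i (l.getD i (l.head hne)) := by
    intro i hi
    rw [if_neg (Finset.mem_range.1 hi).ne]
  rw [Finset.prod_congr rfl this]
  simp only [if_true]
  ring

lemma Wn_const {V : Type*} (n : ℕ) (H : ℕ → V → ℤ) (l : List V) (hl : l.length = n + 2) :
    Wn (n+1) (fun i => if i = n then (fun _ => 1) else H i) (fun _ => 1) l = 0 := by
  have hne : l ≠ [] := by rintro rfl; simp at hl
  rw [Wn_eq_prod (l.head hne) _ _ _ _ hl, Finset.prod_range_succ]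
  simp

lemma exists_PU_sorted {K : Type*} [MetricSpace K] [CompactSpace K] [LinearOrder K] {n : ℕ} (h : topDim K ≤ n) {ε : ℝ} (hε : 0 < ε) :
    ∃ N lam, ∃ pt : Fin N → K, PU (K := K) n ε N lam ∧ Monotone pt ∧ ∀ v x, 0 < lam v x → dist x (pt v) < ε := by
  obtain ⟨N, lam, hP⟩ := exists_PU h hε
  choose p hp using hP.small
  refine ⟨N, fun v => lam (Tuple.sort p v), p ∘ Tuple.sort p, ⟨fun v => hP.cont _, fun v x => hP.nonneg _ _, fun x => ?_, fun v => hP.small _, fun x => ?_⟩,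
    Tuple.monotone_sort p, fun v x hx => hp _ _ hx⟩
  · rw [← hP.sum x]
    exact Equiv.sum_comp (Tuple.sort p) (fun v => lam v x)
  · refine le_trans ?_ (hP.card x)
    apply Finset.card_le_card_of_injOn (Tuple.sort p)
    · intro v hv
      simpa using hv
    · exact (Tuple.sort p).injective.injOn

lemma exists_label_order {K : Type*} (L : K → ℕ) : ∃ o : LinearOrder K, ∀ x y : K, o.le x y → L x ≤ L y := by
  classical
  let o1 : LinearOrder K := linearOrderOfSTO (WellOrderingRel (α := K))
  refine ⟨LinearOrder.lift' (fun x : K => (toLex (L x, x) : ℕ ×ₗ K)) ?_, ?_⟩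
  · intro x y h
    have := congrArg (fun t => (ofLex t).2) h
    simpa using this
  · intro x y h
    have h' : (toLex (L x, x) : ℕ ×ₗ K) ≤ toLex (L y, y) := h
    rw [Prod.Lex.toLex_le_toLex] at h'
    rcases h' with h' | h'
    · exact h'.le
    · exact h'.1.le
end Part14

section Part15
section
variable {K : Type*} [MetricSpace K] [CompactSpace K]

/-- the label cochain -/
def lab (n : ℕ) (L : K → ℕ) : List K → ℤ := Wn n (fun i x => if i < L x then (1:ℤ) else 0) (fun _ => 1)

lemma lab_van [LinearOrder K] {n : ℕ} {L : K → ℕ} (hL : Monotone L) (hLn : ∀ x, L x ≤ n) {A : Set K} {δ0 : ℝ} 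
    (hA : ∀ y ∈ A, ∃ i ≤ n, ∀ x, dist x y < δ0 → L x ≠ i) {δ R : ℝ} (hR : R + δ ≤ δ0)
    (l : List K) (hl : l.length = n + 1) (hs : Sm δ l) (ht : ∀ x ∈ l, x ∈ Th A R) : Sop id (lab n L) l = 0 := by
  apply Sop_support
  intro l' hl' hp hm
  by_contra hne
  have hcol := Wn_color n L l' (hl'.trans hl) (hp.imp fun h => hL h) (fun x _ => hLn x) hne
  have hne' : l ≠ [] := by rintro rfl; simp at hl
  obtain ⟨a, ha, hda⟩ := ht _ (List.head_mem hne')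
  obtain ⟨i, hi, hmiss⟩ := hA a ha
  obtain ⟨x, hx, hxi⟩ := hcol i hi
  obtain ⟨x', hx', hxx⟩ := hm x hx
  rw [id] at hxx
  subst hxx
  refine hmiss x ?_ hxi
  have := hs x hx' _ (List.head_mem hne')
  calc dist x a ≤ dist x (l.head hne') + dist (l.head hne') a := dist_triangle _ _ _
    _ < δ + R := by linarith
    _ ≤ δ0 := by linarith

lemma lab_coc [LinearOrder K] {n : ℕ} {L : K → ℕ} (l : List K) (hl : l.length = n + 2) : cobd (Sop id (lab n L)) l = 0 := by
  rw [← Sop_cobd]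
  apply Sop_support
  intro l' hl' _ _
  rw [lab, cobd_Wn _ _ _ _ (hl'.trans hl), Wn_const _ _ _ (hl'.trans hl), mul_zero]

theorem fine_aux [LinearOrder K] {n : ℕ} (hn : 1 ≤ n) (hdim : topDim K ≤ n)
    (hp : ∀ p : ℕ, p.Prime → Vanish (ZMod p) K n) (hQ : Vanish ℚ K n)
    (L : K → ℕ) (hL : Monotone L) (hLn : ∀ x, L x ≤ n) (A : Set K) (δ0 : ℝ) (hδ0 : 0 < δ0)
    (hA : ∀ y ∈ A, ∃ i ≤ n, ∀ x, dist x y < δ0 → L x ≠ i) :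
    ∃ (G : K × K → ℕ → ℝ) (μ : K → ℕ → ℝ) (b : ℕ → ℝ),
      (∀ i, Continuous fun z => G z i) ∧ (∀ z, ∃ i < 2 * n, G z i ≠ 0) ∧
      (0 < b 0) ∧ (∀ i, b i < b (i+1)) ∧ (b (2*n-1) < 1) ∧
      (∀ x, μ x 0 = 0) ∧ (∀ x, μ x (n+1) = 1) ∧ (∀ x, Monotone (μ x)) ∧
      (∀ y i, (∀ x, dist x y < δ0 → L x ≠ i) → μ y (i+1) = μ y i) ∧
      (∀ z : K × K, z.1 ∈ A ∨ z.2 ∈ A → ∀ i < n, G z i = μ z.1 (i+1) - b i ∧ G z (n+i) = μ z.2 (i+1) - b (n+i)) := by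
  classical
  obtain ⟨q, hq⟩ : ∃ q, q + 1 = n + n := ⟨n + n - 1, by omega⟩
  obtain ⟨δ', hδ', B, hB1, hB2⟩ := prod_cobound (K := K) hn hp hQ A (Sop id (lab n L)) (δ := δ0/4) (r := δ0/4) (R := δ0/2)
    (by linarith) (by linarith) (fun l hl _ => lab_coc l hl) (fun l hl hs ht => lab_van hL hLn hA (by linarith) l hl hs ht)
  obtain ⟨s, hs0, hs1, hs2⟩ : ∃ s > 0, s ≤ δ0/4 ∧ s + s ≤ δ' := ⟨min (δ0/4) (δ'/2), lt_min (by linarith) (by linarith), min_le_left _ _,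
    by linarith [min_le_right (δ0/4) (δ'/2)]⟩
  obtain ⟨N, lam, pt, hP, hmono, hpt⟩ := exists_PU_sorted hdim hs0
  set P : Fin N ×ₗ Fin N → K × K := fun v => (pt (ofLex v).1, pt (ofLex v).2) with hPdef
  set ω : Fin N ×ₗ Fin N → K × K → ℝ := fun v z => ov (fun u => lam u z.1) (fun u => lam u z.2) (ofLex v).1 (ofLex v).2 with hω
  set H : ℕ → Fin N ×ₗ Fin N → ℤ := fun i v => if i < n then (if i < L (P v).1 then (1:ℤ) else 0) else (if i - n < L (P v).2 then (1:ℤ) else 0) with hH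
  set S : K × K → Finset (Fin N ×ₗ Fin N) := fun z => Finset.univ.filter fun v => 0 < ω v z with hS
  have memS : ∀ z v, v ∈ S z ↔ 0 < ω v z := fun z v => by simp [hS]
  have near : ∀ z v, 0 < ω v z → dist z.1 (P v).1 < s ∧ dist z.2 (P v).2 < s := by
    intro z v hv
    have := ov_pos (fun u => hP.nonneg u z.1) (fun u => hP.nonneg u z.2) hv
    exact ⟨hpt _ _ this.1, hpt _ _ this.2.1⟩
  have chain : ∀ z v w, 0 < ω v z → 0 < ω w z → v ≤ w → (P v).1 ≤ (P w).1 ∧ (P v).2 ≤ (P w).2 := by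
    intro z v w hv hw hle
    rw [Prod.Lex.le_iff] at hle
    rcases hle with h | h
    · exact ⟨hmono h.le, hmono (ov_chain (fun u => hP.nonneg u z.1) (fun u => hP.nonneg u z.2) hv hw h)⟩
    · exact ⟨hmono h.1.le, hmono h.2⟩
  have Lsm1 : ∀ z, Sm δ' ((((S z).sort).map P).map Prod.fst) := by
    intro z x hx y hy
    simp only [List.map_map, List.mem_map, Finset.mem_sort, memS, Function.comp] at hx hy
    obtain ⟨v, hv, rfl⟩ := hx
    obtain ⟨w, hw, rfl⟩ := hy
    have h1 := (near z v hv).1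
    have h2 := (near z w hw).1
    have := dist_triangle_left (P v).1 (P w).1 z.1
    linarith
  have Lsm2 : ∀ z, Sm δ' ((((S z).sort).map P).map Prod.snd) := by
    intro z x hx y hy
    simp only [List.map_map, List.mem_map, Finset.mem_sort, memS, Function.comp] at hx hy
    obtain ⟨v, hv, rfl⟩ := hx
    obtain ⟨w, hw, rfl⟩ := hy
    have h1 := (near z v hv).2
    have h2 := (near z w hw).2
    have := dist_triangle_left (P v).2 (P w).2 z.2
    linarith
  have pw : ∀ z, ((S z).sort).Pairwise (fun v w => (P v).1 ≤ (P w).1 ∧ (P v).2 ≤ (P w).2) := by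
    intro z
    refine (Finset.pairwise_sort (S z) (· ≤ ·)).imp_of_mem ?_
    intro v w hv hw h
    rw [Finset.mem_sort, memS] at hv hw
    exact chain z v w hv hw h
  have Lpw1 : ∀ z, ((((S z).sort).map P).map Prod.fst).Pairwise (· ≤ ·) := by
    intro z
    rw [List.map_map, List.pairwise_map]
    exact (pw z).imp fun h => h.1
  have Lpw2 : ∀ z, ((((S z).sort).map P).map Prod.snd).Pairwise (· ≤ ·) := by
    intro z
    rw [List.map_map, List.pairwise_map]
    exact (pw z).imp fun h => h.2
  have hu : ∀ z, (S z).card = q + 2 → Wn (q+1) H (fun _ => 1) (S z).sort = cobd B (((S z).sort).map P) := by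
    intro z hz
    have hlen : (((S z).sort).map P).length = 2 * n + 1 := by rw [List.length_map, Finset.length_sort, hz]; omega
    rw [← hB1 _ hlen (Lsm1 z) (Lsm2 z)]
    rw [cross_congr Prod.fst Prod.snd n (Sop id (lab n L)) (lab n L) (Sop id (lab n L)) (lab n L) _ (by omega)
      (fun a _ ha => Sop_id_sorted (Wn_normalized _ _ _) ((Lpw1 z).sublist ha))
      (fun a _ ha => Sop_id_sorted (Wn_normalized _ _ _) ((Lpw2 z).sublist ha))]
    unfold lab
    rw [cross_Wn, Wn_map, hq]
  set NN : Finset (Fin N ×ₗ Fin N) → Prop := fun T => (∀ v ∈ T, (P v).1 ∈ Th A (δ0/4)) ∨ (∀ v ∈ T, (P v).2 ∈ Th A (δ0/4)) with hNN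
  have hBNN : ∀ z, NN (S z) → ∀ l : List (K × K), l.Sublist (((S z).sort).map P) → l.length = 2 * n → B l = 0 := by
    intro z hz l hl hlen
    refine hB2 l hlen ((Lsm1 z).of_subset ?_) ((Lsm2 z).of_subset ?_) ?_
    · exact fun x hx => (hl.map _).subset hx
    · exact fun x hx => (hl.map _).subset hx
    · refine hz.imp ?_ ?_
      · intro h x hx
        have := hl.subset hx
        rw [List.mem_map] at this
        obtain ⟨v, hv, rfl⟩ := this
        exact h v ((Finset.mem_sort _).1 hv)
      · intro h x hx
        have := hl.subset hx
        rw [List.mem_map] at this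
        obtain ⟨v, hv, rfl⟩ := this
        exact h v ((Finset.mem_sort _).1 hv)
  have mono : ∀ z i v v', 0 < ω v z → 0 < ω v' z → v ≤ v' → H i v' = 0 → H i v = 0 := by
    intro z i v v' hv hv' hle h
    have hc := chain z v v' hv hv' hle
    have h1 := hL hc.1
    have h2 := hL hc.2
    simp only [hH] at h ⊢
    split_ifs at h ⊢ <;> first | rfl | (exfalso; omega)
  let D : GT (K × K) (Fin N ×ₗ Fin N) q :=
    { ω := ω
      H := H
      d := fun l => Wn q H (fun v => 1 - H q v) l - B (l.map P)
      NN := NN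
      hq := by omega
      cont := fun v => ov_continuous (fun u => (hP.cont u).comp continuous_fst) (fun u => (hP.cont u).comp continuous_snd) _ _
      nonneg := fun v z => ov_nonneg (fun u => hP.nonneg u z.1) (fun u => hP.nonneg u z.2) _ _
      sum := by
        intro z
        rw [Fintype.sum_equiv ofLex (fun v => ω v z) (fun t : Fin N × Fin N => ov (fun u => lam u z.1) (fun u => lam u z.2) t.1 t.2) (fun v => rfl),
          Fintype.sum_prod_type]
        simp only [ov_sum_right (fun u => hP.nonneg u z.1) (hP.sum z.1) (hP.sum z.2)]
        exact hP.sum z.1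
      H01 := by
        intro i v
        simp only [hH]
        split_ifs <;> simp
      down := fun s t h => Or.imp (fun h' v hv => h' v (h hv)) (fun h' v hv => h' v (h hv))
      card := by
        intro z
        have := ov_card (fun u => hP.nonneg u z.1) (fun u => hP.nonneg u z.2) (hP.card z.1) (hP.card z.2) (m := q + 2) (by omega)
        refine le_trans ?_ this
        apply Finset.card_le_card_of_injOn ofLex
        · intro v hv
          simpa [hω] using hv
        · exact ofLex.injective.injOn
      mono := mono
      ha := by
        intro z hz
        have hlen : ((S z).sort).length = q + 2 := by rw [Finset.length_sort]; exact hz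
        have e1 := cobd_sub (Wn q H (fun v => 1 - H q v)) (fun l => B (l.map P)) (S z).sort
        rw [cobd_map, cobd_Wn _ _ _ _ hlen, Wn_flip _ _ _ hlen, hu z hz] at e1
        have hodd : Odd q := ⟨n - 1, by omega⟩
        rw [hodd.neg_one_pow] at e1
        refine e1.trans ?_
        ring
      hb := by
        intro z hz hc
        have := hBNN z hz (((S z).sort).map P) (List.Sublist.refl _) (by rw [List.length_map, Finset.length_sort, hS, hc]; omega)
        show Wn q H (fun v => 1 - H q v) (S z).sort - B ((S z).sort.map P) = _
        rw [this, sub_zero]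
      hc := by
        intro z hz hc
        refine (hu z hc).trans ?_
        apply cobd_zero'
        intro l' hl' hlen
        refine hBNN z hz l' hl' ?_
        rw [List.length_map, Finset.length_sort, hS, hc] at hlen
        omega }
  obtain ⟨G, hG1, hG2, hG3⟩ := D.main
  set μ : K → ℕ → ℝ := fun x i => ∑ a, if L (pt a) < i then lam a x else 0 with hμ
  have mu1 : ∀ z : K × K, ∀ i < n, D.mu z (i+1) = μ z.1 (i+1) := by
    intro z i hi
    have : D.mu z (i+1) = ∑ t : Fin N × Fin N, if L (pt t.1) < i + 1 then ov (fun u => lam u z.1) (fun u => lam u z.2) t.1 t.2 else 0 := by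
      refine Fintype.sum_equiv ofLex _ _ ?_
      intro v
      have : D.H (i+1-1) v = 0 ↔ L (pt (ofLex v).1) < i + 1 := by
        show H i v = 0 ↔ _
        simp only [hH, hi, if_true, hPdef]
        split_ifs <;> simp <;> omega
      simp only [this]
      rfl
    rw [this, Fintype.sum_prod_type, hμ]
    refine Finset.sum_congr rfl fun a _ => ?_
    dsimp only
    split_ifs
    · exact ov_sum_right (fun u => hP.nonneg u z.1) (hP.sum z.1) (hP.sum z.2) a
    · simp
  have mu2 : ∀ z : K × K, ∀ i < n, D.mu z (n+i+1) = μ z.2 (i+1) := by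
    intro z i hi
    have : D.mu z (n+i+1) = ∑ t : Fin N × Fin N, if L (pt t.2) < i + 1 then ov (fun u => lam u z.1) (fun u => lam u z.2) t.1 t.2 else 0 := by
      refine Fintype.sum_equiv ofLex _ _ ?_
      intro v
      have : D.H (n+i+1-1) v = 0 ↔ L (pt (ofLex v).2) < i + 1 := by
        show H (n+i) v = 0 ↔ _
        have h1 : ¬ (n + i < n) := by omega
        have h2 : n + i - n = i := by omega
        simp only [hH, h1, h2, if_false, hPdef]
        split_ifs <;> simp <;> omega
      simp only [this]
      rfl
    rw [this, Fintype.sum_prod_type_right, hμ]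
    refine Finset.sum_congr rfl fun a _ => ?_
    dsimp only
    split_ifs
    · exact ov_sum_left (fun u => hP.nonneg u z.2) (hP.sum z.1) (hP.sum z.2) a
    · simp
  refine ⟨fun z i => if h : i < q + 1 then G z ⟨i, h⟩ else 0, μ, fun i => GT.bb q (i+1), ?_, ?_, GT.bb_pos _ _ le_rfl, fun i => GT.bb_lt _ _,
    GT.bb_lt_one _ _ (by omega), ?_, ?_, ?_, ?_, ?_⟩
  · intro i
    by_cases h : i < q + 1
    · simp only [h, dif_pos]
      exact (continuous_apply _).comp hG1
    · simp only [h, dif_neg, not_false_eq_true]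
      exact continuous_const
  · intro z
    obtain ⟨i, hi⟩ := Function.ne_iff.1 (hG2 z)
    refine ⟨i.val, by have := i.2; omega, ?_⟩
    beta_reduce
    rw [dif_pos i.2]
    exact hi
  · intro x; simp [hμ]
  · intro x
    simp only [hμ]
    rw [← hP.sum x]
    refine Finset.sum_congr rfl fun a _ => ?_
    rw [if_pos (Nat.lt_succ_of_le (hLn _))]
  · intro x i j hij
    refine Finset.sum_le_sum fun a _ => ?_
    have := hP.nonneg a x
    split_ifs <;> first | exact le_rfl | exact this | (exfalso; omega)
  · intro y i hi
    refine Finset.sum_congr rfl fun a _ => ?_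
    rcases (hP.nonneg a y).eq_or_lt with h | h
    · simp [← h]
    · have := hi (pt a) (by rw [dist_comm]; linarith [hpt a y h])
      congr 1
      apply propext; omega
  · intro z hz i hi
    have hNz : D.NN (D.supp z) := by
      refine hz.imp ?_ ?_
      · intro h v hv
        refine ⟨z.1, h, ?_⟩
        rw [dist_comm]
        linarith [(near z v (D.mem_supp.1 hv)).1]
      · intro h v hv
        refine ⟨z.2, h, ?_⟩
        rw [dist_comm]
        linarith [(near z v (D.mem_supp.1 hv)).2]
    have hF := hG3 z hNz
    beta_reduce
    rw [dif_pos (show i < q + 1 by omega), dif_pos (show n + i < q + 1 by omega), hF, ← mu1 z i hi, ← mu2 z i hi]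
    exact ⟨rfl, rfl⟩

theorem fine_thm {n : ℕ} (hn : 1 ≤ n) (hdim : topDim K ≤ n)
    (hp : ∀ p : ℕ, p.Prime → Vanish (ZMod p) K n) (hQ : Vanish ℚ K n)
    (L : K → ℕ) (hLn : ∀ x, L x ≤ n) (A : Set K) (δ0 : ℝ) (hδ0 : 0 < δ0)
    (hA : ∀ y ∈ A, ∃ i ≤ n, ∀ x, dist x y < δ0 → L x ≠ i) :
    ∃ (G : K × K → ℕ → ℝ) (μ : K → ℕ → ℝ) (b : ℕ → ℝ),
      (∀ i, Continuous fun z => G z i) ∧ (∀ z, ∃ i < 2 * n, G z i ≠ 0) ∧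
      (0 < b 0) ∧ (∀ i, b i < b (i+1)) ∧ (b (2*n-1) < 1) ∧
      (∀ x, μ x 0 = 0) ∧ (∀ x, μ x (n+1) = 1) ∧ (∀ x, Monotone (μ x)) ∧
      (∀ y i, (∀ x, dist x y < δ0 → L x ≠ i) → μ y (i+1) = μ y i) ∧
      (∀ z : K × K, z.1 ∈ A ∨ z.2 ∈ A → ∀ i < n, G z i = μ z.1 (i+1) - b i ∧ G z (n+i) = μ z.2 (i+1) - b (n+i)) := by
  obtain ⟨o, ho⟩ := exists_label_order L
  exact fine_aux hn hdim hp hQ L (fun x y h => ho x y h) hLn A δ0 hδ0 hA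
end
end Part15

section Part16
/-- cumulative function of one block -/
noncomputable def blk (n : ℕ) (F : ℕ → ℝ) (e : ℝ) (k : ℕ) : ℝ := if k = 0 then 0 else if k = n + 1 then e else F (k-1)

lemma blk_zero (n : ℕ) (F : ℕ → ℝ) (e : ℝ) : blk n F e 0 = 0 := by simp [blk]
lemma blk_top (n : ℕ) (F : ℕ → ℝ) (e : ℝ) : blk n F e (n+1) = e := by simp [blk]
lemma blk_mid (n : ℕ) (F : ℕ → ℝ) (e : ℝ) {i : ℕ} (hi : i < n) : blk n F e (i+1) = F i := by
  rw [blk, if_neg (by omega), if_neg (by omega)]; rfl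

lemma blk_sum (n : ℕ) (F : ℕ → ℝ) (e : ℝ) : ∑ i : Fin (n+1), (blk n F e (i.val+1) - blk n F e i.val) = e := by
  rw [Fin.sum_univ_eq_sum_range (fun i => blk n F e (i+1) - blk n F e i), Finset.sum_range_sub, blk_top, blk_zero, sub_zero]

lemma blk_pos {n : ℕ} (hn : 1 ≤ n) {F : ℕ → ℝ} (h0 : 0 < F 0) (hF : ∀ i, F i < F (i+1)) (h1 : F (n-1) < 1) (i : Fin (n+1)) :
    0 < blk n F 1 (i.val+1) - blk n F 1 i.val := by
  obtain ⟨i, hi⟩ := i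
  rcases i with _ | i
  · simp only [zero_add]
    rw [blk_zero, show 1 = 0 + 1 from rfl, blk_mid _ _ _ (by omega)]; linarith
  · simp only
    rcases Nat.lt_or_ge (i+1) n with h | h
    · rw [blk_mid _ _ _ h, blk_mid _ _ _ (by omega)]; linarith [hF i]
    · have : i + 1 = n := by omega
      rw [this, blk_top, ← this, blk_mid _ _ _ (by omega)]
      have : i = n - 1 := by omega
      rw [this]; linarith

lemma blk_neg {n : ℕ} {F : ℕ → ℝ} (h : ∃ i < n, F i ≠ 0) : ∃ i : Fin (n+1), blk n F 0 (i.val+1) - blk n F 0 i.val < 0 := by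
  by_contra hc
  push Not at hc
  have hz := (Finset.sum_eq_zero_iff_of_nonneg (fun i _ => hc i)).1 (blk_sum n F 0)
  have hk : ∀ k ≤ n + 1, blk n F 0 k = 0 := by
    intro k
    induction k with
    | zero => intro _; exact blk_zero _ _ _
    | succ k ih =>
      intro hk
      have := hz ⟨k, by omega⟩ (Finset.mem_univ _)
      have := ih (by omega)
      simp only at *
      linarith
  obtain ⟨i, hi, hne⟩ := h
  exact hne (by rw [← blk_mid n F 0 hi]; exact hk _ (by omega))

lemma blk_continuous {Z : Type*} [TopologicalSpace Z] (n : ℕ) (F : Z → ℕ → ℝ) (hF : ∀ i, Continuous fun z => F z i) (k : ℕ) :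
    Continuous fun z => blk n (F z) 0 k := by
  unfold blk
  split_ifs
  · exact continuous_const
  · exact continuous_const
  · exact hF _

lemma push {Z ι : Type*} [TopologicalSpace Z] [Fintype ι] [Nonempty ι] (B : ι → ℝ) (hB : ∀ i, 0 < B i) (D : Z → ι → ℝ)
    (hD : ∀ i, Continuous fun z => D z i) (hneg : ∀ z, ∃ i, D z i < 0) :
    ∃ ρ : Z → ℝ, Continuous ρ ∧ (∀ z, 0 < ρ z) ∧ (∀ z i, 0 ≤ B i + D z i / ρ z) ∧ (∀ z, ∃ i, B i + D z i / ρ z = 0) ∧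
      (∀ z, (∀ i, 0 ≤ B i + D z i) → (∃ i, B i + D z i = 0) → ρ z = 1) := by
  set ρ : Z → ℝ := fun z => Finset.univ.sup' Finset.univ_nonempty (fun i => - D z i / B i) with hρ
  have le : ∀ z i, - D z i / B i ≤ ρ z := fun z i => Finset.le_sup' (fun i => - D z i / B i) (Finset.mem_univ i)
  have eq : ∀ z, ∃ i, ρ z = - D z i / B i := by
    intro z
    obtain ⟨i, _, hi⟩ := Finset.exists_mem_eq_sup' Finset.univ_nonempty (fun i => - D z i / B i)
    exact ⟨i, hi⟩
  have pos : ∀ z, 0 < ρ z := by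
    intro z
    obtain ⟨i, hi⟩ := hneg z
    exact lt_of_lt_of_le (div_pos (by linarith) (hB i)) (le z i)
  refine ⟨ρ, ?_, pos, ?_, ?_, ?_⟩
  · exact Continuous.finset_sup'_apply _ fun i _ => (hD i).neg.div_const _
  · intro z i
    have h1 := le z i
    rw [div_le_iff₀ (hB i)] at h1
    have : - B i ≤ D z i / ρ z := by
      rw [le_div_iff₀ (pos z)]; linarith
    linarith
  · intro z
    obtain ⟨i, hi⟩ := eq z
    refine ⟨i, ?_⟩
    have hp := pos z
    have hb := hB i
    have : D z i = - ρ z * B i := by rw [hi]; field_simp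
    rw [this]; field_simp; ring
  · intro z h1 ⟨i, hi⟩
    apply le_antisymm
    · obtain ⟨j, hj⟩ := eq z
      rw [hj, div_le_one (hB j)]
      linarith [h1 j]
    · refine le_trans ?_ (le z i)
      rw [le_div_iff₀ (hB i)]; linarith
end Part16

section Part17
section
variable {K : Type*} [MetricSpace K] [CompactSpace K]

theorem masses {n : ℕ} (hn : 1 ≤ n) (hdim : topDim K ≤ n)
    (hp : ∀ p : ℕ, p.Prime → Vanish (ZMod p) K n) (hQ : Vanish ℚ K n)
    (L : K → ℕ) (hLn : ∀ x, L x ≤ n) (Miss : K → ℕ → Prop) (δ0 : ℝ) (hδ0 : 0 < δ0)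
    (hM : ∀ y i, Miss y i → ∀ x, dist x y < δ0 → L x ≠ i) :
    ∃ a1 a2 : Fin (n+1) → K × K → ℝ, (∀ i, Continuous (a1 i)) ∧ (∀ i, Continuous (a2 i)) ∧ (∀ i z, 0 ≤ a1 i z) ∧ (∀ i z, 0 ≤ a2 i z) ∧
      (∀ z, ∑ i, a1 i z = 1) ∧ (∀ z, ∑ i, a2 i z = 1) ∧ (∀ z, (∃ i, a1 i z = 0) ∨ (∃ i, a2 i z = 0)) ∧
      (∀ z i, Miss z.1 i.val → a1 i z = 0) ∧ (∀ z i, Miss z.2 i.val → a2 i z = 0) := by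
  obtain ⟨G, μ, b, hG, hG0, hb0, hb, hb1, hμ0, hμ1, hμm, hμmiss, hμG⟩ := fine_thm hn hdim hp hQ L hLn {y | ∃ i ≤ n, Miss y i} δ0 hδ0
    (fun y ⟨i, hi, hy⟩ => ⟨i, hi, hM y i hy⟩)
  have hbm : StrictMono b := strictMono_nat_of_lt_succ hb
  set B : Fin (n+1) ⊕ Fin (n+1) → ℝ := Sum.elim (fun i => blk n b 1 (i.val+1) - blk n b 1 i.val)
    (fun i => blk n (fun j => b (n+j)) 1 (i.val+1) - blk n (fun j => b (n+j)) 1 i.val) with hB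
  set D : K × K → Fin (n+1) ⊕ Fin (n+1) → ℝ := fun z => Sum.elim (fun i => blk n (G z) 0 (i.val+1) - blk n (G z) 0 i.val)
    (fun i => blk n (fun j => G z (n+j)) 0 (i.val+1) - blk n (fun j => G z (n+j)) 0 i.val) with hD
  have hBpos : ∀ i, 0 < B i := by
    rintro (i | i)
    · exact blk_pos hn hb0 hb ((hbm.monotone (show n - 1 ≤ 2 * n - 1 by omega)).trans_lt hb1) i
    · exact blk_pos (F := fun j => b (n+j)) hn (hb0.trans_le (hbm.monotone (Nat.zero_le _))) (fun i => hb _)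
        ((hbm.monotone (show n + (n - 1) ≤ 2 * n - 1 by omega)).trans_lt hb1) i
  have hDc : ∀ i, Continuous fun z => D z i := by
    rintro (i | i)
    · exact (blk_continuous n G hG _).sub (blk_continuous n G hG _)
    · exact (blk_continuous n (fun z j => G z (n+j)) (fun j => hG _) _).sub (blk_continuous n (fun z j => G z (n+j)) (fun j => hG _) _)
  have hneg : ∀ z, ∃ i, D z i < 0 := by
    intro z
    obtain ⟨i, hi, hne⟩ := hG0 z
    rcases Nat.lt_or_ge i n with h | h
    · obtain ⟨j, hj⟩ := blk_neg (n := n) (F := G z) ⟨i, h, hne⟩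
      exact ⟨Sum.inl j, hj⟩
    · obtain ⟨j, hj⟩ := blk_neg (n := n) (F := fun j => G z (n+j)) ⟨i - n, by omega, by
        beta_reduce; rw [show n + (i - n) = i by omega]; exact hne⟩
      exact ⟨Sum.inr j, hj⟩
  obtain ⟨ρ, hρc, hρ0, hρ1, hρ2, hρ3⟩ := push B hBpos D hDc hneg
  -- values at points of `A`
  have val1 : ∀ z : K × K, (z.1 ∈ {y | ∃ i ≤ n, Miss y i} ∨ z.2 ∈ {y | ∃ i ≤ n, Miss y i}) → ∀ k ≤ n + 1,
      blk n b 1 k + blk n (G z) 0 k = μ z.1 k := by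
    intro z hz k hk
    rcases k with _ | k
    · rw [blk_zero, blk_zero, hμ0, add_zero]
    · rcases Nat.lt_or_ge k n with h | h
      · rw [blk_mid _ _ _ h, blk_mid _ _ _ h, (hμG z hz k h).1]; ring
      · have : k = n := by omega
        rw [this, blk_top, blk_top, hμ1, add_zero]
  have val2 : ∀ z : K × K, (z.1 ∈ {y | ∃ i ≤ n, Miss y i} ∨ z.2 ∈ {y | ∃ i ≤ n, Miss y i}) → ∀ k ≤ n + 1,
      blk n (fun j => b (n+j)) 1 k + blk n (fun j => G z (n+j)) 0 k = μ z.2 k := by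
    intro z hz k hk
    rcases k with _ | k
    · rw [blk_zero, blk_zero, hμ0, add_zero]
    · rcases Nat.lt_or_ge k n with h | h
      · rw [blk_mid _ _ _ h, blk_mid _ _ _ h, (hμG z hz k h).2]; ring
      · have : k = n := by omega
        rw [this, blk_top, blk_top, hμ1, add_zero]
  have sum1 : ∀ z : K × K, (z.1 ∈ {y | ∃ i ≤ n, Miss y i} ∨ z.2 ∈ {y | ∃ i ≤ n, Miss y i}) → ∀ i : Fin (n+1),
      B (Sum.inl i) + D z (Sum.inl i) = μ z.1 (i.val+1) - μ z.1 i.val := by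
    intro z hz i
    rw [← val1 z hz (i.val+1) (by have := i.2; omega), ← val1 z hz i.val i.2.le]
    simp only [hB, hD, Sum.elim_inl]; ring
  have sum2 : ∀ z : K × K, (z.1 ∈ {y | ∃ i ≤ n, Miss y i} ∨ z.2 ∈ {y | ∃ i ≤ n, Miss y i}) → ∀ i : Fin (n+1),
      B (Sum.inr i) + D z (Sum.inr i) = μ z.2 (i.val+1) - μ z.2 i.val := by
    intro z hz i
    rw [← val2 z hz (i.val+1) (by have := i.2; omega), ← val2 z hz i.val i.2.le]
    simp only [hB, hD, Sum.elim_inr]; ring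
  have nn : ∀ z : K × K, (z.1 ∈ {y | ∃ i ≤ n, Miss y i} ∨ z.2 ∈ {y | ∃ i ≤ n, Miss y i}) → ∀ i, 0 ≤ B i + D z i := by
    rintro z hz (i | i)
    · rw [sum1 z hz]; exact sub_nonneg.2 (hμm _ (Nat.le_succ _))
    · rw [sum2 z hz]; exact sub_nonneg.2 (hμm _ (Nat.le_succ _))
  refine ⟨fun i z => B (Sum.inl i) + D z (Sum.inl i) / ρ z, fun i z => B (Sum.inr i) + D z (Sum.inr i) / ρ z, ?_, ?_, ?_, ?_, ?_, ?_, ?_, ?_, ?_⟩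
  · exact fun i => continuous_const.add ((hDc _).div hρc fun z => (hρ0 z).ne')
  · exact fun i => continuous_const.add ((hDc _).div hρc fun z => (hρ0 z).ne')
  · exact fun i z => hρ1 z _
  · exact fun i z => hρ1 z _
  · intro z
    rw [Finset.sum_add_distrib, ← Finset.sum_div]
    simp only [hB, hD, Sum.elim_inl]
    rw [blk_sum, blk_sum]; simp
  · intro z
    rw [Finset.sum_add_distrib, ← Finset.sum_div]
    simp only [hB, hD, Sum.elim_inr]
    rw [blk_sum, blk_sum]; simp
  · intro z
    obtain ⟨i | i, hi⟩ := hρ2 z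
    · exact Or.inl ⟨i, hi⟩
    · exact Or.inr ⟨i, hi⟩
  · intro z i hi
    have hz : (z.1 ∈ {y | ∃ i ≤ n, Miss y i} ∨ z.2 ∈ {y | ∃ i ≤ n, Miss y i}) := Or.inl ⟨i.val, by have := i.2; omega, hi⟩
    have e : B (Sum.inl i) + D z (Sum.inl i) = 0 := by
      rw [sum1 z hz, hμmiss _ _ (hM _ _ hi), sub_self]
    have := hρ3 z (nn z hz) ⟨_, e⟩
    beta_reduce
    rw [this, div_one, e]
  · intro z i hi
    have hz : (z.1 ∈ {y | ∃ i ≤ n, Miss y i} ∨ z.2 ∈ {y | ∃ i ≤ n, Miss y i}) := Or.inr ⟨i.val, by have := i.2; omega, hi⟩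
    have e : B (Sum.inr i) + D z (Sum.inr i) = 0 := by
      rw [sum2 z hz, hμmiss _ _ (hM _ _ hi), sub_self]
    have := hρ3 z (nn z hz) ⟨_, e⟩
    beta_reduce
    rw [this, div_one, e]

theorem topDim_prod_le {n : ℕ} (hn : 1 ≤ n) (hdim : topDim K ≤ n)
    (hp : ∀ p : ℕ, p.Prime → Vanish (ZMod p) K n) (hQ : Vanish ℚ K n) : topDim (K × K) ≤ ((2 * n - 1 : ℕ) : ℕ∞) := by
  classical
  refine iSup₂_le ?_
  intro α hα
  obtain ⟨ε, hε, hLeb⟩ := lebesgue_number_lemma_of_metric_sUnion (isCompact_univ (X := K × K)) hα.1 (by rw [hα.2])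
  obtain ⟨N, lam, hP⟩ := exists_PU hdim hε
  set θ : Fin (n+1) → ℝ := fun i => ((i.val : ℝ) + 1) / (n + 2) with hθ
  have hn2 : (0:ℝ) < n + 2 := by positivity
  have θinj : Function.Injective θ := by
    intro i j h
    simp only [hθ] at h
    rw [div_left_inj' hn2.ne'] at h
    exact Fin.ext (by exact_mod_cast (add_right_cancel h))
  have θ0 : ∀ i, 0 < θ i := fun i => by simp only [hθ]; positivity
  have θ1 : ∀ i, θ i < 1 := fun i => by
    simp only [hθ]; rw [div_lt_one hn2]
    have : (i.val : ℝ) < n + 1 := by exact_mod_cast i.2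
    linarith
  set U : Fin (n+1) → Fin N → Set K := fun i a => colU lam (θ i) a with hU
  have hUo : ∀ i a, IsOpen (U i a) := fun i a => colU_open hP.cont _ _
  have hcov : ∀ x : K, ∃ i a, x ∈ U i a := by
    intro x
    by_contra hc
    push Not at hc
    have := colU_miss hP θ θinj θ0 θ1 x Finset.univ (fun i _ v => hc i v)
    simp at this
  obtain ⟨δ0, hδ0, hδL⟩ := lebesgue_number_lemma_of_metric (isCompact_univ (X := K)) (c := fun t : Fin (n+1) × Fin N => U t.1 t.2)
    (fun t => hUo _ _) (by
      intro x _
      obtain ⟨i, a, h⟩ := hcov x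
      exact Set.mem_iUnion.2 ⟨(i, a), h⟩)
  have hδL' : ∀ x, ∃ t : Fin (n+1) × Fin N, Metric.ball x δ0 ⊆ U t.1 t.2 := fun x => hδL x (Set.mem_univ x)
  choose lb hlb using hδL'
  obtain ⟨a1, a2, c1, c2, n1, n2, s1, s2, hz, m1, m2⟩ := masses hn hdim hp hQ (fun x => (lb x).1.val) (fun x => by have := (lb x).1.2; omega)
    (fun y i => ∃ h : i < n + 1, ∀ a, y ∉ U ⟨i, h⟩ a) δ0 hδ0 (by
      rintro y i ⟨h, hy⟩ x hx he
      have h2 : y ∈ Metric.ball x δ0 := by rw [Metric.mem_ball, dist_comm]; exact hx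
      have h1 := hlb x h2
      have e : (lb x).1 = ⟨i, h⟩ := Fin.ext he
      rw [e] at h1
      exact hy _ h1)
  set W : (Fin (n+1) × Fin (n+1)) × (Fin N × Fin N) → Set (K × K) := fun t =>
    {z | 0 < ov (fun u => a1 u z) (fun u => a2 u z) t.1.1 t.1.2 ∧ z.1 ∈ U t.1.1 t.2.1 ∧ z.2 ∈ U t.1.2 t.2.2} with hW
  have hβ : IsOpenCover (Set.range W) ∧ Refines (Set.range W) α := by
    refine ⟨⟨?_, ?_⟩, ?_⟩
    · rintro _ ⟨t, rfl⟩
      exact (isOpen_lt continuous_const (ov_continuous c1 c2 _ _)).inter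
        (((hUo _ _).preimage continuous_fst).inter ((hUo _ _).preimage continuous_snd))
    · rw [Set.eq_univ_iff_forall]
      intro z
      have hex : ∃ i j, 0 < ov (fun u => a1 u z) (fun u => a2 u z) i j := by
        by_contra hc
        push Not at hc
        have h1 : ∑ i, a1 i z ≤ 0 := by
          refine Finset.sum_nonpos fun i _ => ?_
          rw [← ov_sum_right (a := fun u => a1 u z) (a' := fun u => a2 u z) (fun u => n1 u z) (s1 z) (s2 z) i]
          exact Finset.sum_nonpos fun j _ => hc i j
        rw [s1 z] at h1
        linarith
      obtain ⟨i, j, hij⟩ := hex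
      have hpos := ov_pos (fun u => n1 u z) (fun u => n2 u z) hij
      have hi : ∃ a, z.1 ∈ U i a := by
        by_contra hc
        push Not at hc
        have := m1 z i ⟨i.2, hc⟩
        exact absurd this hpos.1.ne'
      have hj : ∃ a, z.2 ∈ U j a := by
        by_contra hc
        push Not at hc
        have := m2 z j ⟨j.2, hc⟩
        exact absurd this hpos.2.1.ne'
      obtain ⟨a, ha⟩ := hi
      obtain ⟨b, hb⟩ := hj
      exact ⟨_, ⟨((i, j), (a, b)), rfl⟩, hij, ha, hb⟩
    · rintro _ ⟨⟨⟨i, j⟩, ⟨a, b⟩⟩, rfl⟩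
      obtain ⟨p, hpa⟩ := hP.small a
      obtain ⟨p', hpb⟩ := hP.small b
      obtain ⟨T, hT, hsub⟩ := hLeb (p, p') (Set.mem_univ _)
      refine ⟨T, hT, fun z hzW => hsub ?_⟩
      rw [Metric.mem_ball, Prod.dist_eq, max_lt_iff]
      exact ⟨hpa _ (colU_pos hzW.2.1), hpb _ (colU_pos hzW.2.2)⟩
  refine (iInf₂_le (Set.range W) hβ).trans ?_
  apply ord_le
  intro z s hs
  have hidx : ∀ T : Set (K × K), T ∈ s → ∃ t, W t = T ∧ z ∈ W t := by
    intro T hT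
    obtain ⟨⟨t, rfl⟩, hz⟩ := hs T hT
    exact ⟨t, rfl, hz⟩
  have hcardn : ∀ f : Fin (n+1) → ℝ, (Finset.univ.filter fun v => 0 < f v).card ≤ n + 1 := fun f => by
    refine (Finset.card_le_univ _).trans ?_
    simp
  have hcardz : ∀ f : Fin (n+1) → ℝ, (∃ i, f i = 0) → (Finset.univ.filter fun v => 0 < f v).card ≤ n := by
    rintro f ⟨i, hi⟩
    have : (Finset.univ.filter fun v => 0 < f v).card < (Finset.univ : Finset (Fin (n+1))).card := by
      apply Finset.card_lt_card
      rw [Finset.ssubset_iff_of_subset (Finset.filter_subset _ _)]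
      exact ⟨i, Finset.mem_univ _, by simp [hi]⟩
    simp at this
    omega
  have hc : (Finset.univ.filter fun t : Fin (n+1) × Fin (n+1) => 0 < ov (fun u => a1 u z) (fun u => a2 u z) t.1 t.2).card ≤ 2 * n := by
    rcases hz z with h | h
    · exact ov_card (fun u => n1 u z) (fun u => n2 u z) (hcardz _ h) (hcardn _) (by omega)
    · exact ov_card (fun u => n1 u z) (fun u => n2 u z) (hcardn _) (hcardz _ h) (by omega)
  have h2n : 2 * n - 1 + 1 = 2 * n := by omega
  rw [h2n]
  refine le_trans ?_ hc
  choose idx hidx1 hidx2 using hidx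
  refine Finset.card_le_card_of_injOn (fun T => if h : T ∈ s then (idx T h).1 else (0, 0)) ?_ ?_
  · intro T hT
    have hT' : T ∈ s := hT
    simp only [hT', dif_pos]
    have := hidx2 T hT'
    simpa using this.1
  · intro T hT T' hT' he
    have hT1 : T ∈ s := hT
    have hT2 : T' ∈ s := hT'
    simp only [hT1, hT2, dif_pos] at he
    rw [← hidx1 T hT1, ← hidx1 T' hT2]
    have g1 := hidx2 T hT1
    have g2 := hidx2 T' hT2
    congr 1
    generalize idx T hT1 = t at *
    generalize idx T' hT2 = t' at *
    obtain ⟨t, t2⟩ := t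
    obtain ⟨t', t2'⟩ := t'
    simp only at he
    subst he
    have e1 : t2.1 = t2'.1 := colU_disj hP.nonneg g1.2.1 g2.2.1
    have e2 : t2.2 = t2'.2 := colU_disj hP.nonneg g1.2.2 g2.2.2
    rw [Prod.ext e1 e2]
end
end Part17

section Part18
theorem main_thm {K : Type*} [MetricSpace K] [CompactSpace K]
    (hfin : topDim K ≠ ⊤)
    (hbasic : topDim (K × K) = 2 * topDim K)
    (d : (ℤ → K) → (ℤ → K) → ℝ) (hd : IsCompatMetric d) :
    mdim (shift K) d = (topDim K : ℝ≥0∞) := by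
  obtain ⟨n, hn⟩ := ENat.ne_top_iff_exists.1 hfin
  rw [← hn] at hbasic ⊢
  have hdim : topDim K ≤ n := hn.ge
  have hcast : (((n : ℕ) : ℕ∞) : ℝ≥0∞) = (n : ℝ≥0∞) := by simp
  rw [hcast]
  apply le_antisymm (upper_bound hdim d hd)
  rcases Nat.eq_zero_or_pos n with h0 | h0
  · rw [h0]; simp
  have hne : Nonempty K := by
    by_contra hemp
    rw [not_nonempty_iff] at hemp
    have h1 : topDim K ≤ ((0 : ℕ) : ℕ∞) := by
      refine iSup₂_le fun α hα => ?_
      refine (iInf₂_le α ⟨hα, fun V hV => ⟨V, hV, subset_rfl⟩⟩).trans ?_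
      apply ord_le
      intro x
      exact isEmptyElim x
    rw [← hn] at h1
    have : n ≤ 0 := by exact_mod_cast h1
    omega
  by_cases hp : ∀ p : ℕ, p.Prime → Vanish (ZMod p) K n
  · by_cases hQ : Vanish ℚ K n
    · exfalso
      have h1 := topDim_prod_le h0 hdim hp hQ
      rw [hbasic] at h1
      have h2 : 2 * n ≤ 2 * n - 1 := by exact_mod_cast h1
      omega
    · obtain ⟨δ, η, c, 𝒜, hδ, hη, hR⟩ := Rob.of_not_vanish hQ
      exact lower_bound hR hδ hη d hd
  · push Not at hp
    obtain ⟨p, hpp, hv⟩ := hp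
    haveI : Fact p.Prime := ⟨hpp⟩
    obtain ⟨δ, η, c, 𝒜, hδ, hη, hR⟩ := Rob.of_not_vanish (F := ZMod p) hv
    exact lower_bound hR hδ hη d hd
end Part18

/-- if the finite dimensional compact metric space `K` has basic type
(`dim K² = 2 dim K`), then the mean dimension of the full shift on the alphabet `K`
(computed with any metric compatible with the product topology on `K^ℤ`) equals
`dim K`. -/
theorem mdim_fullshift_of_basic {K : Type*} [MetricSpace K] [CompactSpace K]
    (hfin : topDim K ≠ ⊤)
    (hbasic : topDim (K × K) = 2 * topDim K)
    (d : (ℤ → K) → (ℤ → K) → ℝ) (hd : IsCompatMetric d) :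
    mdim (shift K) d = (topDim K : ℝ≥0∞) := by
  exact main_thm hfin hbasic d hd

end MeanDimPaper
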